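/- Let α be an irrational number which is strong Diophantine, i.e. there exist γ > 0 and τ > 0 such that q_{n+1} ≤ γ^{-1} q_n (log q_n)^τ for all n ∈ ℕ. Then for every s > 2 the Lyapunov exponent is discontinuous at some point of the Gevrey class G^s(S¹, SL(2,ℝ)) in the G^s topology: there exist D ∈ G^s(S¹, SL(2,ℝ)) with L(α,D) > 0, a constant K > 0, and a sequence A_j ∈ G^{s,K}(S¹, SL(2,ℝ)) such that ‖A_j − D‖_{s,K} → 0 as j → ∞ but limsup_{j→∞} L(α, A_j) < L(α, D). -/

import Mathlib

open Filter MeasureTheory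

noncomputable section

attribute [local instance] Matrix.normedAddCommGroup Matrix.normedSpace

/-- The Euclidean operator norm of a 2×2 real matrix. -/
def opNorm (M : Matrix (Fin 2) (Fin 2) ℝ) : ℝ :=
  ‖Matrix.toEuclideanCLM (𝕜 := ℝ) M‖

/-- The iterated cocycle `A^n(x) = A(x + (n-1)α) ⋯ A(x + α) A(x)` over the rotation by `α`. -/
def cocIter (α : ℝ) (A : ℝ → Matrix (Fin 2) (Fin 2) ℝ) :
    ℕ → ℝ → Matrix (Fin 2) (Fin 2) ℝ
  | 0, _ => 1
  | n + 1, x => A (x + (n : ℝ) * α) * cocIter α A n x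

/-- The Lyapunov exponent `L(α, A) = lim_n (1/n) ∫_{S¹} log ‖A^n(x)‖ dx` (the limit exists by
subadditivity, so it agrees with the `limsup` used here). -/
def lyap (α : ℝ) (A : ℝ → Matrix (Fin 2) (Fin 2) ℝ) : ℝ :=
  limsup (fun n : ℕ =>
    (n : ℝ)⁻¹ * ∫ x in (0 : ℝ)..1, Real.log (opNorm (cocIter α A n x))) atTop

/-- The `C^l` norm `max_{0 ≤ k ≤ l} sup_x ‖∂^k A(x)‖` of a matrix-valued map on the circle. -/
def cNorm (l : ℕ) (A : ℝ → Matrix (Fin 2) (Fin 2) ℝ) : ℝ :=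
  ⨆ k : Fin (l + 1), ⨆ x : ℝ, ‖iteratedDeriv (k : ℕ) A x‖

/-- Gauss map iterates of `α`: `x₀ = {α}`, `x_{n+1} = {1/x_n}`. -/
def gaussIter (α : ℝ) : ℕ → ℝ
  | 0 => Int.fract α
  | n + 1 => Int.fract (gaussIter α n)⁻¹

/-- `cfa α n` is the partial quotient `a_{n+1} = ⌊1/x_n⌋` of the continued fraction of `α`. -/
def cfa (α : ℝ) (n : ℕ) : ℕ := ⌊(gaussIter α n)⁻¹⌋₊

/-- Denominators `q_n` of the continued fraction convergents of `α`:
`q₀ = 1`, `q₁ = a₁`, `q_{n+2} = a_{n+2} q_{n+1} + q_n`. -/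
def cfq (α : ℝ) : ℕ → ℕ
  | 0 => 1
  | 1 => cfa α 0
  | n + 2 => cfa α (n + 1) * cfq α (n + 1) + cfq α n

/-- `sup_x ‖∂^k A(x)‖`. -/
def supDeriv (k : ℕ) (A : ℝ → Matrix (Fin 2) (Fin 2) ℝ) : ℝ :=
  ⨆ x : ℝ, ‖iteratedDeriv k A x‖

/-- The `k`-th term of the Gevrey norm `‖A‖_{s,K}`. -/
def gevreySeq (s K : ℝ) (A : ℝ → Matrix (Fin 2) (Fin 2) ℝ) (k : ℕ) : ℝ :=
  (1 + (k : ℝ) ^ 2) * supDeriv k A / (K ^ k * (k.factorial : ℝ) ^ s)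

/-- The Gevrey norm `‖A‖_{s,K} = (4π²/3) sup_k (1+k²) sup_x ‖∂^k A(x)‖ / (K^k (k!)^s)`. -/
def gevreyNorm (s K : ℝ) (A : ℝ → Matrix (Fin 2) (Fin 2) ℝ) : ℝ :=
  (4 * Real.pi ^ 2 / 3) * ⨆ k : ℕ, gevreySeq s K A k

/-- Membership in the Gevrey class `G^{s,K}`: `A` is smooth, each `sup_x ‖∂^k A(x)‖` is
finite, and the defining sequence of `‖A‖_{s,K}` is bounded. -/
def MemGevrey (s K : ℝ) (A : ℝ → Matrix (Fin 2) (Fin 2) ℝ) : Prop :=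
  ContDiff ℝ (⊤ : ℕ∞) A ∧
    (∀ k : ℕ, BddAbove (Set.range fun x : ℝ => ‖iteratedDeriv k A x‖)) ∧
    BddAbove (Set.range (gevreySeq s K A))

/-- Weighted bounds on all derivatives of `f` at `x`. -/
def Jet (s K M : ℝ) (f : ℝ → ℝ) (x : ℝ) : Prop :=
  ∀ n : ℕ, (1 + (n : ℝ) ^ 2) * |iteratedDeriv n f x| ≤ M * K ^ n * (n.factorial : ℝ) ^ s

/-- Smoothness of a real function of one real variable. -/
abbrev Smooth (f : ℝ → ℝ) : Prop := ContDiff ℝ (⊤ : ℕ∞) f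

theorem Smooth.at_nat {f : ℝ → ℝ} (hf : Smooth f) (n : ℕ) (x : ℝ) : ContDiffAt ℝ n f x :=
  (hf.of_le (by exact_mod_cast le_top)).contDiffAt

theorem sum_inv_one_add_sq_le (n : ℕ) :
    ∑ j ∈ Finset.range (n + 1), (1 + (j : ℝ) ^ 2)⁻¹ ≤ 3 - 2 / ((n : ℝ) + 1) := by
  induction n with
  | zero => norm_num
  | succ n ih =>
    rw [Finset.sum_range_succ]
    have h : (1 + ((n + 1 : ℕ) : ℝ) ^ 2)⁻¹ ≤ 2 / ((n : ℝ) + 1) - 2 / (((n + 1 : ℕ) : ℝ) + 1) := by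
      push_cast
      have : (0 : ℝ) ≤ n := Nat.cast_nonneg n
      rw [inv_eq_one_div, div_sub_div _ _ (by positivity) (by positivity),
        div_le_div_iff₀ (by positivity) (by positivity)]
      nlinarith
    linarith

theorem choose_mul_factorial_rpow_le {s : ℝ} (hs : 1 ≤ s) {n j : ℕ} (hj : j ≤ n) :
    (n.choose j : ℝ) * ((j.factorial : ℝ) ^ s * ((n - j).factorial : ℝ) ^ s) ≤
      (n.factorial : ℝ) ^ s := by
  have h := Nat.choose_mul_factorial_mul_factorial hj
  have hc : (1 : ℝ) ≤ n.choose j := by exact_mod_cast Nat.choose_pos hj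
  have h1 : (n.choose j : ℝ) ≤ (n.choose j : ℝ) ^ s := Real.self_le_rpow_of_one_le hc hs
  have h2 : (n.factorial : ℝ) = n.choose j * (j.factorial * (n - j).factorial) := by
    rw [← h]; push_cast; ring
  rw [h2, Real.mul_rpow (by positivity) (by positivity),
    Real.mul_rpow (by positivity) (by positivity)]
  gcongr

/-- The convolution estimate behind all product rules. -/
theorem convolution_weight_le {s : ℝ} (hs : 1 ≤ s) (n : ℕ) :
    ∑ j ∈ Finset.range (n + 1), (1 + (n : ℝ) ^ 2) * (n.choose j *
      ((j.factorial : ℝ) ^ s / (1 + (j : ℝ) ^ 2) *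
        (((n - j).factorial : ℝ) ^ s / (1 + ((n - j : ℕ) : ℝ) ^ 2)))) ≤
      12 * (n.factorial : ℝ) ^ s := by
  have key : ∀ j ∈ Finset.range (n + 1), (1 + (n : ℝ) ^ 2) * (n.choose j *
      ((j.factorial : ℝ) ^ s / (1 + (j : ℝ) ^ 2) *
        (((n - j).factorial : ℝ) ^ s / (1 + ((n - j : ℕ) : ℝ) ^ 2)))) ≤
      (n.factorial : ℝ) ^ s * (2 * (1 + (j : ℝ) ^ 2)⁻¹ + 2 * (1 + ((n - j : ℕ) : ℝ) ^ 2)⁻¹) := by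
    intro j hj
    have hj' : j ≤ n := by simpa [Nat.lt_succ_iff] using hj
    have hn : (n : ℝ) = j + ((n - j : ℕ) : ℝ) := by push_cast [Nat.cast_sub hj']; ring
    have h1 := choose_mul_factorial_rpow_le hs hj'
    have h2 : (1 + (n : ℝ) ^ 2) / ((1 + (j : ℝ) ^ 2) * (1 + ((n - j : ℕ) : ℝ) ^ 2)) ≤
        2 * (1 + (j : ℝ) ^ 2)⁻¹ + 2 * (1 + ((n - j : ℕ) : ℝ) ^ 2)⁻¹ := by
      rw [hn]
      generalize ((n - j : ℕ) : ℝ) = i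
      rw [div_le_iff₀ (by positivity)]
      have : (2 * (1 + (j : ℝ) ^ 2)⁻¹ + 2 * (1 + i ^ 2)⁻¹) * ((1 + (j : ℝ) ^ 2) * (1 + i ^ 2)) =
        2 * (1 + i ^ 2) + 2 * (1 + (j : ℝ) ^ 2) := by field_simp
      rw [this]; nlinarith [sq_nonneg ((j : ℝ) - i)]
    calc _ = ((n.choose j : ℝ) * ((j.factorial : ℝ) ^ s * ((n - j).factorial : ℝ) ^ s)) *
          ((1 + (n : ℝ) ^ 2) / ((1 + (j : ℝ) ^ 2) * (1 + ((n - j : ℕ) : ℝ) ^ 2))) := by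
            field_simp
      _ ≤ _ := by gcongr
  refine (Finset.sum_le_sum key).trans ?_
  rw [← Finset.mul_sum, Finset.sum_add_distrib, ← Finset.mul_sum, ← Finset.mul_sum]
  have h3 : ∑ j ∈ Finset.range (n + 1), (1 + ((n - j : ℕ) : ℝ) ^ 2)⁻¹ =
      ∑ j ∈ Finset.range (n + 1), (1 + (j : ℝ) ^ 2)⁻¹ := by
    have := Finset.sum_range_reflect (fun j : ℕ => (1 + (j : ℝ) ^ 2)⁻¹) (n + 1)
    simpa using this
  rw [h3]
  have h4 := sum_inv_one_add_sq_le n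
  have h5 : (0 : ℝ) ≤ 2 / ((n : ℝ) + 1) := by positivity
  have h6 : (0 : ℝ) ≤ (n.factorial : ℝ) ^ s := by positivity
  nlinarith

theorem Jet.nonneg {s K M : ℝ} {f : ℝ → ℝ} {x : ℝ} (h : Jet s K M f x) : 0 ≤ M := by
  have := h 0
  simp at this
  exact (abs_nonneg _).trans this

theorem Jet.div_le {s K M : ℝ} {f : ℝ → ℝ} {x : ℝ} (h : Jet s K M f x) (n : ℕ) :
    |iteratedDeriv n f x| ≤ M * K ^ n * ((n.factorial : ℝ) ^ s / (1 + (n : ℝ) ^ 2)) := by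
  rw [← mul_div_assoc, le_div_iff₀ (by positivity), mul_comm]
  exact h n

theorem Jet.mono {s K M K' M' : ℝ} {f : ℝ → ℝ} {x : ℝ} (h : Jet s K M f x) (hK : 0 ≤ K)
    (hKK : K ≤ K') (hM : M ≤ M') : Jet s K' M' f x := by
  intro n
  refine (h n).trans ?_
  have := h.nonneg
  have h' := this.trans hM
  gcongr

theorem Jet.mono_const {s K M M' : ℝ} {f : ℝ → ℝ} {x : ℝ} (h : Jet s K M f x) (hK : 0 ≤ K)
    (hM : M ≤ M') : Jet s K M' f x := h.mono hK le_rfl hM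

theorem Jet.add {s K M N : ℝ} {f g : ℝ → ℝ} {x : ℝ} (hf : Smooth f) (hg : Smooth g)
    (h : Jet s K M f x) (h' : Jet s K N g x) : Jet s K (M + N) (fun y => f y + g y) x := by
  intro n
  have : iteratedDeriv n (fun y => f y + g y) x = iteratedDeriv n f x + iteratedDeriv n g x :=
    iteratedDeriv_fun_add (hf.at_nat n x) (hg.at_nat n x)
  rw [this]
  have h1 := h n
  have h2 := h' n
  have h3 := abs_add_le (iteratedDeriv n f x) (iteratedDeriv n g x)
  have : 0 ≤ 1 + (n : ℝ) ^ 2 := by positivity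
  nlinarith

theorem Jet.const_mul {s K M : ℝ} {f : ℝ → ℝ} {x : ℝ} (h : Jet s K M f x) (a : ℝ) :
    Jet s K (|a| * M) (fun y => a * f y) x := by
  intro n
  rw [iteratedDeriv_const_mul_field, abs_mul]
  have h1 := h n
  have := abs_nonneg a
  nlinarith [mul_le_mul_of_nonneg_left h1 this]

theorem Jet.sub {s K M N : ℝ} {f g : ℝ → ℝ} {x : ℝ} (hf : Smooth f) (hg : Smooth g)
    (h : Jet s K M f x) (h' : Jet s K N g x) : Jet s K (M + N) (fun y => f y - g y) x := by
  have h2 := h'.const_mul (-1)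
  simp only [abs_neg, abs_one, one_mul, neg_mul] at h2
  simpa only [sub_eq_add_neg] using h.add hf hg.neg h2

theorem jet_const {s K : ℝ} (hK : 0 ≤ K) (a x : ℝ) : Jet s K |a| (fun _ => a) x := by
  intro n
  rw [iteratedDeriv_const]
  split_ifs with h
  · subst h; simp
  · simp; positivity

theorem jet_sum {ι : Type*} {s K : ℝ} (hK : 0 ≤ K) {x : ℝ} (S : Finset ι) (f : ι → ℝ → ℝ)
    (M : ι → ℝ) (hf : ∀ i, Smooth (f i)) (h : ∀ i ∈ S, Jet s K (M i) (f i) x) :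
    Jet s K (∑ i ∈ S, M i) (fun y => ∑ i ∈ S, f i y) x := by
  classical
  induction S using Finset.induction_on with
  | empty => simpa using jet_const (s := s) hK 0 x
  | insert i S hi ih =>
    simp only [Finset.sum_insert hi]
    exact (h i (by simp)).add (hf i) (ContDiff.sum fun j _ => hf j)
      (ih fun j hj => h j (by simp [hj]))

theorem Jet.mul {s K M N : ℝ} (hs : 1 ≤ s) (hK : 0 ≤ K) {f g : ℝ → ℝ} {x : ℝ} (hf : Smooth f)
    (hg : Smooth g) (h : Jet s K M f x) (h' : Jet s K N g x) :
    Jet s K (12 * M * N) (fun y => f y * g y) x := by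
  intro n
  have e : iteratedDeriv n (fun y => f y * g y) x = _ :=
    iteratedDeriv_fun_mul (hf.at_nat n x) (hg.at_nat n x)
  rw [e]
  have hM := h.nonneg
  have hN := h'.nonneg
  calc _ ≤ (1 + (n : ℝ) ^ 2) * ∑ j ∈ Finset.range (n + 1),
        |(n.choose j : ℝ) * iteratedDeriv j f x * iteratedDeriv (n - j) g x| := by
          gcongr; exact Finset.abs_sum_le_sum_abs _ _
    _ ≤ ∑ j ∈ Finset.range (n + 1), (M * N * K ^ n) * ((1 + (n : ℝ) ^ 2) * (n.choose j *
      ((j.factorial : ℝ) ^ s / (1 + (j : ℝ) ^ 2) *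
        (((n - j).factorial : ℝ) ^ s / (1 + ((n - j : ℕ) : ℝ) ^ 2))))) := by
          rw [Finset.mul_sum]
          refine Finset.sum_le_sum fun j hj => ?_
          have hj' : j ≤ n := by simpa [Nat.lt_succ_iff] using hj
          rw [abs_mul, abs_mul, Nat.abs_cast]
          have h1 := h.div_le j
          have h2 := h'.div_le (n - j)
          have hk : K ^ n = K ^ j * K ^ (n - j) := by rw [← pow_add]; congr 1; omega
          calc _ ≤ (1 + (n : ℝ) ^ 2) * (n.choose j *
                (M * K ^ j * ((j.factorial : ℝ) ^ s / (1 + (j : ℝ) ^ 2))) *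
                (N * K ^ (n - j) * (((n - j).factorial : ℝ) ^ s /
                  (1 + ((n - j : ℕ) : ℝ) ^ 2)))) := by gcongr
            _ = _ := by rw [hk]; ring
    _ ≤ (M * N * K ^ n) * (12 * (n.factorial : ℝ) ^ s) := by
          rw [← Finset.mul_sum]
          gcongr
          exact convolution_weight_le hs n
    _ = _ := by ring

theorem Jet.pow {s K M : ℝ} (hs : 1 ≤ s) (hK : 0 ≤ K) {f : ℝ → ℝ} {x : ℝ} (hf : Smooth f)
    (h : Jet s K M f x) (p : ℕ) : Jet s K ((12 * M) ^ p) (fun y => f y ^ p) x := by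
  induction p with
  | zero => simpa using jet_const (s := s) hK 1 x
  | succ p ih =>
    simp only [pow_succ]
    refine (ih.mul hs hK (hf.pow p) hf h).mono_const hK (le_of_eq (by ring))

theorem jet_exp_of_small {s K m : ℝ} (hs : 1 ≤ s) (hK : 0 ≤ K) (hm : 12 * m ≤ 1) {ψ : ℝ → ℝ}
    {x : ℝ} (hψ : Smooth ψ) (h : ∀ n : ℕ, 1 ≤ n →
      (1 + (n : ℝ) ^ 2) * |iteratedDeriv n ψ x| ≤ m * K ^ n * (n.factorial : ℝ) ^ s) :
    Jet s K (Real.exp (ψ x)) (fun y => Real.exp (ψ y)) x := by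
  intro n
  induction n using Nat.strong_induction_on with
  | _ n ih =>
    rcases n with _ | n
    · simp
    have hE : Smooth fun y => Real.exp (ψ y) := hψ.exp
    have hd : deriv (fun y => Real.exp (ψ y)) = fun y => deriv ψ y * Real.exp (ψ y) := by
      funext y
      rw [deriv_exp ((hψ.differentiable (by simp)).differentiableAt)]
      ring
    have hψ' : Smooth (deriv ψ) := (contDiff_infty_iff_deriv.1 hψ).2
    rw [iteratedDeriv_succ', hd, iteratedDeriv_fun_mul (hψ'.at_nat n x) (hE.at_nat n x)]
    have hm0 : 0 ≤ m * K := by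
      have := h 1 le_rfl
      simp at this
      exact (by positivity : (0 : ℝ) ≤ (1 + 1) * |deriv ψ x|).trans this
    have hterm : ∀ j : ℕ, |iteratedDeriv j (deriv ψ) x| ≤
        m * K ^ (j + 1) * (((j + 1).factorial : ℝ) ^ s / (1 + ((j + 1 : ℕ) : ℝ) ^ 2)) := by
      intro j
      rw [← iteratedDeriv_succ', ← mul_div_assoc, le_div_iff₀ (by positivity), mul_comm]
      exact h (j + 1) (by omega)
    have hterm2 : ∀ j : ℕ, j ≤ n → |iteratedDeriv j (fun y => Real.exp (ψ y)) x| ≤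
        Real.exp (ψ x) * K ^ j * ((j.factorial : ℝ) ^ s / (1 + (j : ℝ) ^ 2)) := by
      intro j hj
      rw [← mul_div_assoc, le_div_iff₀ (by positivity), mul_comm]
      exact ih j (by omega)
    have hmK : 0 ≤ m * K ^ (n + 1) := by rw [pow_succ']; rw [← mul_assoc]; positivity
    calc _ ≤ (1 + ((n + 1 : ℕ) : ℝ) ^ 2) * ∑ j ∈ Finset.range (n + 1),
        |(n.choose j : ℝ) * iteratedDeriv j (deriv ψ) x *
          iteratedDeriv (n - j) (fun y => Real.exp (ψ y)) x| := by
          gcongr; exact Finset.abs_sum_le_sum_abs _ _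
      _ ≤ ∑ j ∈ Finset.range (n + 1), (m * K ^ (n + 1) * Real.exp (ψ x)) *
        ((1 + ((n + 1 : ℕ) : ℝ) ^ 2) * ((n + 1).choose (j + 1) *
        (((j + 1).factorial : ℝ) ^ s / (1 + ((j + 1 : ℕ) : ℝ) ^ 2) *
        (((n + 1 - (j + 1)).factorial : ℝ) ^ s / (1 + ((n + 1 - (j + 1) : ℕ) : ℝ) ^ 2))))) := by
          rw [Finset.mul_sum]
          refine Finset.sum_le_sum fun j hj => ?_
          have hj' : j ≤ n := by simpa [Nat.lt_succ_iff] using hj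
          rw [abs_mul, abs_mul, Nat.abs_cast]
          have h1 := hterm j
          have h2 := hterm2 (n - j) (by omega)
          have hk : K ^ (n + 1) = K ^ (j + 1) * K ^ (n - j) := by
            rw [← pow_add]; congr 1; omega
          have hc : (n.choose j : ℝ) ≤ ((n + 1).choose (j + 1) : ℕ) := by
            rw [Nat.choose_succ_succ]; push_cast
            linarith [(Nat.cast_nonneg (n.choose (j + 1)) : (0 : ℝ) ≤ _)]
          have hmj : 0 ≤ m * K ^ (j + 1) := by rw [pow_succ']; rw [← mul_assoc]; positivity
          have e : n + 1 - (j + 1) = n - j := by omega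
          rw [e]
          calc _ ≤ (1 + ((n + 1 : ℕ) : ℝ) ^ 2) * (((n + 1).choose (j + 1) : ℕ) *
                (m * K ^ (j + 1) * (((j + 1).factorial : ℝ) ^ s / (1 + ((j + 1 : ℕ) : ℝ) ^ 2))) *
                (Real.exp (ψ x) * K ^ (n - j) * (((n - j).factorial : ℝ) ^ s /
                  (1 + ((n - j : ℕ) : ℝ) ^ 2)))) := by gcongr
            _ = _ := by rw [hk]; ring
      _ ≤ (m * K ^ (n + 1) * Real.exp (ψ x)) * (12 * ((n + 1).factorial : ℝ) ^ s) := by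
          rw [← Finset.mul_sum]
          gcongr
          refine le_trans ?_ (convolution_weight_le hs (n + 1))
          rw [Finset.sum_range_succ' _ (n + 1)]
          exact le_add_of_nonneg_right (by positivity)
      _ = (12 * m) * (Real.exp (ψ x) * K ^ (n + 1) * ((n + 1).factorial : ℝ) ^ s) := by ring
      _ ≤ _ := mul_le_of_le_one_left (by positivity) hm

/-- Derivative bounds for an exponential. -/
theorem jet_exp {s K m : ℝ} (hs : 1 ≤ s) (hK : 0 ≤ K) (hm : 0 ≤ m) {ψ : ℝ → ℝ}
    {x : ℝ} (hψ : Smooth ψ) (h : ∀ n : ℕ, 1 ≤ n →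
      (1 + (n : ℝ) ^ 2) * |iteratedDeriv n ψ x| ≤ m * K ^ n * (n.factorial : ℝ) ^ s) :
    Jet s K (Real.exp (ψ x + 36 * m + 6)) (fun y => Real.exp (ψ y)) x := by
  obtain ⟨p, hp⟩ : ∃ p : ℕ, p = ⌈12 * m⌉₊ + 1 := ⟨_, rfl⟩
  have hp0 : (0 : ℝ) < p := by rw [hp]; positivity
  have hp1 : 12 * m ≤ p := by rw [hp]; push_cast; linarith [Nat.le_ceil (12 * m)]
  have hp2 : (p : ℝ) ≤ 12 * m + 2 := by
    rw [hp]; push_cast; linarith [Nat.ceil_lt_add_one (show 0 ≤ 12 * m by positivity)]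
  have h1 : Jet s K (Real.exp ((p : ℝ)⁻¹ * ψ x)) (fun y => Real.exp ((p : ℝ)⁻¹ * ψ y)) x := by
    refine jet_exp_of_small (m := (p : ℝ)⁻¹ * m) hs hK ?_ (contDiff_const.mul hψ) ?_
    · rw [inv_mul_eq_div, ← mul_div_assoc, div_le_one hp0]; exact hp1
    · intro n hn
      rw [iteratedDeriv_const_mul_field, abs_mul, abs_of_nonneg (inv_nonneg.2 hp0.le)]
      have := mul_le_mul_of_nonneg_left (h n hn) (inv_nonneg.2 hp0.le)
      linarith
  have h2 := h1.pow hs hK (contDiff_const.mul hψ).exp p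
  have e : ∀ y, Real.exp ((p : ℝ)⁻¹ * ψ y) ^ p = Real.exp (ψ y) := by
    intro y
    rw [← Real.exp_nat_mul]; congr 1; field_simp
  simp only [e] at h2
  refine h2.mono_const hK ?_
  rw [mul_pow, e]
  have h12 : (12 : ℝ) ≤ Real.exp 3 := by
    have h271 := Real.exp_one_gt_d9
    have : Real.exp 3 = Real.exp 1 ^ 3 := by rw [← Real.exp_nat_mul]; norm_num
    rw [this]
    calc (12 : ℝ) ≤ 2.7 ^ 3 := by norm_num
      _ ≤ _ := by gcongr; linarith
  calc (12 : ℝ) ^ p * Real.exp (ψ x) ≤ Real.exp 3 ^ p * Real.exp (ψ x) := by gcongr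
    _ = Real.exp (p * 3 + ψ x) := by rw [← Real.exp_nat_mul, ← Real.exp_add]
    _ ≤ _ := Real.exp_le_exp.2 (by linarith)

/-- Trading a large radius for a larger Gevrey exponent. -/
theorem Jet.upgrade {s' σ K M : ℝ} (hσ : 0 < σ) (hK : 0 ≤ K) {B : ℝ} (hB : 0 < B) {f : ℝ → ℝ}
    {x : ℝ} (h : Jet s' K M f x) :
    Jet (s' + σ) B (M * Real.exp (σ * (K / B) ^ (1 / σ))) f x := by
  intro n
  refine (h n).trans ?_
  have hM := h.nonneg
  obtain ⟨L, hL⟩ : ∃ L, L = K / B := ⟨_, rfl⟩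
  have hL0 : 0 ≤ L := by rw [hL]; positivity
  have hKL : K = L * B := by rw [hL]; field_simp
  have h1 : (L ^ (1 / σ)) ^ n / (n.factorial : ℝ) ≤ Real.exp (L ^ (1 / σ)) :=
    Real.pow_div_factorial_le_exp _ (by positivity) n
  have h2 : ((L ^ (1 / σ)) ^ n) ≤ Real.exp (L ^ (1 / σ)) * n.factorial := by
    rwa [div_le_iff₀ (by positivity)] at h1
  have h3 := Real.rpow_le_rpow (by positivity) h2 hσ.le
  have e1 : ((L ^ (1 / σ)) ^ n) ^ σ = L ^ n := by
    rw [← Real.rpow_natCast, ← Real.rpow_natCast, ← Real.rpow_mul hL0, ← Real.rpow_mul hL0]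
    congr 1; field_simp
  rw [e1, Real.mul_rpow (by positivity) (by positivity), ← Real.exp_mul] at h3
  rw [Real.rpow_add (by positivity), ← hL, hKL, mul_pow]
  calc M * (L ^ n * B ^ n) * (n.factorial : ℝ) ^ s' ≤
      M * ((Real.exp (L ^ (1 / σ) * σ) * (n.factorial : ℝ) ^ σ) * B ^ n) *
        (n.factorial : ℝ) ^ s' := by gcongr
    _ = _ := by rw [mul_comm (L ^ (1 / σ)) σ]; ring

theorem iteratedDeriv_comp_affine {f : ℝ → ℝ} (hf : Smooth f) (a b : ℝ) (n : ℕ) (x : ℝ) :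
    iteratedDeriv n (fun y => f (a * y + b)) x = a ^ n * iteratedDeriv n f (a * x + b) := by
  have h1 : Smooth fun y => f (y + b) := hf.comp (contDiff_id.add contDiff_const)
  have := iteratedDeriv_comp_const_mul (n := n)
    (h1.of_le (by exact_mod_cast le_top)) a
  rw [this]
  simp [iteratedDeriv_comp_add_const]

theorem Jet.comp_affine {s K M : ℝ} {f : ℝ → ℝ} (hf : Smooth f) {a b x : ℝ}
    (h : Jet s K M f (a * x + b)) : Jet s (|a| * K) M (fun y => f (a * y + b)) x := by
  intro n
  rw [iteratedDeriv_comp_affine hf, abs_mul, abs_pow, mul_pow]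
  have := mul_le_mul_of_nonneg_left (h n) (pow_nonneg (abs_nonneg a) n)
  linarith

theorem Jet.congr {s K M : ℝ} {f g : ℝ → ℝ} {x : ℝ} (h : Jet s K M f x)
    (e : f =ᶠ[nhds x] g) : Jet s K M g x := by
  intro n
  rw [← e.iteratedDeriv_eq]
  exact h n

theorem exists_smooth_pos_eq_id {x : ℝ} (hx : 0 < x) :
    ∃ φ : ℝ → ℝ, Smooth φ ∧ (∀ y, 0 < φ y) ∧ φ =ᶠ[nhds x] id := by
  let f : ContDiffBump x := ⟨x / 4, x / 2, by positivity, by linarith⟩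
  refine ⟨fun y => f y * y + (1 - f y) * x, ?_, ?_, ?_⟩
  · exact (f.contDiff.mul contDiff_id).add ((contDiff_const.sub f.contDiff).mul contDiff_const)
  · intro y
    beta_reduce
    rcases lt_or_ge (dist y x) (x / 2) with h | h
    · have hy : 0 < y := by
        rw [Real.dist_eq, abs_lt] at h; linarith
      have h0 := f.nonneg (x := y)
      have h1 := f.le_one (x := y)
      rcases h0.eq_or_lt with h2 | h2
      · rw [← h2]; simpa using hx
      · have := mul_pos h2 hy
        have := mul_nonneg (sub_nonneg.2 h1) hx.le
        linarith
    · rw [f.zero_of_le_dist h]; simpa using hx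
  · filter_upwards [f.eventuallyEq_one] with y hy
    have : f y = 1 := hy
    simp [this]

theorem jet_inv {φ : ℝ → ℝ} {x : ℝ} (hx : 0 < x) (e : φ =ᶠ[nhds x] id) :
    Jet 1 (2 / x) (2 / x) (fun y => (φ y)⁻¹) x := by
  intro n
  have e' : (fun y => (φ y)⁻¹) =ᶠ[nhds x] Inv.inv := by
    filter_upwards [e] with y hy
    rw [hy]; rfl
  rw [e'.iteratedDeriv_eq, iteratedDeriv_eq_iterate, iter_deriv_inv, abs_mul, abs_mul, abs_pow,
    abs_neg, abs_one, one_pow, one_mul, Nat.abs_cast, Real.rpow_one]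
  have h2 : (1 + (n : ℝ) ^ 2) ≤ 2 * 2 ^ n := by
    have : ∀ n : ℕ, 1 + n ^ 2 ≤ 2 * 2 ^ n := by
      intro n
      induction n with
      | zero => simp
      | succ n ih =>
        rcases n with _ | _ | _ | n
        · norm_num
        · norm_num
        · norm_num
        · have e : 2 * 2 ^ (n + 1 + 1 + 1 + 1) = 2 * (2 * 2 ^ (n + 1 + 1 + 1)) := by ring
          rw [e]
          have h : 1 + (n + 1 + 1 + 1 + 1) ^ 2 ≤ 2 * (1 + (n + 1 + 1 + 1) ^ 2) := by
            clear ih e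
            ring_nf
            linarith [Nat.zero_le n, Nat.zero_le (n ^ 2)]
          exact h.trans (Nat.mul_le_mul_left 2 ih)
    exact_mod_cast this n
  have h3 : |x ^ (-1 - (n : ℤ))| = x⁻¹ * (x⁻¹) ^ n := by
    rw [abs_of_pos (by positivity), zpow_sub₀ hx.ne']
    simp [div_eq_mul_inv]
  rw [h3]
  calc _ ≤ (2 * 2 ^ n) * ((n.factorial : ℝ) * (x⁻¹ * (x⁻¹) ^ n)) := by gcongr
    _ = _ := by rw [div_eq_mul_inv, mul_pow]; ring

/-- The flat function `exp (-x ^ (-r))` for `x > 0`. -/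
def flatFun (r : ℕ) (x : ℝ) : ℝ := expNegInvGlue (x ^ r)

theorem flatFun_smooth (r : ℕ) : Smooth (flatFun r) :=
  expNegInvGlue.contDiff.comp (contDiff_id.pow r)

theorem flatFun_jet_pos {r : ℕ} (hr : 0 < r) {x : ℝ} (hx : 0 < x) :
    Jet (1 + 1 / (r : ℝ)) (4 * (72 * 24 ^ r)) (Real.exp 6) (flatFun r) x := by
  obtain ⟨φ, hφ, hφ0, hφe⟩ := exists_smooth_pos_eq_id hx
  have hi : Smooth fun y => (φ y)⁻¹ := hφ.inv fun y => (hφ0 y).ne'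
  have h1 := (jet_inv hx hφe).pow le_rfl (by positivity) hi r
  set A : ℝ := 72 * 24 ^ r with hA
  have hA1 : 1 ≤ A := by
    rw [hA]; nlinarith [one_le_pow₀ (M₀ := ℝ) (a := 24) (by norm_num) (n := r)]
  have hψ : Smooth fun y => -((φ y)⁻¹ ^ r) := (hi.pow r).neg
  have h2 := h1.const_mul (-1)
  simp only [abs_neg, abs_one, one_mul, neg_mul] at h2
  have h3 := jet_exp (K := A * (2 / x)) (m := (12 * (2 / x)) ^ r / A) le_rfl (by positivity)
    (by positivity) hψ (by
      intro n hn
      refine (h2 n).trans ?_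
      rw [mul_pow A, Real.rpow_one]
      have : A ≤ A ^ n := le_self_pow₀ hA1 (by omega)
      calc _ = (12 * (2 / x)) ^ r / A * (A * (2 / x) ^ n) * n.factorial := by field_simp
        _ ≤ _ := by gcongr)
  have hφx : φ x = x := hφe.eq_of_nhds
  have hr' : (0 : ℝ) < r := by exact_mod_cast hr
  have h4 := h3.upgrade (σ := 1 / (r : ℝ)) (B := 4 * A) (by positivity) (by positivity)
    (by positivity)
  have e : (fun y => Real.exp (-((φ y)⁻¹ ^ r))) =ᶠ[nhds x] flatFun r := by
    filter_upwards [hφe, lt_mem_nhds hx] with y hy hy0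
    have hy0 : 0 < y := hy0
    have : ¬ y ^ r ≤ 0 := not_le.2 (by positivity)
    rw [hy]; simp [flatFun, expNegInvGlue, this]
  refine (h4.congr e).mono_const (by positivity) ?_
  rw [← Real.exp_add, hφx]
  apply Real.exp_le_exp.2
  have e1 : A * (2 / x) / (4 * A) = x⁻¹ / 2 := by
    field_simp; norm_num
  have e2 : (1 : ℝ) / (1 / (r : ℝ)) = r := by simp
  rw [e1, e2, Real.rpow_natCast]
  have e3 : (12 * (2 / x)) ^ r = 24 ^ r * x⁻¹ ^ r := by
    rw [← mul_pow]; congr 1; field_simp; norm_num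
  have e4 : 36 * ((12 * (2 / x)) ^ r / A) = x⁻¹ ^ r / 2 := by
    rw [e3, hA]; field_simp; norm_num
  have h5 : 1 / (r : ℝ) * (x⁻¹ / 2) ^ r ≤ x⁻¹ ^ r / 2 := by
    rw [div_pow]
    have h6 : (2 : ℝ) ≤ 2 ^ r := le_self_pow₀ (by norm_num) hr.ne'
    have h7 : 1 / (r : ℝ) ≤ 1 := by
      rw [div_le_one hr']; exact_mod_cast hr
    calc 1 / (r : ℝ) * (x⁻¹ ^ r / 2 ^ r) ≤ 1 * (x⁻¹ ^ r / 2) := by gcongr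
      _ = _ := one_mul _
  linarith

theorem flatFun_of_nonpos {r : ℕ} (hr : Odd r) {x : ℝ} (hx : x ≤ 0) : flatFun r x = 0 :=
  expNegInvGlue.zero_of_nonpos (hr.pow_nonpos hx)

theorem flatFun_jet {r : ℕ} (hr : Odd r) (x : ℝ) :
    Jet (1 + 1 / (r : ℝ)) (4 * (72 * 24 ^ r)) (Real.exp 6) (flatFun r) x := by
  rcases lt_or_ge 0 x with hx | hx
  · exact flatFun_jet_pos hr.pos hx
  · have hneg : ∀ n : ℕ, ∀ y < 0, iteratedDeriv n (flatFun r) y = 0 := by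
      intro n y hy
      have : flatFun r =ᶠ[nhds y] fun _ => 0 := by
        filter_upwards [gt_mem_nhds hy] with z hz
        exact flatFun_of_nonpos hr (le_of_lt hz)
      rw [this.iteratedDeriv_eq, iteratedDeriv_const]; simp
    intro n
    have h0 : iteratedDeriv n (flatFun r) x = 0 := by
      rcases hx.lt_or_eq with h | rfl
      · exact hneg n x h
      · have hc := (flatFun_smooth r).continuous_iteratedDeriv n (by exact_mod_cast le_top)
        have hcl : IsClosed {y | iteratedDeriv n (flatFun r) y = 0} :=
          isClosed_eq hc continuous_const
        have : closure (Set.Iio (0 : ℝ)) ⊆ {y | iteratedDeriv n (flatFun r) y = 0} :=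
          hcl.closure_subset_iff.2 fun y hy => hneg n y hy
        rw [closure_Iio] at this
        exact this (Set.mem_Iic.2 le_rfl)
    rw [h0]; simp; positivity

/-- A primitive of a function with controlled derivatives has controlled derivatives. -/
theorem jet_primitive {s K M : ℝ} (hs : 0 ≤ s) (hK : 1 ≤ K) {f F : ℝ → ℝ}
    (hF : ∀ x, HasDerivAt F (f x) x) {x : ℝ} (h1 : |F x| ≤ 1) (h : Jet s K M f x) :
    Jet s K (3 * M + 1) F x := by
  intro n
  have hM := h.nonneg
  rcases n with _ | n
  · simp; linarith
  · have hd : deriv F = f := funext fun y => (hF y).deriv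
    rw [iteratedDeriv_succ', hd]
    have h2 : (1 + ((n + 1 : ℕ) : ℝ) ^ 2) ≤ 3 * (1 + (n : ℝ) ^ 2) := by
      push_cast; nlinarith [sq_nonneg ((n : ℝ) - 1)]
    have hfac : (n.factorial : ℝ) ≤ (n + 1).factorial := by
      exact_mod_cast Nat.factorial_le (Nat.le_succ n)
    calc _ ≤ 3 * (1 + (n : ℝ) ^ 2) * |iteratedDeriv n f x| := by gcongr
      _ ≤ 3 * (M * K ^ n * (n.factorial : ℝ) ^ s) := by linarith [h n]
      _ ≤ (3 * M + 1) * K ^ (n + 1) * ((n + 1).factorial : ℝ) ^ s := by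
        have : K ^ n ≤ K ^ (n + 1) := pow_le_pow_right₀ hK (Nat.le_succ n)
        have h4 : (n.factorial : ℝ) ^ s ≤ ((n + 1).factorial : ℝ) ^ s := by gcongr
        calc _ = (3 * M) * K ^ n * (n.factorial : ℝ) ^ s := by ring
          _ ≤ _ := by gcongr; linarith

/-- Gevrey smooth steps. -/
theorem exists_gevrey_step {r : ℕ} (hr : Odd r) : ∃ S : ℝ → ℝ, ∃ K M : ℝ, 1 ≤ K ∧ Smooth S ∧
    (∀ x, 0 ≤ S x ∧ S x ≤ 1) ∧ (∀ x ≤ 0, S x = 0) ∧ (∀ x, 1 ≤ x → S x = 1) ∧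
    ∀ x, Jet (1 + 1 / (r : ℝ)) K M S x := by
  have hs : (1 : ℝ) ≤ 1 + 1 / (r : ℝ) := by
    have : (0 : ℝ) ≤ 1 / (r : ℝ) := by positivity
    linarith
  set K : ℝ := 4 * (72 * 24 ^ r) with hKdef
  have hK : 1 ≤ K := by
    rw [hKdef]; nlinarith [one_le_pow₀ (M₀ := ℝ) (a := 24) (by norm_num) (n := r)]
  have hK0 : 0 ≤ K := by linarith
  let g : ℝ → ℝ := fun t => flatFun r t * flatFun r (-1 * t + 1)
  have hrefl : Smooth fun t => flatFun r (-1 * t + 1) :=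
    (flatFun_smooth r).comp ((contDiff_const.mul contDiff_id).add contDiff_const)
  have hg : Smooth g := (flatFun_smooth r).mul hrefl
  have hg0 : ∀ t, 0 ≤ g t := fun t => mul_nonneg (expNegInvGlue.nonneg _) (expNegInvGlue.nonneg _)
  have hgl : ∀ t ≤ 0, g t = 0 := fun t ht => by
    change flatFun r t * _ = 0
    rw [flatFun_of_nonpos hr ht, zero_mul]
  have hgr : ∀ t, 1 ≤ t → g t = 0 := fun t ht => by
    change flatFun r t * flatFun r (-1 * t + 1) = 0
    rw [flatFun_of_nonpos hr (by linarith : -1 * t + 1 ≤ 0), mul_zero]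
  have hgp : ∀ t ∈ Set.Ioo (0 : ℝ) 1, 0 < g t := fun t ht =>
    mul_pos (expNegInvGlue.pos_of_pos (pow_pos ht.1 r))
      (expNegInvGlue.pos_of_pos (pow_pos (by linarith [ht.2]) r))
  have hgj : ∀ x, Jet (1 + 1 / (r : ℝ)) K (12 * Real.exp 6 * Real.exp 6) g x := fun x => by
    have h2 := (flatFun_jet hr (-1 * x + 1)).comp_affine (flatFun_smooth r)
    simp only [abs_neg, abs_one, one_mul] at h2
    exact (flatFun_jet hr x).mul hs hK0 (flatFun_smooth r) hrefl h2
  have h_int : ∀ a b, IntervalIntegrable g volume a b := fun a b =>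
    hg.continuous.intervalIntegrable a b
  obtain ⟨Z, hZ⟩ : ∃ Z, Z = ∫ t in (0 : ℝ)..1, g t := ⟨_, rfl⟩
  have hZ0 : 0 < Z := by
    rw [hZ]; exact intervalIntegral.intervalIntegral_pos_of_pos_on (h_int 0 1) hgp one_pos
  let S : ℝ → ℝ := fun x => Z⁻¹ * ∫ t in (0 : ℝ)..x, g t
  have hSd : ∀ x, HasDerivAt S (Z⁻¹ * g x) x := fun x =>
    ((hg.continuous.integral_hasStrictDerivAt 0 x).hasDerivAt).const_mul _
  have hS0 : ∀ x ≤ 0, S x = 0 := fun x hx => by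
    change Z⁻¹ * ∫ t in (0 : ℝ)..x, g t = 0
    rw [intervalIntegral.integral_symm, intervalIntegral.integral_congr (g := fun _ => 0)]
    · simp
    · intro t ht
      rw [Set.uIcc_of_le hx] at ht
      exact hgl t ht.2
  have hS1 : ∀ x, 1 ≤ x → S x = 1 := fun x hx => by
    change Z⁻¹ * ∫ t in (0 : ℝ)..x, g t = 1
    have h0 : ∫ t in (1 : ℝ)..x, g t = 0 := by
      rw [intervalIntegral.integral_congr (g := fun _ => 0)]
      · simp
      · intro t ht
        rw [Set.uIcc_of_le hx] at ht
        exact hgr t ht.1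
    rw [← intervalIntegral.integral_add_adjacent_intervals (h_int 0 1) (h_int 1 x), h0, add_zero,
      ← hZ, inv_mul_cancel₀ hZ0.ne']
  have hmono : Monotone S := monotone_of_hasDerivAt_nonneg hSd
    fun x => mul_nonneg (inv_nonneg.2 hZ0.le) (hg0 x)
  have hnn : ∀ x, 0 ≤ S x := fun x => by
    rcases le_total x 0 with h | h
    · rw [hS0 x h]
    · rw [← hS0 0 le_rfl]; exact hmono h
  have hle : ∀ x, S x ≤ 1 := fun x => by
    rcases le_total 1 x with h | h
    · rw [hS1 x h]
    · rw [← hS1 1 le_rfl]; exact hmono h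
  refine ⟨S, K, _, hK, ?_, fun x => ⟨hnn x, hle x⟩, hS0, hS1, fun x =>
    jet_primitive (by linarith) hK hSd (by rw [abs_of_nonneg (hnn x)]; exact hle x)
      ((hgj x).const_mul Z⁻¹)⟩
  refine contDiff_infty_iff_deriv.2 ⟨fun x => (hSd x).differentiableAt, ?_⟩
  rw [funext fun x => (hSd x).deriv]
  exact contDiff_const.mul hg

/-- The data of a Gevrey bump function equal to one on `[-1/2, 1/2]` and supported in `[-1, 1]`. -/
structure IsBump (s K M : ℝ) (χ : ℝ → ℝ) : Prop where
  one_le_K : 1 ≤ K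
  smooth : Smooth χ
  nonneg : ∀ x, 0 ≤ χ x
  le_one : ∀ x, χ x ≤ 1
  eq_one : ∀ x, |x| ≤ 1 / 2 → χ x = 1
  eq_zero : ∀ x, 1 ≤ |x| → χ x = 0
  jet : ∀ x, Jet s K M χ x

theorem exists_isBump {r : ℕ} (hr : Odd r) :
    ∃ (χ : ℝ → ℝ) (K M : ℝ), IsBump (1 + 1 / (r : ℝ)) K M χ := by
  obtain ⟨S, K, M, hK, hS, hS01, hSl, hSr, hj⟩ := exists_gevrey_step hr
  have hs : (1 : ℝ) ≤ 1 + 1 / (r : ℝ) := by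
    have : (0 : ℝ) ≤ 1 / (r : ℝ) := by positivity
    linarith
  have h1 : Smooth fun x => S (-2 * x + 2) :=
    hS.comp ((contDiff_const.mul contDiff_id).add contDiff_const)
  have h2 : Smooth fun x => S (2 * x + 2) :=
    hS.comp ((contDiff_const.mul contDiff_id).add contDiff_const)
  refine ⟨fun x => S (-2 * x + 2) * S (2 * x + 2), 2 * K, 12 * M * M, by linarith, h1.mul h2,
    fun x => mul_nonneg (hS01 _).1 (hS01 _).1, fun x => ?_, fun x hx => ?_, fun x hx => ?_,
    fun x => ?_⟩
  · exact mul_le_one₀ (hS01 _).2 (hS01 _).1 (hS01 _).2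
  · rw [abs_le] at hx
    rw [hSr _ (by linarith), hSr _ (by linarith), one_mul]
  · rcases le_abs'.1 hx with h | h
    · rw [hSl (2 * x + 2) (by linarith), mul_zero]
    · rw [hSl (-2 * x + 2) (by linarith), zero_mul]
  · have j1 := (hj (-2 * x + 2)).comp_affine hS
    have j2 := (hj (2 * x + 2)).comp_affine hS
    rw [abs_neg] at j1
    rw [abs_of_pos (two_pos : (0 : ℝ) < 2)] at j1 j2
    exact j1.mul hs (by linarith) h1 h2 j2

/-- Distance to the nearest integer. -/
def nd (x : ℝ) : ℝ := |x - round x|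

theorem nd_le (x : ℝ) (z : ℤ) : nd x ≤ |x - z| := round_le x z

theorem nd_le_abs (x : ℝ) : nd x ≤ |x| := by simpa using nd_le x 0

theorem nd_le_half (x : ℝ) : nd x ≤ 1 / 2 := abs_sub_round x

theorem nd_add_le (x y : ℝ) : nd (x + y) ≤ nd x + nd y := by
  refine (nd_le (x + y) (round x + round y)).trans ?_
  push_cast
  rw [show x + y - ((round x : ℝ) + round y) = (x - round x) + (y - round y) by ring]
  exact abs_add_le _ _

theorem nd_neg_le (x : ℝ) : nd (-x) ≤ nd x := by
  refine (nd_le (-x) (-round x)).trans (le_of_eq ?_)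
  push_cast
  rw [nd, ← abs_neg]; congr 1; ring

theorem nd_neg (x : ℝ) : nd (-x) = nd x :=
  le_antisymm (nd_neg_le x) (by simpa using nd_neg_le (-x))

theorem nd_sub_le (x y : ℝ) : nd (x - y) ≤ nd x + nd y := by
  rw [sub_eq_add_neg, ← nd_neg y]; exact nd_add_le x (-y)

/-- Denominators whose smaller multiples stay away from the integers. -/
def IsGoodDenom (α : ℝ) (q : ℕ) : Prop :=
  0 < q ∧ ∀ l : ℤ, l ≠ 0 → |l| < q → 1 / (2 * (q : ℝ)) ≤ nd (l * α)

/-- Numerators of the convergents. -/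
def cfnum (α : ℝ) : ℕ → ℤ
  | 0 => ⌊α⌋
  | 1 => cfa α 0 * ⌊α⌋ + 1
  | n + 2 => cfa α (n + 1) * cfnum α (n + 1) + cfnum α n

theorem gaussIter_irrational {α : ℝ} (hα : Irrational α) (n : ℕ) : Irrational (gaussIter α n) := by
  induction n with
  | zero =>
    change Irrational (Int.fract α)
    rw [Int.fract]; exact hα.sub_intCast _
  | succ n ih =>
    change Irrational (Int.fract _)
    rw [Int.fract]; exact ih.inv.sub_intCast _

theorem gaussIter_pos {α : ℝ} (hα : Irrational α) (n : ℕ) : 0 < gaussIter α n := by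
  have h : 0 ≤ gaussIter α n := by cases n <;> exact Int.fract_nonneg _
  exact lt_of_le_of_ne h (gaussIter_irrational hα n).ne_zero.symm

theorem gaussIter_lt_one (α : ℝ) (n : ℕ) : gaussIter α n < 1 := by
  cases n <;> exact Int.fract_lt_one _

theorem gaussIter_inv {α : ℝ} (hα : Irrational α) (n : ℕ) :
    (gaussIter α n)⁻¹ = cfa α n + gaussIter α (n + 1) := by
  have h0 : 0 ≤ (gaussIter α n)⁻¹ := inv_nonneg.2 (gaussIter_pos hα n).le
  change _ = (⌊(gaussIter α n)⁻¹⌋₊ : ℝ) + Int.fract (gaussIter α n)⁻¹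
  rw [natCast_floor_eq_intCast_floor h0]
  exact (Int.floor_add_fract _).symm

theorem one_le_cfa {α : ℝ} (hα : Irrational α) (n : ℕ) : 1 ≤ cfa α n := by
  apply Nat.le_floor
  rw [Nat.cast_one]
  exact (one_le_inv₀ (gaussIter_pos hα n)).2 (gaussIter_lt_one α n).le

theorem one_le_cfq {α : ℝ} (hα : Irrational α) : ∀ n, 1 ≤ cfq α n
  | 0 => le_rfl
  | 1 => one_le_cfa hα 0
  | n + 2 => le_trans (one_le_cfq hα n) (Nat.le_add_left _ _)

theorem cfq_le_succ {α : ℝ} (hα : Irrational α) (n : ℕ) : cfq α n ≤ cfq α (n + 1) := by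
  cases n with
  | zero => exact one_le_cfa hα 0
  | succ n =>
    change cfq α (n + 1) ≤ cfa α (n + 1) * cfq α (n + 1) + cfq α n
    exact le_trans (Nat.le_mul_of_pos_left _ (one_le_cfa hα _)) (Nat.le_add_right _ _)

theorem cfq_mono {α : ℝ} (hα : Irrational α) : Monotone (cfq α) :=
  monotone_nat_of_le_succ (cfq_le_succ hα)

theorem le_cfq {α : ℝ} (hα : Irrational α) (n : ℕ) : n ≤ cfq α n := by
  induction n with
  | zero => simp
  | succ n ih =>
    cases n with
    | zero => exact one_le_cfa hα 0
    | succ n =>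
      change _ ≤ cfa α (n + 1) * cfq α (n + 1) + cfq α n
      have h1 := one_le_cfq hα n
      have h2 := Nat.le_mul_of_pos_left (cfq α (n + 1)) (one_le_cfa hα (n + 1))
      omega

/-- The signed approximation error. -/
def cferr (α : ℝ) (n : ℕ) : ℝ := cfq α n * α - cfnum α n

theorem cferr_succ {α : ℝ} (hα : Irrational α) (n : ℕ) :
    cferr α (n + 1) = -(gaussIter α (n + 1) * cferr α n) := by
  induction n using Nat.strong_induction_on with
  | _ n ih =>
    have hi := gaussIter_inv hα n
    have hg := gaussIter_pos hα n
    have hi' : 1 = gaussIter α n * cfa α n + gaussIter α n * gaussIter α (n + 1) := by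
      rw [← mul_add, ← hi, mul_inv_cancel₀ hg.ne']
    cases n with
    | zero =>
      have e0 : gaussIter α 0 = α - ⌊α⌋ := rfl
      simp only [cferr, cfq, cfnum]
      push_cast
      rw [e0] at hi'
      linear_combination (-1) * hi'
    | succ n =>
      have h := ih n (by omega)
      have e : cferr α (n + 1 + 1) = cfa α (n + 1) * cferr α (n + 1) + cferr α n := by
        simp only [cferr, cfq, cfnum]; push_cast; ring
      rw [e]
      rw [h]
      linear_combination cferr α n * hi'

theorem abs_cferr_succ_le {α : ℝ} (hα : Irrational α) (n : ℕ) :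
    |cferr α (n + 1)| ≤ |cferr α n| := by
  rw [cferr_succ hα, abs_neg, abs_mul, abs_of_pos (gaussIter_pos hα _)]
  exact mul_le_of_le_one_left (abs_nonneg _) (gaussIter_lt_one α _).le

theorem cf_det (α : ℝ) (n : ℕ) :
    (cfq α n : ℤ) * cfnum α (n + 1) - cfq α (n + 1) * cfnum α n = (-1) ^ n := by
  induction n with
  | zero => simp [cfq, cfnum]
  | succ n ih =>
    simp only [cfq, cfnum, pow_succ]
    push_cast
    linear_combination -ih

theorem half_inv_le_abs_cferr {α : ℝ} (hα : Irrational α) (n : ℕ) :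
    1 / (2 * (cfq α (n + 1) : ℝ)) ≤ |cferr α n| := by
  have h1 : (1 : ℝ) ≤ cfq α (n + 1) := by exact_mod_cast one_le_cfq hα (n + 1)
  have hd : ((cfq α n : ℝ) * cfnum α (n + 1) - cfq α (n + 1) * cfnum α n) = (-1) ^ n := by
    exact_mod_cast cf_det α n
  have h2 : (cfq α (n + 1) : ℝ) * cferr α n - cfq α n * cferr α (n + 1) = (-1) ^ n := by
    rw [← hd, cferr, cferr]; ring
  have h3 : 1 ≤ (cfq α (n + 1) : ℝ) * |cferr α n| + cfq α n * |cferr α (n + 1)| := by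
    have := abs_sub (cfq α (n + 1) * cferr α n) (cfq α n * cferr α (n + 1))
    rw [h2, abs_mul, abs_mul, Nat.abs_cast, Nat.abs_cast] at this
    simpa using this
  have h4 : (cfq α n : ℝ) ≤ cfq α (n + 1) := by exact_mod_cast cfq_le_succ hα n
  have h5 := abs_cferr_succ_le hα n
  rw [div_le_iff₀ (by positivity)]
  have : (cfq α n : ℝ) * |cferr α (n + 1)| ≤ cfq α (n + 1) * |cferr α n| := by gcongr
  linarith

theorem abs_cferr_le {α : ℝ} (hα : Irrational α) (n : ℕ) {l p : ℤ} (hl0 : l ≠ 0)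
    (hl : |l| < cfq α (n + 1)) : |cferr α n| ≤ |l * α - p| := by
  have hd := cf_det α n
  obtain ⟨u, v, hlu, hpu⟩ : ∃ u v : ℤ, l = u * cfq α (n + 1) + v * cfq α n ∧
      p = u * cfnum α (n + 1) + v * cfnum α n := by
    have hsq : ((-1 : ℤ) ^ n) * (-1) ^ n = 1 := by rw [← mul_pow]; simp
    refine ⟨(-1) ^ n * (cfq α n * p - cfnum α n * l),
      (-1) ^ n * (cfnum α (n + 1) * l - cfq α (n + 1) * p), ?_, ?_⟩
    · linear_combination (-l) * hsq - (-1) ^ n * l * hd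
    · linear_combination (-p) * hsq - (-1) ^ n * p * hd
  have hq : (1 : ℤ) ≤ cfq α n := by exact_mod_cast one_le_cfq hα n
  have hq' : (1 : ℤ) ≤ cfq α (n + 1) := by exact_mod_cast one_le_cfq hα (n + 1)
  have e : (l : ℝ) * α - p = u * cferr α (n + 1) + v * cferr α n := by
    rw [hlu, hpu, cferr, cferr]; push_cast; ring
  rw [e]
  have hg := gaussIter_pos hα (n + 1)
  have he : u * cferr α (n + 1) + v * cferr α n = (v - u * gaussIter α (n + 1)) * cferr α n := by
    rw [cferr_succ hα]; ring
  rw [he, abs_mul]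
  refine le_mul_of_one_le_left (abs_nonneg _) ?_
  rw [abs_lt] at hl
  have hv : v ≠ 0 := by
    rintro rfl
    rcases lt_trichotomy u 0 with h | h | h
    · nlinarith
    · simp [h] at hlu; exact hl0 hlu
    · nlinarith
  rcases lt_or_gt_of_ne hv with h | h
  · have hu : 0 ≤ u := by
      by_contra hu
      push Not at hu
      nlinarith
    have h1 : (v : ℝ) ≤ -1 := by exact_mod_cast (by omega : v ≤ -1)
    have h2 : (0 : ℝ) ≤ u := by exact_mod_cast hu
    rw [le_abs]; right; nlinarith
  · have hu : u ≤ 0 := by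
      by_contra hu
      push Not at hu
      nlinarith
    have h1 : (1 : ℝ) ≤ v := by exact_mod_cast h
    have h2 : (u : ℝ) ≤ 0 := by exact_mod_cast hu
    rw [le_abs]; left; nlinarith

theorem isGoodDenom_cfq {α : ℝ} (hα : Irrational α) (n : ℕ) : IsGoodDenom α (cfq α (n + 1)) :=
  ⟨one_le_cfq hα _, fun _ h0 hl =>
    (half_inv_le_abs_cferr hα n).trans (abs_cferr_le hα n h0 hl)⟩

/-- Under the strong Diophantine condition good denominators are plentiful at every scale. -/
theorem exists_goodDenom {α : ℝ} (hα : Irrational α)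
    (hSDC : ∃ γ : ℝ, 0 < γ ∧ ∃ τ : ℝ, 0 < τ ∧ ∀ᶠ n in atTop,
      (cfq α (n + 1) : ℝ) ≤ γ⁻¹ * (cfq α n : ℝ) * (Real.log (cfq α n : ℝ)) ^ τ)
    {δ : ℝ} (hδ : 0 < δ) :
    ∃ X₀ : ℝ, 1 ≤ X₀ ∧ ∀ X, X₀ ≤ X → ∃ q : ℕ, IsGoodDenom α q ∧ X ≤ q ∧ (q : ℝ) ≤ X ^ (1 + δ) := by
  obtain ⟨γ, hγ, τ, hτ, hS⟩ := hSDC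
  have hlim : Tendsto (fun n => (cfq α n : ℝ)) atTop atTop :=
    tendsto_atTop_mono (fun n => by exact_mod_cast le_cfq hα n) tendsto_natCast_atTop_atTop
  have hlog : ∀ᶠ y : ℝ in atTop, γ⁻¹ * Real.log y ^ τ ≤ y ^ δ := by
    have := (isLittleO_log_rpow_rpow_atTop τ hδ).bound hγ
    filter_upwards [this, eventually_ge_atTop (1 : ℝ)] with y hy hy1
    rw [Real.norm_of_nonneg (Real.rpow_nonneg (Real.log_nonneg hy1) _),
      Real.norm_of_nonneg (by positivity)] at hy
    rw [inv_mul_le_iff₀ hγ]; exact hy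
  obtain ⟨n₀, hn₀⟩ := eventually_atTop.1 (hS.and (hlim.eventually hlog))
  have hstep : ∀ n, n₀ ≤ n → (cfq α (n + 1) : ℝ) ≤ (cfq α n : ℝ) ^ (1 + δ) := by
    intro n hn
    obtain ⟨h1, h2⟩ := hn₀ n hn
    have hq : (1 : ℝ) ≤ cfq α n := by exact_mod_cast one_le_cfq hα n
    rw [Real.rpow_add (by linarith), Real.rpow_one]
    calc _ ≤ _ := h1
      _ = cfq α n * (γ⁻¹ * Real.log (cfq α n) ^ τ) := by ring
      _ ≤ _ := by gcongr
  refine ⟨cfq α n₀ + 1, by linarith [(Nat.cast_nonneg (cfq α n₀) : (0:ℝ) ≤ _)], fun X hX => ?_⟩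
  classical
  have hex : ∃ n, X ≤ cfq α n := (hlim.eventually_ge_atTop X).exists
  have hf := Nat.find_spec hex
  have hmin := fun m => Nat.find_min hex (m := m)
  obtain ⟨N, hN⟩ : ∃ N, N = Nat.find hex := ⟨_, rfl⟩
  rw [← hN] at hf hmin
  have hNn : n₀ < N := by
    by_contra h
    push Not at h
    have : (cfq α N : ℝ) ≤ cfq α n₀ := by exact_mod_cast cfq_mono hα h
    linarith
  obtain ⟨m, rfl⟩ : ∃ m, N = m + 1 := ⟨N - 1, by omega⟩
  refine ⟨cfq α (m + 1), isGoodDenom_cfq hα m, hf, (hstep m (by omega)).trans ?_⟩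
  have hm : (cfq α m : ℝ) < X := not_le.1 (hmin m (by omega))
  gcongr

/-- A family of scales adapted to the rotation by `α`. -/
structure Scales (α a : ℝ) where
  q : ℕ → ℕ
  d : ℕ → ℕ
  k : ℕ → ℕ
  R : ℕ → ℝ
  good : ∀ m, ∀ l : ℤ, l ≠ 0 → |l| < q m → 8 * (1 / 2 : ℝ) ^ d m ≤ nd (l * α)
  q_le : ∀ m, 16 * q m ≤ 2 ^ d m
  pow_le : ∀ m, 2 ^ d m ≤ 32 * q m
  k_pos : ∀ m, 1 ≤ k m
  le_k : ∀ m, m ≤ k m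
  k_le : ∀ m, 2 ^ (14 + m) * k m ≤ q m
  d_mono : StrictMono d
  free : ∀ m, ∀ m' < m, ∀ i : ℤ, |i - k m| ≤ k m' → 2 * (1 / 2 : ℝ) ^ d m' ≤ nd (i * α)
  theta_le : ∀ m, ((2 : ℝ) ^ a) ^ (d (m + 1) + 1) ≤ 64 * k m
  R_pos : ∀ j, 0 < R j
  sep : ∀ j, d 0 ≤ j → ∀ l : ℤ, l ≠ 0 → |(l : ℝ)| < R j → 2 * (1 / 2 : ℝ) ^ j ≤ nd (l * α)
  summable : Summable fun j => ((2 : ℝ) ^ a) ^ j / R j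

theorem spaced_card_le {q : ℝ} (S : Finset ℤ) (A : ℝ)
    (hS : ∀ i ∈ S, ∀ j ∈ S, i < j → (i : ℝ) + q ≤ j) (hA : ∀ i ∈ S, A ≤ i) :
    ∀ B : ℝ, 0 ≤ B - A + q → (∀ i ∈ S, (i : ℝ) ≤ B) → q * S.card ≤ B - A + q := by
  induction S using Finset.induction_on_max with
  | empty => intro B hB _; simpa using hB
  | insert a S ha ih =>
    intro B hB hle
    have hna : a ∉ S := fun h => lt_irrefl _ (ha a h)
    have h1 := ih (fun i hi j hj => hS i (by simp [hi]) j (by simp [hj]))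
      (fun i hi => hA i (by simp [hi])) (a - q) (by linarith [hA a (by simp)])
      (fun i hi => by linarith [hS i (by simp [hi]) a (by simp) (ha i hi)])
    rw [Finset.card_insert_of_notMem hna]
    push_cast
    linarith [hle a (by simp)]

open Classical in
theorem bad_times_card_le {α ρ : ℝ} {q : ℕ} (hq : 0 < q)
    (hgood : ∀ l : ℤ, l ≠ 0 → |l| < q → 4 * ρ ≤ nd (l * α)) (K K' : ℕ) :
    (q : ℝ) * ({k ∈ Finset.Ico (K : ℤ) (2 * K) | ∃ i : ℤ, |i - k| ≤ 2 * K' ∧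
      nd (i * α) < 2 * ρ} : Finset ℤ).card ≤ (4 * K' + 1) * (K + 4 * K' + q) := by
  classical
  set S : Finset ℤ := {i ∈ Finset.Icc ((K : ℤ) - 2 * K') (2 * K + 2 * K') | nd (i * α) < 2 * ρ}
    with hSdef
  have hsub : ({k ∈ Finset.Ico (K : ℤ) (2 * K) | ∃ i : ℤ, |i - k| ≤ 2 * K' ∧
      nd (i * α) < 2 * ρ} : Finset ℤ) ⊆
      S.biUnion fun i => Finset.Icc (i - 2 * (K' : ℤ)) (i + 2 * K') := by
    intro k hk
    simp only [Finset.mem_filter, Finset.mem_Ico] at hk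
    obtain ⟨hk, i, hi, hnd⟩ := hk
    rw [abs_le] at hi
    simp only [Finset.mem_biUnion, Finset.mem_Icc, hSdef, Finset.mem_filter]
    exact ⟨i, ⟨⟨by omega, by omega⟩, hnd⟩, by omega, by omega⟩
  have hc1 : (({k ∈ Finset.Ico (K : ℤ) (2 * K) | ∃ i : ℤ, |i - k| ≤ 2 * K' ∧
      nd (i * α) < 2 * ρ} : Finset ℤ).card : ℝ) ≤ S.card * (4 * K' + 1) := by
    have h1 := (Finset.card_le_card hsub).trans
      (Finset.card_biUnion_le_card_mul S _ (4 * K' + 1) (fun i _ => by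
        rw [Int.card_Icc]; omega))
    exact_mod_cast h1
  have hc2 : (q : ℝ) * S.card ≤ (2 * K + 2 * K') - ((K : ℝ) - 2 * K') + q := by
    apply spaced_card_le
    · intro i hi j hj hij
      by_contra h
      push Not at h
      have hlt : j - i < q := by
        have : (j : ℝ) - i < q := by linarith
        exact_mod_cast this
      have h1 := hgood (j - i) (by omega) (by rw [abs_of_pos (by omega)]; exact hlt)
      have h2 := nd_sub_le (j * α) (i * α)
      simp only [hSdef, Finset.mem_filter] at hi hj
      push_cast at h1
      rw [sub_mul] at h1
      linarith [hi.2, hj.2]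
    · intro i hi
      simp only [hSdef, Finset.mem_filter, Finset.mem_Icc] at hi
      exact_mod_cast hi.1.1
    · have : (0 : ℝ) ≤ K := Nat.cast_nonneg _
      have : (0 : ℝ) ≤ K' := Nat.cast_nonneg _
      have : (0 : ℝ) ≤ q := Nat.cast_nonneg _
      linarith
    · intro i hi
      simp only [hSdef, Finset.mem_filter, Finset.mem_Icc] at hi
      exact_mod_cast hi.1.2
  calc _ ≤ (q : ℝ) * (S.card * (4 * K' + 1)) := by gcongr
    _ = (4 * K' + 1) * (q * S.card) := by ring
    _ ≤ (4 * K' + 1) * ((2 * K + 2 * K') - ((K : ℝ) - 2 * K') + q) := by gcongr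
    _ = _ := by ring

theorem exists_free_time {α : ℝ} {q K : ℕ → ℕ} {ρ : ℕ → ℝ}
    (hgood : ∀ m, ∀ l : ℤ, l ≠ 0 → |l| < q m → 4 * ρ m ≤ nd (l * α))
    (hK0 : 1 ≤ K 0) (hKq : ∀ m, 2 ^ (15 + m) * K m ≤ q m) (hK : ∀ m, 32 * K m ≤ K (m + 1))
    (m : ℕ) : ∃ k : ℕ, K m ≤ k ∧ k < 2 * K m ∧
      ∀ m' < m, ∀ i : ℤ, |i - k| ≤ 2 * K m' → 2 * ρ m' ≤ nd (i * α) := by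
  classical
  have hKpos : ∀ m, 1 ≤ K m := by
    intro m
    induction m with
    | zero => exact hK0
    | succ n ih => exact le_trans (by omega) (hK n)
  let B : ℕ → Finset ℤ := fun m' => {k ∈ Finset.Ico (K m : ℤ) (2 * K m) |
    ∃ i : ℤ, |i - k| ≤ 2 * K m' ∧ nd (i * α) < 2 * ρ m'}
  have hsum : ∀ m, 31 * ∑ m' ∈ Finset.range m, (K m' : ℝ) ≤ K m := by
    intro m
    induction m with
    | zero => simp
    | succ n ih =>
      rw [Finset.sum_range_succ]
      have : (32 : ℝ) * K n ≤ K (n + 1) := by exact_mod_cast hK n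
      linarith
  have hmono : ∀ m' < m, K m' ≤ K m := by
    intro m' h
    exact (monotone_nat_of_le_succ fun n => le_trans (by omega) (hK n)) h.le
  have hB : ∀ m' ∈ Finset.range m, ((B m').card : ℝ) ≤
      25 / 2 ^ 15 * K m * (1 / 2) ^ m' + 5 * K m' := by
    intro m' hm'
    have hm'' : m' < m := Finset.mem_range.1 hm'
    have hq1 : (1 : ℝ) ≤ K m' := by exact_mod_cast hKpos m'
    have hqK : (2 : ℝ) ^ (15 + m') * K m' ≤ q m' := by exact_mod_cast hKq m'
    have hqpos : (0 : ℝ) < q m' := lt_of_lt_of_le (by positivity) hqK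
    have h1 := bad_times_card_le (by exact_mod_cast hqpos) (hgood m') (K m) (K m')
    have hKK : (K m' : ℝ) ≤ K m := by exact_mod_cast hmono m' hm''
    have h2 : (q m' : ℝ) * (B m').card ≤
        q m' * (25 / 2 ^ 15 * K m * (1 / 2) ^ m' + 5 * K m') := by
      refine h1.trans ?_
      have h3 : (K m' : ℝ) ≤ q m' * ((1 / 2) ^ m' / 2 ^ 15) := by
        rw [pow_add] at hqK
        have e : (q m' : ℝ) * ((1 / 2) ^ m' / 2 ^ 15) = q m' / (2 ^ 15 * 2 ^ m') := by
          rw [one_div, inv_pow]; field_simp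
        rw [e, le_div_iff₀ (by positivity)]
        linarith
      calc (4 * (K m' : ℝ) + 1) * (K m + 4 * K m' + q m') ≤
          (5 * K m') * (5 * K m + q m') := by gcongr <;> linarith
        _ = 25 * K m' * K m + 5 * K m' * q m' := by ring
        _ ≤ 25 * (q m' * ((1 / 2) ^ m' / 2 ^ 15)) * K m + 5 * K m' * q m' := by gcongr
        _ = _ := by ring
    exact le_of_mul_le_mul_left h2 hqpos
  have hcard : (((Finset.range m).biUnion B).card : ℝ) < K m := by
    have h1 : (((Finset.range m).biUnion B).card : ℝ) ≤ ∑ m' ∈ Finset.range m, ((B m').card : ℝ) := by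
      exact_mod_cast Finset.card_biUnion_le
    have h2 := h1.trans (Finset.sum_le_sum hB)
    rw [Finset.sum_add_distrib, ← Finset.mul_sum, ← Finset.mul_sum] at h2
    have h3 := sum_geometric_two_le m
    have h4 := hsum m
    have h5 : (1 : ℝ) ≤ K m := by exact_mod_cast hKpos m
    have h6 : 25 / 2 ^ 15 * (K m : ℝ) * ∑ i ∈ Finset.range m, (1 / 2 : ℝ) ^ i ≤
        25 / 2 ^ 15 * K m * 2 := by gcongr
    linarith
  have hlt : ((Finset.range m).biUnion B).card < (Finset.Ico (K m : ℤ) (2 * K m)).card := by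
    rw [Int.card_Ico]
    have : ((Finset.range m).biUnion B).card < K m := by exact_mod_cast hcard
    omega
  obtain ⟨k, hk, hkB⟩ := Finset.exists_mem_notMem_of_card_lt_card hlt
  have hk' := Finset.mem_Ico.1 hk
  refine ⟨k.toNat, by omega, by omega, fun m' hm' i hi => ?_⟩
  by_contra hcon
  push Not at hcon
  apply hkB
  refine Finset.mem_biUnion.2 ⟨m', Finset.mem_range.2 hm', Finset.mem_filter.2 ⟨hk, i, ?_, hcon⟩⟩
  rwa [Int.toNat_of_nonneg (by omega)] at hi

theorem exists_denominators {α : ℝ} {e Y : ℝ}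
    (hstep : ∀ X, Y ≤ X → ∃ q : ℕ, IsGoodDenom α q ∧ X ≤ q ∧ (q : ℝ) ≤ X ^ e)
    (hY : 1 ≤ Y) (he : 1 ≤ e) : ∃ q : ℕ → ℕ, (∀ m, IsGoodDenom α (q m)) ∧ (∀ m, Y ≤ q m) ∧
      ∀ m, (q m : ℝ) ^ e ≤ q (m + 1) ∧ (q (m + 1) : ℝ) ≤ ((q m : ℝ) ^ e) ^ e := by
  have hnext : ∀ p : {p : ℕ // IsGoodDenom α p ∧ Y ≤ p}, ∃ p' : {p : ℕ // IsGoodDenom α p ∧ Y ≤ p},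
      (p.1 : ℝ) ^ e ≤ p'.1 ∧ (p'.1 : ℝ) ≤ ((p.1 : ℝ) ^ e) ^ e := by
    rintro ⟨p, hp, hYp⟩
    have h1 : (p : ℝ) ≤ (p : ℝ) ^ e := Real.self_le_rpow_of_one_le (hY.trans hYp) he
    obtain ⟨p', hg, hl, hu⟩ := hstep ((p : ℝ) ^ e) (hYp.trans h1)
    exact ⟨⟨p', hg, (hYp.trans h1).trans hl⟩, hl, hu⟩
  choose nxt hnxt using hnext
  obtain ⟨p₀, hg, hl, -⟩ := hstep Y le_rfl
  let u : ℕ → {p : ℕ // IsGoodDenom α p ∧ Y ≤ p} := fun m => Nat.rec ⟨p₀, hg, hl⟩ (fun _ p => nxt p) m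
  exact ⟨fun m => (u m).1, fun m => (u m).2.1, fun m => (u m).2.2, fun m => hnxt (u m)⟩

theorem nonempty_scales {α a : ℝ} (ha0 : 0 < a) (ha1 : a < 1)
    (hH : ∀ δ : ℝ, 0 < δ → ∃ X₀ : ℝ, 1 ≤ X₀ ∧ ∀ X, X₀ ≤ X →
      ∃ q : ℕ, IsGoodDenom α q ∧ X ≤ q ∧ (q : ℝ) ≤ X ^ (1 + δ)) : Nonempty (Scales α a) := by
  obtain ⟨b, hb⟩ : ∃ b, b = (1 + a) / 2 := ⟨_, rfl⟩
  have hab : a < b := by linarith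
  have hb1 : b < 1 := by linarith
  have hb0 : 0 < b := by linarith
  obtain ⟨e, he⟩ : ∃ e, e = Real.sqrt (b / a) := ⟨_, rfl⟩
  have he1 : 1 < e := by
    rw [he, Real.lt_sqrt (by norm_num), one_pow, one_lt_div ha0]; exact hab
  have he2 : e * e = b / a := by rw [he]; exact Real.mul_self_sqrt (by positivity)
  have hea : e * e * a = b := by rw [he2]; field_simp
  have he0 : 0 < e := by linarith
  have hae : a * e < 1 := by nlinarith
  obtain ⟨X₀, hX₀, hX⟩ := hH (e - 1) (by linarith)
  simp only [add_sub_cancel] at hX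
  obtain ⟨E, hE⟩ := exists_nat_ge (1 / (1 - b))
  have hE' : 1 ≤ E * (1 - b) := by
    rwa [div_le_iff₀ (by linarith)] at hE
  -- the separation radii
  let R : ℕ → ℝ := fun j => (2 : ℝ) ^ (((j : ℝ) - 2) / e)
  have hRlim : Tendsto R atTop atTop := by
    refine (tendsto_rpow_atTop_of_base_gt_one 2 (by norm_num)).comp ?_
    exact (tendsto_atTop_add_const_right _ (-2) tendsto_natCast_atTop_atTop).atTop_div_const he0
  obtain ⟨j₁, hj₁⟩ := eventually_atTop.1 (hRlim.eventually_ge_atTop X₀)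
  -- thresholds
  have hthr : ∀ᶠ y : ℝ in atTop, X₀ ≤ y ∧ 1 ≤ y ∧ (2 : ℝ) ^ (E + 2) ≤ y ^ (e - 1) ∧
      (2 : ℝ) ^ 16 ≤ y ^ (1 - b) ∧ 64 ≤ y ^ (b * (e - 1)) ∧ (2 : ℝ) ^ j₁ ≤ y := by
    refine (eventually_ge_atTop _).and ((eventually_ge_atTop _).and
      (((tendsto_rpow_atTop (by linarith)).eventually_ge_atTop _).and
      (((tendsto_rpow_atTop (by linarith)).eventually_ge_atTop _).and
      (((tendsto_rpow_atTop (mul_pos hb0 (by linarith))).eventually_ge_atTop _).and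
        (eventually_ge_atTop _)))))
  obtain ⟨Y, hY⟩ := eventually_atTop.1 hthr
  obtain ⟨q, hqg, hqY, hqs⟩ := exists_denominators (Y := Y) (e := e)
    (fun X h => hX X (hY X h).1) (hY Y le_rfl).2.1 he1.le
  have hq1 : ∀ m, (1 : ℝ) ≤ q m := fun m => (hY _ (hqY m)).2.1
  have hqpos : ∀ m, (0 : ℝ) < q m := fun m => by linarith [hq1 m]
  have hqgrow : ∀ m, (2 : ℝ) ^ (E + 2) * q m ≤ q (m + 1) := by
    intro m
    refine le_trans ?_ (hqs m).1
    have h1 := (hY _ (hqY m)).2.2.1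
    have h2 : (q m : ℝ) ^ e = (q m : ℝ) ^ (e - 1) * q m := by
      rw [← Real.rpow_add_one (hqpos m).ne']; congr 1; ring
    rw [h2]; gcongr
  have hqexp : ∀ m, ((2 : ℝ) ^ E) ^ m * q 0 ≤ q m := by
    intro m
    induction m with
    | zero => simp
    | succ n ih =>
      refine le_trans ?_ (hqgrow n)
      rw [pow_succ, pow_add]
      have h0 : (0 : ℝ) ≤ (2 ^ E) ^ n * q 0 := by positivity
      have h1 : (0 : ℝ) < 2 ^ E := by positivity
      have h2 := mul_le_mul_of_nonneg_left ih h1.le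
      have h3 : (0 : ℝ) ≤ 2 ^ E * q n := by positivity
      linarith
  let K : ℕ → ℕ := fun m => ⌈(q m : ℝ) ^ b⌉₊
  have hKl : ∀ m, (q m : ℝ) ^ b ≤ K m := fun m => Nat.le_ceil _
  have hqb1 : ∀ m, 1 ≤ (q m : ℝ) ^ b := fun m => Real.one_le_rpow (hq1 m) hb0.le
  have hKu : ∀ m, (K m : ℝ) ≤ 2 * (q m : ℝ) ^ b := fun m => by
    have := Nat.ceil_lt_add_one (show 0 ≤ (q m : ℝ) ^ b by positivity)
    linarith [hqb1 m]
  have hK0 : 1 ≤ K 0 := by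
    have : (1 : ℝ) ≤ K 0 := (hqb1 0).trans (hKl 0)
    exact_mod_cast this
  have hKq : ∀ m, 2 ^ (15 + m) * K m ≤ q m := by
    intro m
    have h1 : (2 : ℝ) ^ (16 + m) ≤ (q m : ℝ) ^ (1 - b) := by
      have h2 := Real.rpow_le_rpow (by positivity) (hqexp m) (by linarith : 0 ≤ 1 - b)
      rw [Real.mul_rpow (by positivity) (by positivity)] at h2
      refine le_trans ?_ h2
      have h3 := (hY _ (hqY 0)).2.2.2.1
      have h4 : (2 : ℝ) ^ m ≤ (((2 : ℝ) ^ E) ^ m) ^ (1 - b) := by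
        rw [← pow_mul, ← Real.rpow_natCast 2 (E * m), ← Real.rpow_mul (by norm_num),
          ← Real.rpow_natCast 2 m]
        apply Real.rpow_le_rpow_of_exponent_le (by norm_num)
        push_cast
        have : (0 : ℝ) ≤ m := Nat.cast_nonneg m
        nlinarith
      rw [pow_add, mul_comm]; gcongr
    have h5 : (2 : ℝ) ^ (15 + m) * K m ≤ q m := by
      have h6 : (q m : ℝ) = (q m : ℝ) ^ (1 - b) * (q m : ℝ) ^ b := by
        rw [← Real.rpow_add (hqpos m)]; simp
      calc (2 : ℝ) ^ (15 + m) * K m ≤ 2 ^ (15 + m) * (2 * (q m : ℝ) ^ b) := by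
            gcongr; exact hKu m
        _ = 2 ^ (16 + m) * (q m : ℝ) ^ b := by ring
        _ ≤ (q m : ℝ) ^ (1 - b) * (q m : ℝ) ^ b := by gcongr
        _ = _ := h6.symm
    exact_mod_cast h5
  have hKs : ∀ m, 32 * K m ≤ K (m + 1) := by
    intro m
    have h1 := (hY _ (hqY m)).2.2.2.2.1
    have h2 : (64 : ℝ) * (q m : ℝ) ^ b ≤ (q (m + 1) : ℝ) ^ b := by
      have h3 := Real.rpow_le_rpow (by positivity) (hqs m).1 hb0.le
      rw [← Real.rpow_mul (by positivity)] at h3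
      refine le_trans ?_ h3
      have : e * b = b * (e - 1) + b := by ring
      rw [this, Real.rpow_add (hqpos m)]
      gcongr
    have h4 : (32 : ℝ) * K m ≤ K (m + 1) := by linarith [hKu m, hKl (m + 1)]
    exact_mod_cast h4
  have hdex : ∀ m, ∃ n : ℕ, 16 * q m ≤ 2 ^ n ∧ 2 ^ n ≤ 32 * q m := by
    intro m
    have hqm : 1 ≤ q m := by exact_mod_cast hq1 m
    obtain ⟨n, h1, h2⟩ := exists_nat_pow_near (x := 16 * q m) (y := 2) (by omega) (by norm_num)
    exact ⟨n + 1, h2.le, by rw [pow_succ]; omega⟩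
  choose d hd1 hd2 using hdex
  have hgood : ∀ m, ∀ l : ℤ, l ≠ 0 → |l| < q m → 8 * (1 / 2 : ℝ) ^ d m ≤ nd (l * α) := by
    intro m l h0 hl
    refine le_trans ?_ ((hqg m).2 l h0 hl)
    have h1 : (16 : ℝ) * q m ≤ 2 ^ d m := by exact_mod_cast hd1 m
    have := hqpos m
    rw [one_div, inv_pow, ← div_eq_mul_inv, div_le_div_iff₀ (by positivity) (by positivity)]
    linarith
  have hkex := fun m => exists_free_time (α := α) (ρ := fun m => (1 / 2 : ℝ) ^ d m)
    (fun m l h0 hl => le_trans (by have : (0 : ℝ) ≤ (1 / 2 : ℝ) ^ d m := by positivity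
                                   linarith) (hgood m l h0 hl)) hK0 hKq hKs m
  choose k hk1 hk2 hk3 using hkex
  have hKm : ∀ m, m + 1 ≤ K m := by
    intro m
    induction m with
    | zero => exact hK0
    | succ n ih => exact le_trans (by omega) (hKs n)
  refine ⟨⟨q, d, k, R, hgood, hd1, hd2, fun m => ?_, fun m => ?_, fun m => ?_, ?_, ?_, ?_, ?_, ?_,
    ?_⟩⟩
  · have := hKm m; have := hk1 m; omega
  · have := hKm m; have := hk1 m; omega
  · refine le_trans ?_ (hKq m)
    have e1 : 2 ^ (15 + m) * K m = 2 ^ (14 + m) * (2 * K m) := by ring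
    rw [e1]; exact Nat.mul_le_mul_left _ (hk2 m).le
  · refine strictMono_nat_of_lt_succ fun m => ?_
    have h1 : (4 : ℝ) * q m ≤ q (m + 1) := by
      refine le_trans ?_ (hqgrow m)
      have : (1 : ℝ) ≤ 2 ^ E := one_le_pow₀ (by norm_num)
      have := hqpos m
      rw [pow_add]; nlinarith
    have h1' : 4 * q m ≤ q (m + 1) := by exact_mod_cast h1
    have hqm : 1 ≤ q m := by exact_mod_cast hq1 m
    refine (Nat.pow_lt_pow_iff_right (a := 2) (by norm_num)).1 ?_
    have := hd1 (m + 1); have := hd2 m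
    omega
  · intro m m' hm' i hi
    exact hk3 m m' hm' i (by have := hk2 m'; omega)
  · intro m
    have h1 : ((2 : ℝ) ^ a) ^ (d (m + 1) + 1) = ((2 : ℝ) ^ (d (m + 1) + 1)) ^ a := by
      rw [← Real.rpow_natCast, ← Real.rpow_natCast, ← Real.rpow_mul (by norm_num),
        ← Real.rpow_mul (by norm_num), mul_comm]
    have h2 : (2 : ℝ) ^ (d (m + 1) + 1) ≤ 64 * q (m + 1) := by
      have : (2 : ℝ) ^ d (m + 1) ≤ 32 * q (m + 1) := by exact_mod_cast hd2 (m + 1)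
      rw [pow_succ]; linarith
    have h3 : (q (m + 1) : ℝ) ^ a ≤ (q m : ℝ) ^ b := by
      have := Real.rpow_le_rpow (by positivity) (hqs m).2 ha0.le
      rwa [← Real.rpow_mul (by positivity), ← Real.rpow_mul (by positivity), ← mul_assoc, hea] at this
    have h4 : (64 : ℝ) ^ a ≤ 64 := by
      have := Real.rpow_le_rpow_of_exponent_le (by norm_num : (1 : ℝ) ≤ 64) ha1.le
      rwa [Real.rpow_one] at this
    have h5 : (K m : ℝ) ≤ k m := by exact_mod_cast hk1 m
    calc _ = _ := h1
      _ ≤ (64 * (q (m + 1) : ℝ)) ^ a := by gcongr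
      _ = 64 ^ a * (q (m + 1) : ℝ) ^ a := Real.mul_rpow (by norm_num) (by positivity)
      _ ≤ 64 * (q m : ℝ) ^ b := by gcongr
      _ ≤ _ := by have := hKl m; linarith
  · intro j; positivity
  · intro j hj l h0 hl
    have hdj : j₁ ≤ d 0 := by
      have h1 : (2 : ℝ) ^ j₁ ≤ 2 ^ d 0 := by
        have h2 := (hY _ (hqY 0)).2.2.2.2.2
        have h3 : (16 : ℝ) * q 0 ≤ 2 ^ d 0 := by exact_mod_cast hd1 0
        linarith [hqpos 0]
      exact (pow_le_pow_iff_right₀ (by norm_num : (1 : ℝ) < 2)).1 h1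
    obtain ⟨p, hp, hRp, hpR⟩ := hX (R j) (hj₁ j (hdj.trans hj))
    have hlp : |l| < p := by
      have : |(l : ℝ)| < p := hl.trans_le hRp
      exact_mod_cast this
    refine le_trans ?_ (hp.2 l h0 hlp)
    have hp0 : (0 : ℝ) < p := by exact_mod_cast hp.1
    have hR : R j ^ e = 2 ^ ((j : ℝ) - 2) := by
      change ((2 : ℝ) ^ (((j : ℝ) - 2) / e)) ^ e = _
      rw [← Real.rpow_mul (by norm_num)]; congr 1; field_simp
    rw [hR, Real.rpow_sub (by norm_num), Real.rpow_natCast] at hpR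
    rw [one_div, inv_pow, ← div_eq_mul_inv, div_le_div_iff₀ (by positivity) (by positivity)]
    norm_num at hpR
    linarith
  · have h1 : ∀ j : ℕ, ((2 : ℝ) ^ a) ^ j / R j = 2 ^ (2 / e) * ((2 : ℝ) ^ (a - 1 / e)) ^ j := by
      intro j
      change ((2 : ℝ) ^ a) ^ j / (2 : ℝ) ^ (((j : ℝ) - 2) / e) = _
      rw [← Real.rpow_natCast, ← Real.rpow_natCast, ← Real.rpow_mul (by norm_num),
        ← Real.rpow_mul (by norm_num), ← Real.rpow_sub (by norm_num),
        ← Real.rpow_add (by norm_num)]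
      congr 1; field_simp; ring
    simp only [h1]
    refine (summable_geometric_of_lt_one (by positivity) ?_).mul_left _
    apply Real.rpow_lt_one_of_one_lt_of_neg (by norm_num)
    rw [sub_neg, lt_div_iff₀ he0]; exact hae

theorem abs_nd_sub_le (x y : ℝ) : nd x ≤ nd y + |x - y| := by
  have h := nd_add_le y (x - y)
  rw [add_sub_cancel] at h
  linarith [nd_le_abs (x - y)]

theorem continuous_nd : Continuous nd := by
  refine (LipschitzWith.of_dist_le_mul (K := 1) fun x y => ?_).continuous
  rw [Real.dist_eq, Real.dist_eq, NNReal.coe_one, one_mul, abs_le]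
  have h1 := abs_nd_sub_le x y
  have h2 := abs_nd_sub_le y x
  rw [abs_sub_comm] at h2
  constructor <;> linarith

theorem round_eq_of_abs_lt {x : ℝ} {z : ℤ} (h : |x - z| < 1 / 2) : round x = z := by
  have h1 := nd_le x z
  have h2 : |(round x : ℝ) - z| < 1 := by
    have h3 : (round x : ℝ) - z = (x - z) - (x - round x) := by ring
    rw [h3]
    refine (abs_sub _ _).trans_lt ?_
    rw [nd] at h1
    linarith
  have h3 : |round x - z| < 1 := by exact_mod_cast h2
  rw [Int.abs_lt_one_iff] at h3
  omega

/-- The `1`-periodic extension of the rescaled bump `x ↦ χ (2 ^ j * x)`. -/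
def pbump (χ : ℝ → ℝ) (j : ℕ) (x : ℝ) : ℝ := χ (2 ^ j * (x - round x))

theorem pbump_add_one (χ : ℝ → ℝ) (j : ℕ) (x : ℝ) : pbump χ j (x + 1) = pbump χ j x := by
  rw [pbump, round_add_one]; push_cast; rw [pbump]; congr 2; ring

namespace IsBump

variable {s K M : ℝ} {χ : ℝ → ℝ}

theorem pbump_nonneg (h : IsBump s K M χ) (j : ℕ) (x : ℝ) : 0 ≤ pbump χ j x := h.nonneg _

theorem pbump_le_one (h : IsBump s K M χ) (j : ℕ) (x : ℝ) : pbump χ j x ≤ 1 := h.le_one _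

theorem pbump_eq_one (h : IsBump s K M χ) {j : ℕ} {x : ℝ} (hx : nd x ≤ (1 / 2) ^ (j + 1)) :
    pbump χ j x = 1 := by
  apply h.eq_one
  rw [abs_mul, abs_of_pos (by positivity : (0 : ℝ) < 2 ^ j)]
  have h1 := mul_le_mul_of_nonneg_left hx (by positivity : (0 : ℝ) ≤ 2 ^ j)
  rw [pow_succ, ← mul_assoc, ← mul_pow] at h1
  norm_num at h1
  rw [nd] at h1
  linarith

theorem pbump_eq_zero (h : IsBump s K M χ) {j : ℕ} {x : ℝ} (hx : (1 / 2) ^ j ≤ nd x) :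
    pbump χ j x = 0 := by
  apply h.eq_zero
  rw [abs_mul, abs_of_pos (by positivity : (0 : ℝ) < 2 ^ j)]
  have h1 := mul_le_mul_of_nonneg_left hx (by positivity : (0 : ℝ) ≤ 2 ^ j)
  rw [← mul_pow] at h1
  norm_num at h1
  exact h1

theorem pbump_eventuallyEq (h : IsBump s K M χ) {j : ℕ} (hj : 2 ≤ j) (x : ℝ) :
    (fun y => χ (2 ^ j * y + -(2 ^ j * round x))) =ᶠ[nhds x] pbump χ j := by
  filter_upwards [Metric.ball_mem_nhds x (by norm_num : (0 : ℝ) < 1 / 4)] with y hy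
  rw [Metric.mem_ball, Real.dist_eq] at hy
  by_cases hr : |y - round x| < 1 / 2
  · rw [pbump, round_eq_of_abs_lt hr]; congr 1; ring
  · push Not at hr
    have hjj : (4 : ℝ) ≤ 2 ^ j := by
      calc (4 : ℝ) = 2 ^ 2 := by norm_num
        _ ≤ 2 ^ j := pow_le_pow_right₀ (by norm_num) hj
    have h1 : χ (2 ^ j * y + -(2 ^ j * round x)) = 0 := by
      apply h.eq_zero
      have e : (2 : ℝ) ^ j * y + -(2 ^ j * round x) = 2 ^ j * (y - round x) := by ring
      rw [e, abs_mul, abs_of_pos (by positivity : (0 : ℝ) < 2 ^ j)]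
      nlinarith
    rw [h1]
    symm
    apply h.pbump_eq_zero
    have h2 : (1 / 2 : ℝ) ^ j ≤ 1 / 4 := by
      calc (1 / 2 : ℝ) ^ j ≤ (1 / 2) ^ 2 := pow_le_pow_of_le_one (by norm_num) (by norm_num) hj
        _ = 1 / 4 := by norm_num
    refine h2.trans ?_
    have h3 : |y - x| < 1 / 4 := hy
    have h4 := nd_le_half x
    have h5 : |y - round x| ≤ |y - x| + |x - round x| := abs_sub_le _ _ _
    rw [nd] at h4
    rw [nd]
    by_contra hcon
    push Not at hcon
    have hne : round y ≠ round x := by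
      intro he; rw [he] at hcon; linarith
    have h6 : (1 : ℝ) ≤ |(round y : ℝ) - round x| := by
      have : 1 ≤ |round y - round x| := Int.one_le_abs (sub_ne_zero.2 hne)
      exact_mod_cast this
    have h7 : |(round y : ℝ) - round x| ≤ |(round y : ℝ) - y| + |y - round x| := abs_sub_le _ _ _
    rw [abs_sub_comm (round y : ℝ) y] at h7
    linarith

theorem smooth_pbump (h : IsBump s K M χ) {j : ℕ} (hj : 2 ≤ j) : Smooth (pbump χ j) := by
  refine contDiff_iff_contDiffAt.2 fun x => ?_
  refine ContDiffAt.congr_of_eventuallyEq ?_ (h.pbump_eventuallyEq hj x).symm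
  exact (h.smooth.comp ((contDiff_const.mul contDiff_id).add contDiff_const)).contDiffAt

theorem jet_pbump (h : IsBump s K M χ) {j : ℕ} (hj : 2 ≤ j) (x : ℝ) :
    Jet s (2 ^ j * K) M (pbump χ j) x := by
  have h1 := (h.jet (2 ^ j * x + -(2 ^ j * round x))).comp_affine h.smooth
  rw [abs_of_pos (by positivity : (0 : ℝ) < 2 ^ j)] at h1
  exact h1.congr (h.pbump_eventuallyEq hj x)

theorem jet_pbump_of_lt (h : IsBump s K M χ) {j : ℕ} {x : ℝ} (hx : (1 / 2) ^ j < nd x) (K' : ℝ) :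
    Jet s K' 0 (pbump χ j) x := by
  have h0 : Jet s K' 0 (fun _ : ℝ => (0 : ℝ)) x := by
    intro n; rw [iteratedDeriv_const]; simp
  refine h0.congr ?_
  filter_upwards [(continuous_nd.tendsto x).eventually (lt_mem_nhds hx)] with y hy
  exact (h.pbump_eq_zero hy.le).symm

theorem M_nonneg (h : IsBump s K M χ) : 0 ≤ M := (h.jet 0).nonneg

end IsBump

/-- The parameters and building blocks of the construction. -/
structure Setup (α s : ℝ) where
  s₁ : ℝ
  σ : ℝ
  a : ℝ
  K : ℝ
  M : ℝ
  χ : ℝ → ℝ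
  one_le_s₁ : 1 ≤ s₁
  add_eq : s₁ + σ = s
  σ_pos : 0 < σ
  a_pos : 0 < a
  a_lt : a < 1
  inv_lt : 1 / σ < a
  bump : IsBump s₁ K M χ
  sc : Scales α a

namespace Setup

variable {α s : ℝ} (S : Setup α s)

/-- The growth rate of the heights of the singularity. -/
def Θ : ℝ := 2 ^ S.a

/-- The first scale of the singularity. -/
def j₀ : ℕ := S.sc.d 0 + 1

/-- The scale at which the `N`-th approximation is truncated. -/
def J (N : ℕ) : ℕ := S.sc.d (N + 1) + 1

/-- The truncated logarithmic singularity. -/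
def psi (J : ℕ) (x : ℝ) : ℝ := ∑ j ∈ Finset.Ico S.j₀ J, S.Θ ^ j * pbump S.χ j x

/-- The cut-off at the `m`-th resonance scale. -/
def eta (m : ℕ) : ℝ → ℝ := pbump S.χ (S.sc.d m)

/-- A majorant of the truncated singularity, controlling also its jets. -/
def maj (J : ℕ) (x : ℝ) : ℝ :=
  ∑ j ∈ Finset.Ico S.j₀ J, if nd x ≤ (1 / 2) ^ j then S.Θ ^ j else 0

theorem one_lt_Θ : 1 < S.Θ := Real.one_lt_rpow (by norm_num) S.a_pos

theorem Θ_lt_two : S.Θ < 2 := by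
  have := Real.rpow_lt_rpow_of_exponent_lt (by norm_num : (1 : ℝ) < 2) S.a_lt
  rwa [Real.rpow_one] at this

theorem Θ_pos : 0 < S.Θ := one_pos.trans S.one_lt_Θ

theorem K_pos : 0 < S.K := one_pos.trans_le S.bump.one_le_K

theorem q_pos (m : ℕ) : 2 ^ 14 ≤ S.sc.q m := by
  have h1 := S.sc.k_le m
  have h2 := S.sc.k_pos m
  have h3 : 2 ^ 14 ≤ 2 ^ (14 + m) := Nat.pow_le_pow_right (by norm_num) (by omega)
  calc 2 ^ 14 ≤ 2 ^ (14 + m) * 1 := by omega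
    _ ≤ 2 ^ (14 + m) * S.sc.k m := Nat.mul_le_mul_left _ h2
    _ ≤ _ := h1

theorem four_le_d (m : ℕ) : 4 ≤ S.sc.d m := by
  have h1 := S.sc.q_le m
  have h2 := S.q_pos m
  refine (Nat.pow_le_pow_iff_right (a := 2) (by norm_num)).1 ?_
  omega

theorem two_le_j₀ : 2 ≤ S.j₀ := by
  have := S.four_le_d 0; rw [j₀]; omega

theorem j₀_lt_J (N : ℕ) : S.j₀ < S.J N := by
  have := S.sc.d_mono (Nat.succ_pos N); rw [j₀, J]; simp only [Nat.succ_eq_add_one] at this; omega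

theorem J_mono : StrictMono S.J := fun a b h => by
  have := S.sc.d_mono (Nat.succ_lt_succ h); rw [J, J]; simp only [Nat.succ_eq_add_one] at this; omega

theorem smooth_pb {j : ℕ} (hj : S.j₀ ≤ j) : Smooth (pbump S.χ j) :=
  S.bump.smooth_pbump (S.two_le_j₀.trans hj)

theorem smooth_eta (m : ℕ) : Smooth (S.eta m) :=
  S.bump.smooth_pbump (le_trans (by norm_num) (S.four_le_d m))

theorem smooth_psi (J : ℕ) : Smooth (S.psi J) := by
  exact ContDiff.sum fun j hj => contDiff_const.mul (S.smooth_pb (Finset.mem_Ico.1 hj).1)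

theorem psi_nonneg (J : ℕ) (x : ℝ) : 0 ≤ S.psi J x :=
  Finset.sum_nonneg fun _ _ => mul_nonneg (pow_nonneg S.Θ_pos.le _) (S.bump.pbump_nonneg _ _)

theorem maj_nonneg (J : ℕ) (x : ℝ) : 0 ≤ S.maj J x :=
  Finset.sum_nonneg fun j _ => by
    have := pow_nonneg S.Θ_pos.le j
    split_ifs <;> simp [this]

theorem psi_le_maj (J : ℕ) (x : ℝ) : S.psi J x ≤ S.maj J x := by
  refine Finset.sum_le_sum fun j _ => ?_
  have := pow_nonneg S.Θ_pos.le j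
  split_ifs with h
  · exact mul_le_of_le_one_right this (S.bump.pbump_le_one _ _)
  · rw [S.bump.pbump_eq_zero (not_le.1 h).le, mul_zero]

theorem psi_add_one (J : ℕ) (x : ℝ) : S.psi J (x + 1) = S.psi J x := by
  simp only [psi, pbump_add_one]

theorem eta_add_one (m : ℕ) (x : ℝ) : S.eta m (x + 1) = S.eta m x := pbump_add_one _ _ _

theorem psi_eq_zero (J : ℕ) {x : ℝ} (hx : (1 / 2) ^ S.j₀ ≤ nd x) : S.psi J x = 0 := by
  refine Finset.sum_eq_zero fun j hj => ?_
  rw [S.bump.pbump_eq_zero, mul_zero]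
  exact (pow_le_pow_of_le_one (by norm_num) (by norm_num) (Finset.mem_Ico.1 hj).1).trans hx

theorem psi_eq_psi {J J' : ℕ} (hJ : S.j₀ ≤ J) (hJJ : J ≤ J') {x : ℝ} (hx : (1 / 2) ^ J ≤ nd x) :
    S.psi J' x = S.psi J x := by
  rw [psi, psi, ← Finset.sum_Ico_consecutive _ hJ hJJ, add_eq_left]
  refine Finset.sum_eq_zero fun j hj => ?_
  rw [S.bump.pbump_eq_zero, mul_zero]
  exact (pow_le_pow_of_le_one (by norm_num) (by norm_num) (Finset.mem_Ico.1 hj).1).trans hx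

theorem psi_eq_sum (J : ℕ) {x : ℝ} (hx : nd x ≤ (1 / 2) ^ J) :
    S.psi J x = ∑ j ∈ Finset.Ico S.j₀ J, S.Θ ^ j := by
  refine Finset.sum_congr rfl fun j hj => ?_
  rw [S.bump.pbump_eq_one, mul_one]
  exact hx.trans (pow_le_pow_of_le_one (by norm_num) (by norm_num) (Finset.mem_Ico.1 hj).2)

theorem sum_Θ_le (J : ℕ) : ∑ j ∈ Finset.Ico S.j₀ J, S.Θ ^ j ≤ S.Θ ^ J / (S.Θ - 1) := by
  have h1 : ∑ j ∈ Finset.Ico S.j₀ J, S.Θ ^ j ≤ ∑ j ∈ Finset.range J, S.Θ ^ j :=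
    Finset.sum_le_sum_of_subset_of_nonneg (fun j hj => by simp at hj ⊢; omega)
      fun j _ _ => pow_nonneg S.Θ_pos.le j
  refine h1.trans ?_
  rw [geom_sum_eq S.one_lt_Θ.ne']
  have := S.one_lt_Θ
  gcongr
  linarith

theorem maj_le (J : ℕ) (x : ℝ) : S.maj J x ≤ S.Θ ^ J / (S.Θ - 1) := by
  refine le_trans (Finset.sum_le_sum fun j _ => ?_) (S.sum_Θ_le J)
  have := pow_nonneg S.Θ_pos.le j
  split_ifs <;> simp [this]

theorem jet_psi (J : ℕ) (x : ℝ) : Jet S.s₁ (2 ^ J * S.K) (S.M * S.maj J x) (S.psi J) x := by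
  have hK := S.K_pos
  have h1 : ∀ j : ℕ, Smooth fun y => if S.j₀ ≤ j then S.Θ ^ j * pbump S.χ j y else 0 := by
    intro j
    split_ifs with h
    · exact contDiff_const.mul (S.smooth_pb h)
    · exact contDiff_const
  have h2 := jet_sum (s := S.s₁) (K := 2 ^ J * S.K) (by positivity) (x := x)
    (Finset.Ico S.j₀ J) (fun j y => if S.j₀ ≤ j then S.Θ ^ j * pbump S.χ j y else 0)
    (fun j => S.M * if nd x ≤ (1 / 2) ^ j then S.Θ ^ j else 0) h1 ?_
  · rw [← Finset.mul_sum] at h2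
    have e : S.psi J = fun y => ∑ j ∈ Finset.Ico S.j₀ J,
        if S.j₀ ≤ j then S.Θ ^ j * pbump S.χ j y else 0 := by
      funext y
      exact Finset.sum_congr rfl fun j hj => by rw [if_pos (Finset.mem_Ico.1 hj).1]
    rw [e]; exact h2
  · intro j hj
    rw [Finset.mem_Ico] at hj
    simp only [if_pos hj.1]
    have hΘ := pow_pos S.Θ_pos j
    split_ifs with h
    · have h3 := (S.bump.jet_pbump (S.two_le_j₀.trans hj.1) x).const_mul (S.Θ ^ j)
      rw [abs_of_pos hΘ] at h3
      refine h3.mono (by positivity) ?_ (by rw [mul_comm])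
      gcongr
      · norm_num
      · exact hj.2.le
    · have h3 := (S.bump.jet_pbump_of_lt (not_le.1 h) (2 ^ J * S.K)).const_mul (S.Θ ^ j)
      simpa using h3

end Setup

namespace Setup

variable {α s : ℝ} (S : Setup α s)

theorem nd_mul_eq {α ω : ℝ} (hω : ω = α ∨ ω = -α) (l : ℝ) : nd (l * ω) = nd (l * α) := by
  rcases hω with rfl | rfl
  · rfl
  · rw [mul_neg, nd_neg]

theorem four_k_le (m : ℕ) : 4 * S.sc.k m ≤ S.sc.q m := by
  refine le_trans (Nat.mul_le_mul_right _ ?_) (S.sc.k_le m)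
  calc 4 = 2 ^ 2 := by norm_num
    _ ≤ 2 ^ (14 + m) := Nat.pow_le_pow_right (by norm_num) (by omega)

/-- The rate in the bound for the total height met by an orbit before a resonance. -/
def visitRate : ℝ := ∑' j, S.Θ ^ j / S.sc.R (j - 1)

theorem summable_visit : Summable fun j => S.Θ ^ j / S.sc.R (j - 1) := by
  rw [← summable_nat_add_iff 1]
  have h := S.sc.summable.mul_left S.Θ
  refine h.congr fun j => ?_
  rw [Nat.add_sub_cancel, pow_succ, Θ]; ring

theorem visitRate_nonneg : 0 ≤ S.visitRate :=
  tsum_nonneg fun _ => div_nonneg (pow_nonneg S.Θ_pos.le _) (S.sc.R_pos _).le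

theorem visits_card_le {ω : ℝ} (hω : ω = α ∨ ω = -α) {m j : ℕ} (hj : S.j₀ ≤ j) {x : ℝ}
    (hx : nd x ≤ (1 / 2) ^ S.sc.d m) :
    (((Finset.range (S.sc.k m)).filter fun l : ℕ => nd (x + (l + 1) * ω) ≤ (1 / 2) ^ j).card : ℝ) ≤
      S.sc.k m / S.sc.R (j - 1) := by
  have hR := S.sc.R_pos (j - 1)
  rcases le_or_gt (S.sc.d m) j with hdj | hdj
  · rw [Finset.filter_eq_empty_iff.2, Finset.card_empty, Nat.cast_zero]
    · positivity
    intro l hl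
    rw [Finset.mem_range] at hl
    have h1 := S.sc.good m (l + 1) (by omega) (by
      have := S.four_k_le m
      rw [abs_of_pos (by omega)]; omega)
    push_cast at h1
    rw [← nd_mul_eq hω] at h1
    have h2 := nd_sub_le (x + (l + 1) * ω) x
    rw [add_sub_cancel_left] at h2
    have h3 : (1 / 2 : ℝ) ^ j ≤ (1 / 2) ^ S.sc.d m :=
      pow_le_pow_of_le_one (by norm_num) (by norm_num) hdj
    have h4 : (0 : ℝ) < (1 / 2) ^ S.sc.d m := by positivity
    rw [not_le]
    linarith
  · have hsep : ∀ l : ℤ, l ≠ 0 → |(l : ℝ)| < S.sc.R (j - 1) → 4 * (1 / 2 : ℝ) ^ j ≤ nd (l * ω) := by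
      intro l h0 hl
      have h1 := S.sc.sep (j - 1) (by rw [j₀] at hj; omega) l h0 hl
      rw [← nd_mul_eq hω] at h1
      refine le_trans (le_of_eq ?_) h1
      obtain ⟨i, rfl⟩ : ∃ i, j = i + 1 := ⟨j - 1, by have := S.two_le_j₀; omega⟩
      rw [Nat.add_sub_cancel, pow_succ]; ring
    have hp : (0 : ℝ) < (1 / 2) ^ j := by positivity
    have hxj : nd x ≤ (1 / 2) ^ j := hx.trans (pow_le_pow_of_le_one (by norm_num) (by norm_num) hdj.le)
    set T := (Finset.range (S.sc.k m)).filter fun l : ℕ => nd (x + (l + 1) * ω) ≤ (1 / 2) ^ j with hT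
    have hinj : Function.Injective fun l : ℕ => (l : ℤ) + 1 := fun a b h => by
      simp only at h; omega
    rw [le_div_iff₀ hR, mul_comm, ← Finset.card_image_of_injective T hinj]
    have key := spaced_card_le (q := S.sc.R (j - 1)) (T.image fun l : ℕ => (l : ℤ) + 1)
      (S.sc.R (j - 1)) ?_ ?_ (S.sc.k m) (by simp) ?_
    · simpa using key
    · intro i hi i' hi' hlt
      obtain ⟨l, hl, rfl⟩ := Finset.mem_image.1 hi
      obtain ⟨l', hl', rfl⟩ := Finset.mem_image.1 hi'
      by_contra hcon
      push Not at hcon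
      push_cast at hcon
      have hlt' : (l : ℝ) < l' := by
        have : l < l' := by omega
        exact_mod_cast this
      have h1 := hsep ((l' : ℤ) - l) (by omega) (by
        push_cast; rw [abs_of_pos (by linarith)]; linarith)
      have h2 := nd_sub_le (x + (l' + 1) * ω) (x + (l + 1) * ω)
      rw [show x + ((l' : ℝ) + 1) * ω - (x + (l + 1) * ω) = ((l' : ℝ) - l) * ω by ring] at h2
      push_cast at h1
      have h3 := (Finset.mem_filter.1 hl).2
      have h4 := (Finset.mem_filter.1 hl').2
      linarith
    · intro i hi
      obtain ⟨l, hl, rfl⟩ := Finset.mem_image.1 hi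
      by_contra hcon
      push Not at hcon
      have h1 := hsep ((l : ℤ) + 1) (by omega) (by rw [abs_of_pos (by positivity)]; exact hcon)
      have h2 := nd_sub_le (x + (l + 1) * ω) x
      rw [add_sub_cancel_left] at h2
      push_cast at h1
      have h3 := (Finset.mem_filter.1 hl).2
      linarith
    · intro i hi
      obtain ⟨l, hl, rfl⟩ := Finset.mem_image.1 hi
      have := Finset.mem_range.1 (Finset.mem_filter.1 hl).1
      have h2 : l + 1 ≤ S.sc.k m := this
      push_cast
      exact_mod_cast h2

theorem sum_maj_le {ω : ℝ} (hω : ω = α ∨ ω = -α) (m J : ℕ) {x : ℝ}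
    (hx : nd x ≤ (1 / 2) ^ S.sc.d m) :
    ∑ l ∈ Finset.range (S.sc.k m), S.maj J (x + (l + 1) * ω) ≤ S.visitRate * S.sc.k m := by
  have h1 : ∑ l ∈ Finset.range (S.sc.k m), S.maj J (x + (l + 1) * ω) ≤
      ∑ j ∈ Finset.Ico S.j₀ J, S.Θ ^ j / S.sc.R (j - 1) * S.sc.k m := by
    simp only [maj]
    rw [Finset.sum_comm]
    refine Finset.sum_le_sum fun j hj => ?_
    rw [← Finset.sum_filter, Finset.sum_const, nsmul_eq_mul]
    have h2 := mul_le_mul_of_nonneg_left (S.visits_card_le hω (Finset.mem_Ico.1 hj).1 hx)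
      (pow_nonneg S.Θ_pos.le j)
    calc _ = _ := mul_comm _ _
      _ ≤ _ := h2
      _ = _ := by ring
  refine h1.trans ?_
  rw [← Finset.sum_mul]
  gcongr
  exact S.summable_visit.sum_le_tsum _
    fun j _ => div_nonneg (pow_nonneg S.Θ_pos.le _) (S.sc.R_pos _).le

/-- The (unnormalised) correction located at the `m`-th resonance, in the direction `ω = ± α`. -/
def corr (ω : ℝ) (m : ℕ) (y : ℝ) : ℝ :=
  (S.eta m y - S.eta (m + 1) y) * (Real.exp (S.psi (S.J m) y) - 1) *
    Real.exp (2 * ∑ l ∈ Finset.range (S.sc.k m), S.psi (S.J m) (y + (l + 1) * ω))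

theorem smooth_sum_psi (J k : ℕ) (ω : ℝ) :
    Smooth fun y => ∑ l ∈ Finset.range k, S.psi J (y + (l + 1) * ω) :=
  ContDiff.sum fun _ _ => (S.smooth_psi J).comp (contDiff_id.add contDiff_const)

theorem smooth_corr (ω : ℝ) (m : ℕ) : Smooth (S.corr ω m) :=
  (((S.smooth_eta m).sub (S.smooth_eta (m + 1))).mul ((S.smooth_psi _).exp.sub contDiff_const)).mul
    (contDiff_const.mul (S.smooth_sum_psi _ _ _)).exp

theorem corr_eq_zero (ω : ℝ) {m : ℕ} {y : ℝ} (hy : (1 / 2) ^ S.sc.d m ≤ nd y) :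
    S.corr ω m y = 0 := by
  have h1 : S.eta m y = 0 := S.bump.pbump_eq_zero hy
  have h2 : S.eta (m + 1) y = 0 := S.bump.pbump_eq_zero
    ((pow_le_pow_of_le_one (by norm_num) (by norm_num) (S.sc.d_mono (Nat.lt_succ_self m)).le).trans hy)
  rw [corr, h1, h2]; ring

theorem scale_rpow_le (J : ℕ) : (2 ^ J * S.K / 1) ^ (1 / S.σ) ≤ S.K ^ (1 / S.σ) * S.Θ ^ J := by
  have hK := S.K_pos
  rw [div_one, Real.mul_rpow (by positivity) hK.le, mul_comm]
  gcongr
  rw [Θ, ← Real.rpow_natCast, ← Real.rpow_natCast, ← Real.rpow_mul (by norm_num),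
    ← Real.rpow_mul (by norm_num), mul_comm]
  exact Real.rpow_le_rpow_of_exponent_le (by norm_num)
    (mul_le_mul_of_nonneg_right S.inv_lt.le (Nat.cast_nonneg J))

theorem jet_corr_aux {ω : ℝ} (hω : ω = α ∨ ω = -α) (m : ℕ) {x : ℝ}
    (hx : nd x ≤ (1 / 2) ^ S.sc.d m) : Jet S.s₁ (2 ^ S.J m * S.K) (12 * (12 * (S.M + S.M) *
      (Real.exp ((1 + 36 * S.M) * (S.Θ ^ S.J m / (S.Θ - 1)) + 6) + |(1 : ℝ)|)) *
        Real.exp ((2 + 72 * S.M) * (S.visitRate * S.sc.k m) + 6)) (S.corr ω m) x := by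
  have hK := S.K_pos
  have hM := S.bump.M_nonneg
  have hKJ : 0 ≤ 2 ^ S.J m * S.K := by positivity
  have hη : ∀ i, i ≤ m + 1 → Jet S.s₁ (2 ^ S.J m * S.K) S.M (S.eta i) x := by
    intro i hi
    refine (S.bump.jet_pbump (le_trans (by norm_num) (S.four_le_d i)) x).mono (by positivity) ?_ le_rfl
    gcongr
    · norm_num
    · have := S.sc.d_mono.monotone hi; rw [J]; omega
  have h1 := (hη m (by omega)).sub (S.smooth_eta m) (S.smooth_eta (m + 1)) (hη (m + 1) le_rfl)
  have hmaj := S.maj_nonneg (S.J m) x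
  have h2 := jet_exp S.one_le_s₁ hKJ (mul_nonneg hM hmaj) (S.smooth_psi (S.J m))
    (fun n _ => S.jet_psi (S.J m) x n)
  have h2' : Jet S.s₁ (2 ^ S.J m * S.K)
      (Real.exp ((1 + 36 * S.M) * (S.Θ ^ S.J m / (S.Θ - 1)) + 6))
      (fun y => Real.exp (S.psi (S.J m) y)) x := by
    refine h2.mono_const hKJ (Real.exp_le_exp.2 ?_)
    have e1 := S.psi_le_maj (S.J m) x
    have e2 := S.maj_le (S.J m) x
    have e3 := mul_le_mul_of_nonneg_left e2 (by positivity : 0 ≤ 1 + 36 * S.M)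
    linarith
  have h3 := h2'.sub (S.smooth_psi _).exp contDiff_const (jet_const hKJ 1 x)
  have hsm : ∀ l : ℕ, Smooth fun y => S.psi (S.J m) (y + (l + 1) * ω) := fun l =>
    (S.smooth_psi _).comp (contDiff_id.add contDiff_const)
  have h4 := jet_sum hKJ (Finset.range (S.sc.k m))
    (fun (l : ℕ) y => S.psi (S.J m) (y + (l + 1) * ω))
    (fun l => S.M * S.maj (S.J m) (x + (l + 1) * ω)) hsm (x := x) (s := S.s₁) (fun l _ => by
      have := (S.jet_psi (S.J m) (1 * x + (l + 1) * ω)).comp_affine (S.smooth_psi _)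
      simpa using this)
  have h5 := h4.const_mul 2
  rw [← Finset.mul_sum, abs_of_pos (by norm_num : (0 : ℝ) < 2)] at h5
  have hsum0 : 0 ≤ ∑ l ∈ Finset.range (S.sc.k m), S.maj (S.J m) (x + (l + 1) * ω) :=
    Finset.sum_nonneg fun l _ => S.maj_nonneg _ _
  have h6 := jet_exp S.one_le_s₁ hKJ (by positivity) (contDiff_const.mul (S.smooth_sum_psi _ _ _))
    (fun n _ => h5 n)
  have h6' : Jet S.s₁ (2 ^ S.J m * S.K) (Real.exp ((2 + 72 * S.M) * (S.visitRate * S.sc.k m) + 6))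
      (fun y => Real.exp (2 * ∑ l ∈ Finset.range (S.sc.k m), S.psi (S.J m) (y + (l + 1) * ω))) x := by
    refine h6.mono_const hKJ (Real.exp_le_exp.2 ?_)
    have e1 : ∑ l ∈ Finset.range (S.sc.k m), S.psi (S.J m) (x + (l + 1) * ω) ≤
        ∑ l ∈ Finset.range (S.sc.k m), S.maj (S.J m) (x + (l + 1) * ω) :=
      Finset.sum_le_sum fun l _ => S.psi_le_maj _ _
    have e2 := S.sum_maj_le hω m (S.J m) hx
    have e3 := mul_le_mul_of_nonneg_left e2 (by positivity : 0 ≤ 2 + 72 * S.M)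
    linarith
  have hs1 : Smooth fun y => S.eta m y - S.eta (m + 1) y := (S.smooth_eta m).sub (S.smooth_eta _)
  have hs2 : Smooth fun y => Real.exp (S.psi (S.J m) y) - 1 :=
    (S.smooth_psi _).exp.sub contDiff_const
  exact (h1.mul S.one_le_s₁ hKJ hs1 hs2 h3).mul S.one_le_s₁ hKJ (hs1.mul hs2)
    (contDiff_const.mul (S.smooth_sum_psi _ _ _)).exp h6'

theorem exists_jet_corr : ∃ C : ℝ, ∀ ω, (ω = α ∨ ω = -α) → ∀ m x,
    Jet s 1 (Real.exp (C * S.sc.k m)) (S.corr ω m) x := by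
  have hM := S.bump.M_nonneg
  have hΘ := S.one_lt_Θ
  have hv := S.visitRate_nonneg
  have hK := S.K_pos
  have hσ := S.σ_pos
  refine ⟨288 * S.M + ((1 + 36 * S.M) * (64 / (S.Θ - 1)) + 6) + 1 +
    ((2 + 72 * S.M) * S.visitRate + 6) + S.σ * (S.K ^ (1 / S.σ) * 64), fun ω hω m x => ?_⟩
  have hk : (1 : ℝ) ≤ S.sc.k m := by exact_mod_cast S.sc.k_pos m
  have hΘk : S.Θ ^ S.J m ≤ 64 * S.sc.k m := S.sc.theta_le m
  rcases le_or_gt (nd x) ((1 / 2) ^ S.sc.d m) with hx | hx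
  · have h1 := (S.jet_corr_aux hω m hx).upgrade hσ (by positivity) one_pos
    rw [S.add_eq] at h1
    refine h1.mono_const zero_le_one ?_
    set k : ℝ := (S.sc.k m : ℝ)
    set e1 := (1 + 36 * S.M) * (S.Θ ^ S.J m / (S.Θ - 1)) + 6 with he1
    set e2 := (2 + 72 * S.M) * (S.visitRate * k) + 6 with he2
    have he10 : 0 ≤ e1 := by
      have : 0 ≤ S.Θ ^ S.J m / (S.Θ - 1) := div_nonneg (by positivity) (by linarith)
      positivity
    have a1 : Real.exp e1 + |(1 : ℝ)| ≤ Real.exp (e1 + 1) := by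
      rw [Real.exp_add e1 1, abs_one]
      have := Real.add_one_le_exp (1 : ℝ)
      have := Real.one_le_exp he10
      nlinarith
    have a2 : 288 * S.M ≤ Real.exp (288 * S.M) := by linarith [Real.add_one_le_exp (288 * S.M)]
    have a3 := S.scale_rpow_le (S.J m)
    calc _ = (288 * S.M) * (Real.exp e1 + |(1 : ℝ)|) * Real.exp e2 *
          Real.exp (S.σ * (2 ^ S.J m * S.K / 1) ^ (1 / S.σ)) := by ring
      _ ≤ Real.exp (288 * S.M) * Real.exp (e1 + 1) * Real.exp e2 *
          Real.exp (S.σ * (S.K ^ (1 / S.σ) * S.Θ ^ S.J m)) := by gcongr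
      _ = Real.exp (288 * S.M + (e1 + 1) + e2 + S.σ * (S.K ^ (1 / S.σ) * S.Θ ^ S.J m)) := by
          simp only [Real.exp_add]
      _ ≤ _ := by
        refine Real.exp_le_exp.2 ?_
        have b1 : S.Θ ^ S.J m / (S.Θ - 1) ≤ 64 / (S.Θ - 1) * k := by
          rw [div_mul_eq_mul_div]; gcongr
        have b2 : S.σ * (S.K ^ (1 / S.σ) * S.Θ ^ S.J m) ≤ S.σ * (S.K ^ (1 / S.σ) * 64) * k := by
          have := mul_le_mul_of_nonneg_left hΘk (by positivity : 0 ≤ S.σ * S.K ^ (1 / S.σ))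
          linarith
        have b3 := mul_le_mul_of_nonneg_left b1 (by positivity : 0 ≤ 1 + 36 * S.M)
        have b4 : 288 * S.M ≤ 288 * S.M * k := le_mul_of_one_le_right (by positivity) hk
        rw [he1, he2]
        nlinarith
  · have h0 : Jet s 1 0 (fun _ : ℝ => (0 : ℝ)) x := by
      intro n; rw [iteratedDeriv_const]; simp
    refine (h0.congr ?_).mono_const zero_le_one (Real.exp_pos _).le
    filter_upwards [(continuous_nd.tendsto x).eventually (lt_mem_nhds hx)] with y hy
    exact (S.corr_eq_zero ω hy.le).symm

end Setup

theorem Jet.norm_iteratedFDeriv_le {s M : ℝ} {f : ℝ → ℝ} {x : ℝ} (h : Jet s 1 M f x) (n : ℕ) :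
    ‖iteratedFDeriv ℝ n f x‖ ≤ M * ((n.factorial : ℝ) ^ s / (1 + (n : ℝ) ^ 2)) := by
  rw [norm_iteratedFDeriv_eq_norm_iteratedDeriv, Real.norm_eq_abs]
  simpa using h.div_le n

section Series

variable {s : ℝ} {f : ℕ → ℝ → ℝ} {ε : ℕ → ℝ}

theorem smooth_tsum_of_jet (hf : ∀ i, Smooth (f i)) (hε : Summable ε)
    (h : ∀ i x, Jet s 1 (ε i) (f i) x) : Smooth fun x => ∑' i, f i x :=
  contDiff_tsum (v := fun n i => ε i * ((n.factorial : ℝ) ^ s / (1 + (n : ℝ) ^ 2))) hf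
    (fun _ _ => hε.mul_right _) (fun n i x _ => (h i x).norm_iteratedFDeriv_le n)

theorem jet_tsum (hf : ∀ i, Smooth (f i)) (hε : Summable ε)
    (h : ∀ i x, Jet s 1 (ε i) (f i) x) (x : ℝ) : Jet s 1 (∑' i, ε i) (fun x => ∑' i, f i x) x := by
  intro n
  have e := iteratedFDeriv_tsum (𝕜 := ℝ) (N := (⊤ : ℕ∞))
    (v := fun n i => ε i * ((n.factorial : ℝ) ^ s / (1 + (n : ℝ) ^ 2))) (f := f)
    hf (fun _ _ => hε.mul_right _) (fun n i x _ => (h i x).norm_iteratedFDeriv_le n)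
    (k := n) (by exact_mod_cast le_top)
  have h1 : |iteratedDeriv n (fun x => ∑' i, f i x) x| ≤
      (∑' i, ε i) * ((n.factorial : ℝ) ^ s / (1 + (n : ℝ) ^ 2)) := by
    rw [← Real.norm_eq_abs, ← norm_iteratedFDeriv_eq_norm_iteratedDeriv, e, ← tsum_mul_right]
    exact tsum_of_norm_bounded (hε.mul_right _).hasSum fun i => (h i x).norm_iteratedFDeriv_le n
  calc _ ≤ (1 + (n : ℝ) ^ 2) * ((∑' i, ε i) * ((n.factorial : ℝ) ^ s / (1 + (n : ℝ) ^ 2))) := by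
        gcongr
    _ = _ := by field_simp; ring

theorem summable_of_jet (hε : Summable ε) (h : ∀ i x, Jet s 1 (ε i) (f i) x) (x : ℝ) :
    Summable fun i => f i x := by
  refine Summable.of_norm_bounded hε fun i => ?_
  simpa using h i x 0

end Series

/-- Convergence in the Gevrey class with unit radius. -/
structure GConv (s : ℝ) (f : ℕ → ℝ → ℝ) (g : ℝ → ℝ) : Prop where
  smooth_limit : Smooth g
  smooth : ∀ n, Smooth (f n)
  jet_limit : ∃ M, ∀ x, Jet s 1 M g x
  jet_sub : ∃ δ : ℕ → ℝ, Tendsto δ atTop (nhds 0) ∧ ∀ n x, Jet s 1 (δ n) (fun y => f n y - g y) x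

theorem gconv_sum {s : ℝ} {f : ℕ → ℝ → ℝ} {ε : ℕ → ℝ} (hf : ∀ i, Smooth (f i)) (hε : Summable ε)
    (h : ∀ i x, Jet s 1 (ε i) (f i) x) :
    GConv s (fun n x => ∑ i ∈ Finset.range n, f i x) (fun x => ∑' i, f i x) := by
  refine ⟨smooth_tsum_of_jet hf hε h, fun n => ContDiff.sum fun i _ => hf i,
    ⟨_, jet_tsum hf hε h⟩, fun n => ∑' i, ε (i + n), tendsto_sum_nat_add ε, fun n x => ?_⟩
  have h1 := (jet_tsum (fun i => hf (i + n)) ((summable_nat_add_iff n).2 hε)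
    (fun i => h (i + n)) x).const_mul (-1)
  rw [abs_neg, abs_one, one_mul] at h1
  have e : (fun y => ∑ i ∈ Finset.range n, f i y - ∑' i, f i y) =
      fun y => -1 * ∑' i, f (i + n) y := by
    funext y
    rw [← (summable_of_jet hε h y).sum_add_tsum_nat_add n]; ring
  rw [e]; exact h1

theorem GConv.comp {s : ℝ} {f : ℕ → ℝ → ℝ} {g : ℝ → ℝ} (h : GConv s f g) {φ : ℕ → ℕ}
    (hφ : Tendsto φ atTop atTop) : GConv s (fun n => f (φ n)) g := by
  obtain ⟨δ, hδ, hj⟩ := h.jet_sub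
  exact ⟨h.smooth_limit, fun n => h.smooth _, h.jet_limit, δ ∘ φ, hδ.comp hφ, fun n => hj _⟩

theorem GConv.const_add {s : ℝ} {f : ℕ → ℝ → ℝ} {g : ℝ → ℝ} (h : GConv s f g) {φ : ℝ → ℝ}
    (hφ : Smooth φ) (hj : ∃ M, ∀ x, Jet s 1 M φ x) :
    GConv s (fun n y => φ y + f n y) (fun y => φ y + g y) := by
  obtain ⟨M, hM⟩ := hj
  obtain ⟨N, hN⟩ := h.jet_limit
  obtain ⟨δ, hδ, hjs⟩ := h.jet_sub
  refine ⟨hφ.add h.smooth_limit, fun n => hφ.add (h.smooth n),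
    ⟨M + N, fun x => (hM x).add hφ h.smooth_limit (hN x)⟩, δ, hδ, fun n x => ?_⟩
  simpa only [add_sub_add_left_eq_sub] using hjs n x

theorem GConv.tendsto {s : ℝ} {f : ℕ → ℝ → ℝ} {g : ℝ → ℝ} (h : GConv s f g) (x : ℝ) :
    Tendsto (fun n => f n x) atTop (nhds (g x)) := by
  obtain ⟨δ, hδ, hj⟩ := h.jet_sub
  rw [tendsto_iff_norm_sub_tendsto_zero]
  refine squeeze_zero (fun _ => norm_nonneg _) (fun n => ?_) hδ
  simpa using hj n x 0

namespace Setup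

variable {α s : ℝ} (S : Setup α s)

/-- The regularised profile `exp (- ψ)`, vanishing near the integers. -/
def prof (J : ℕ) (x : ℝ) : ℝ := Real.exp (-S.psi J x) * (1 - pbump S.χ J x)

theorem smooth_one_sub_pb {J : ℕ} (hJ : S.j₀ ≤ J) : Smooth fun y => 1 - pbump S.χ J y :=
  contDiff_const.sub (S.smooth_pb hJ)

theorem smooth_prof {J : ℕ} (hJ : S.j₀ ≤ J) : Smooth (S.prof J) :=
  (S.smooth_psi J).neg.exp.mul (S.smooth_one_sub_pb hJ)

theorem prof_succ_sub (J : ℕ) (hJ : S.j₀ ≤ J) (y : ℝ) : S.prof (J + 1) y - S.prof J y =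
    Real.exp (-∑ j ∈ Finset.Ico S.j₀ J, S.Θ ^ j) *
      (Real.exp (-S.Θ ^ J * pbump S.χ J y) * (1 - pbump S.χ (J + 1) y) - (1 - pbump S.χ J y)) := by
  have e : S.psi (J + 1) y = S.psi J y + S.Θ ^ J * pbump S.χ J y := by
    rw [psi, Finset.sum_Ico_succ_top hJ, psi]
  rw [prof, prof, e, neg_add, Real.exp_add, neg_mul]
  rcases le_or_gt (nd y) ((1 / 2) ^ J) with h | h
  · rw [S.psi_eq_sum J h]; ring
  · rw [S.bump.pbump_eq_zero h.le, S.bump.pbump_eq_zero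
      ((pow_le_pow_of_le_one (by norm_num) (by norm_num) (Nat.le_succ J)).trans h.le)]
    simp

theorem jet_one_sub_pb {J J' : ℕ} (hJ : S.j₀ ≤ J) (hJ' : J ≤ J') {A : ℝ} (hA : 1 ≤ A) (x : ℝ) :
    Jet S.s₁ (2 ^ J' * (A * S.K)) (1 + S.M) (fun y => 1 - pbump S.χ J y) x := by
  have hK := S.K_pos
  have h1 := (S.bump.jet_pbump (S.two_le_j₀.trans hJ) x).mono (K' := 2 ^ J' * (A * S.K))
    (by positivity) (mul_le_mul (pow_le_pow_right₀ (by norm_num) hJ')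
      (le_mul_of_one_le_left hK.le hA) hK.le (by positivity)) le_rfl
  have := (jet_const (s := S.s₁) (by positivity : 0 ≤ 2 ^ J' * (A * S.K)) 1 x).sub contDiff_const
    (S.smooth_pb hJ) h1
  rwa [abs_one] at this

theorem exists_jet_prof (J : ℕ) (hJ : S.j₀ ≤ J) : ∃ M, ∀ x, Jet s 1 M (S.prof J) x := by
  have hK := S.K_pos
  have hM := S.bump.M_nonneg
  have hΘ := S.one_lt_Θ
  have hKJ : 0 ≤ 2 ^ J * S.K := by positivity
  refine ⟨12 * Real.exp (36 * (S.M * (S.Θ ^ J / (S.Θ - 1))) + 6) * (1 + S.M) *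
    Real.exp (S.σ * (2 ^ J * S.K / 1) ^ (1 / S.σ)), fun x => ?_⟩
  have h1 : Jet S.s₁ (2 ^ J * S.K) (S.M * (S.Θ ^ J / (S.Θ - 1))) (fun y => -S.psi J y) x := by
    have := ((S.jet_psi J x).const_mul (-1)).mono_const hKJ (M' := S.M * (S.Θ ^ J / (S.Θ - 1))) (by
      rw [abs_neg, abs_one, one_mul]; exact mul_le_mul_of_nonneg_left (S.maj_le J x) hM)
    simpa using this
  have h2 := (jet_exp S.one_le_s₁ hKJ h1.nonneg (S.smooth_psi J).neg fun n _ => h1 n).mono_const hKJ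
    (M' := Real.exp (36 * (S.M * (S.Θ ^ J / (S.Θ - 1))) + 6))
    (Real.exp_le_exp.2 (by linarith [S.psi_nonneg J x]))
  have h3 := S.jet_one_sub_pb hJ le_rfl le_rfl x
  rw [one_mul] at h3
  have h4 := (h2.mul S.one_le_s₁ hKJ (S.smooth_psi J).neg.exp (S.smooth_one_sub_pb hJ) h3).upgrade
    S.σ_pos hKJ one_pos
  rw [S.add_eq] at h4
  exact h4

theorem jet_prof_succ_sub {J : ℕ} (hJ : S.j₀ < J) (x : ℝ) :
    Jet s 1 (13 * (1 + S.M) * Real.exp 6 * Real.exp (-(S.Θ ^ J / 4) +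
      S.σ * (2 * ((144 * S.M + 1) * S.K)) ^ (1 / S.σ) * ((2 : ℝ) ^ (1 / S.σ)) ^ J))
      (fun y => S.prof (J + 1) y - S.prof J y) x := by
  have hK := S.K_pos
  have hM := S.bump.M_nonneg
  have hΘ := S.one_lt_Θ
  have hΘ2 := S.Θ_lt_two
  have hΘJ := pow_pos S.Θ_pos J
  obtain ⟨A, hA⟩ : ∃ A, A = 144 * S.M + 1 := ⟨_, rfl⟩
  have hA1 : 1 ≤ A := by linarith
  have hA0 : 0 < A := by linarith
  rw [← hA]
  have hr : 0 ≤ 2 ^ (J + 1) * (A * S.K) := by positivity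
  -- the exponential factor
  have h1 : ∀ n : ℕ, 1 ≤ n → (1 + (n : ℝ) ^ 2) *
      |iteratedDeriv n (fun y => -S.Θ ^ J * pbump S.χ J y) x| ≤
        S.Θ ^ J * S.M / A * (2 ^ (J + 1) * (A * S.K)) ^ n * (n.factorial : ℝ) ^ S.s₁ := by
    intro n hn
    have h := ((S.bump.jet_pbump (S.two_le_j₀.trans hJ.le) x).const_mul (-S.Θ ^ J)) n
    rw [abs_neg, abs_of_pos hΘJ] at h
    refine h.trans ?_
    gcongr ?_ * _
    have hAn : A ≤ A ^ n := le_self_pow₀ hA1 (by omega)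
    have e : (2 ^ (J + 1) * (A * S.K)) ^ n = A ^ n * (2 ^ (J + 1) * S.K) ^ n := by
      rw [← mul_pow]; congr 1; ring
    rw [e]
    calc S.Θ ^ J * S.M * (2 ^ J * S.K) ^ n = S.Θ ^ J * S.M / A * (A * (2 ^ J * S.K) ^ n) := by
          field_simp
      _ ≤ _ := by
        gcongr
        · norm_num
        · omega
  have hsm1 : Smooth fun y => -S.Θ ^ J * pbump S.χ J y := contDiff_const.mul (S.smooth_pb hJ.le)
  have h2 := jet_exp S.one_le_s₁ hr (by positivity) hsm1 h1
  have h2' : Jet S.s₁ (2 ^ (J + 1) * (A * S.K)) (Real.exp (S.Θ ^ J / 4 + 6))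
      (fun y => Real.exp (-S.Θ ^ J * pbump S.χ J y)) x := by
    refine h2.mono_const hr (Real.exp_le_exp.2 ?_)
    have e1 : 0 ≤ S.Θ ^ J * pbump S.χ J x := mul_nonneg hΘJ.le (S.bump.pbump_nonneg _ _)
    have e2 : 36 * (S.Θ ^ J * S.M / A) ≤ S.Θ ^ J / 4 := by
      rw [mul_div_assoc', div_le_div_iff₀ hA0 (by norm_num)]
      nlinarith
    linarith
  have h3 := h2'.mul S.one_le_s₁ hr hsm1.exp (S.smooth_one_sub_pb (J := J + 1) (by omega))
    (S.jet_one_sub_pb (by omega) le_rfl hA1 x)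
  have h4 := h3.sub (hsm1.exp.mul (S.smooth_one_sub_pb (J := J + 1) (by omega)))
    (S.smooth_one_sub_pb hJ.le) (S.jet_one_sub_pb hJ.le (Nat.le_succ J) hA1 x)
  have h5 := h4.const_mul (Real.exp (-∑ j ∈ Finset.Ico S.j₀ J, S.Θ ^ j))
  have h6 := h5.upgrade S.σ_pos hr one_pos
  rw [S.add_eq] at h6
  have e : (fun y => S.prof (J + 1) y - S.prof J y) = fun y =>
      Real.exp (-∑ j ∈ Finset.Ico S.j₀ J, S.Θ ^ j) *
      (Real.exp (-S.Θ ^ J * pbump S.χ J y) * (1 - pbump S.χ (J + 1) y) - (1 - pbump S.χ J y)) :=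
    funext (S.prof_succ_sub J hJ.le)
  rw [e]
  refine h6.mono_const zero_le_one ?_
  have hP : S.Θ ^ J / 2 ≤ ∑ j ∈ Finset.Ico S.j₀ J, S.Θ ^ j := by
    have h7 : S.Θ ^ (J - 1) ≤ ∑ j ∈ Finset.Ico S.j₀ J, S.Θ ^ j :=
      Finset.single_le_sum (f := fun j => S.Θ ^ j) (fun j _ => pow_nonneg S.Θ_pos.le j)
        (Finset.mem_Ico.2 ⟨by omega, by omega⟩)
    have h8 : S.Θ ^ J = S.Θ ^ (J - 1) * S.Θ := by
      rw [← pow_succ]; congr 1; omega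
    have h9 : 0 < S.Θ ^ (J - 1) := pow_pos S.Θ_pos _
    nlinarith
  have hrad : (2 ^ (J + 1) * (A * S.K) / 1) ^ (1 / S.σ) =
      (2 * (A * S.K)) ^ (1 / S.σ) * ((2 : ℝ) ^ (1 / S.σ)) ^ J := by
    have h7 : ((2 : ℝ) ^ (1 / S.σ)) ^ J = ((2 : ℝ) ^ J) ^ (1 / S.σ) := by
      rw [← Real.rpow_natCast (2 ^ (1 / S.σ)) J, ← Real.rpow_mul (by norm_num),
        mul_comm (1 / S.σ) (J : ℝ), Real.rpow_mul (by norm_num), Real.rpow_natCast]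
    rw [h7, ← Real.mul_rpow (by positivity) (by positivity)]
    congr 1; ring
  rw [hrad, abs_of_pos (Real.exp_pos _)]
  have hE1 : 1 + S.M ≤ (1 + S.M) * Real.exp (S.Θ ^ J / 4 + 6) :=
    le_mul_of_one_le_right (by positivity) (Real.one_le_exp (by positivity))
  calc _ ≤ Real.exp (-(S.Θ ^ J / 2)) * (13 * ((1 + S.M) * Real.exp (S.Θ ^ J / 4 + 6))) *
        Real.exp (S.σ * ((2 * (A * S.K)) ^ (1 / S.σ) * ((2 : ℝ) ^ (1 / S.σ)) ^ J)) := by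
        gcongr
        linarith
    _ = 13 * (1 + S.M) * Real.exp 6 * (Real.exp (-(S.Θ ^ J / 2)) * Real.exp (S.Θ ^ J / 4) *
        Real.exp (S.σ * ((2 * (A * S.K)) ^ (1 / S.σ) * ((2 : ℝ) ^ (1 / S.σ)) ^ J))) := by
        rw [Real.exp_add]; ring
    _ = _ := by
        rw [← Real.exp_add, ← Real.exp_add]; congr 2; ring

end Setup

theorem summable_exp_sub_pow {Θ θ c : ℝ} (hΘ : 1 < Θ) (hθ0 : 0 ≤ θ) (hθ : θ < Θ) :
    Summable fun J : ℕ => Real.exp (-(Θ ^ J / 4) + c * θ ^ J) := by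
  have hlim : Tendsto (fun J : ℕ => c * (θ / Θ) ^ J) atTop (nhds 0) := by
    have := (tendsto_pow_atTop_nhds_zero_of_lt_one (r := θ / Θ) (by positivity)
      ((div_lt_one (by linarith)).2 hθ)).const_mul c
    simpa using this
  have hlin : Tendsto (fun J : ℕ => (J : ℝ) ^ 1 / Θ ^ J) atTop (nhds 0) :=
    tendsto_pow_const_div_const_pow_of_one_lt 1 hΘ
  refine Summable.of_norm_bounded_eventually_nat
    (Real.summable_exp_neg_nat) ?_
  filter_upwards [hlim.eventually (gt_mem_nhds (by norm_num : (0 : ℝ) < 1 / 8)),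
    hlin.eventually (gt_mem_nhds (by norm_num : (0 : ℝ) < 1 / 8))] with J h1 h2
  have hp : 0 < Θ ^ J := by positivity
  rw [Real.norm_eq_abs, abs_of_pos (Real.exp_pos _), Real.exp_le_exp]
  rw [pow_one, div_lt_iff₀ hp] at h2
  rw [div_pow, mul_div_assoc', div_lt_iff₀ hp] at h1
  linarith

namespace Setup

variable {α s : ℝ} (S : Setup α s)

theorem exists_gconv_prof : ∃ g, GConv s (fun N => S.prof (S.J N)) g := by
  have hθ : (2 : ℝ) ^ (1 / S.σ) < S.Θ :=
    Real.rpow_lt_rpow_of_exponent_lt (by norm_num) S.inv_lt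
  have hsum := (summable_exp_sub_pow (c := S.σ * (2 * ((144 * S.M + 1) * S.K)) ^ (1 / S.σ))
    S.one_lt_Θ (by positivity) hθ).mul_left (13 * (1 + S.M) * Real.exp 6)
  have h1 := gconv_sum (fun i => (S.smooth_prof (J := S.j₀ + 1 + i + 1) (by omega)).sub
    (S.smooth_prof (J := S.j₀ + 1 + i) (by omega)))
    (hsum.comp_injective (i := fun i => S.j₀ + 1 + i) (fun a b h => by simp only at h; omega))
    (fun i x => S.jet_prof_succ_sub (J := S.j₀ + 1 + i) (by omega) x)
  have h2 := (h1.comp (φ := fun N => S.J N - (S.j₀ + 1)) ?_).const_add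
    (S.smooth_prof (Nat.le_succ S.j₀)) (S.exists_jet_prof _ (Nat.le_succ _))
  · suffices e : (fun N => S.prof (S.J N)) = fun n y => S.prof S.j₀.succ y +
        ∑ i ∈ Finset.range (S.J n - (S.j₀ + 1)),
          (S.prof (S.j₀ + 1 + i + 1) y - S.prof (S.j₀ + 1 + i) y) from ⟨_, e ▸ h2⟩
    funext N y
    have hsub := Finset.sum_range_sub (fun i => S.prof (S.j₀ + 1 + i) y) (S.J N - (S.j₀ + 1))
    have e : S.j₀ + 1 + (S.J N - (S.j₀ + 1)) = S.J N := by have := S.j₀_lt_J N; omega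
    simp only [e, add_zero] at hsub
    have h3 : ∀ i, S.j₀ + 1 + (i + 1) = S.j₀ + 1 + i + 1 := fun i => by omega
    simp only [h3] at hsub
    simp only [Nat.succ_eq_add_one]
    linarith
  · exact (tendsto_sub_atTop_nat _).comp S.J_mono.tendsto_atTop

end Setup

/-- Lower unipotent matrices. -/
def low (a : ℝ) : Matrix (Fin 2) (Fin 2) ℝ := !![1, 0; a, 1]

/-- Upper unipotent matrices. -/
def upp (a : ℝ) : Matrix (Fin 2) (Fin 2) ℝ := !![1, a; 0, 1]

/-- The hyperbolic matrix with eigenvalues `c` and `c⁻¹`. -/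
def hyp (c : ℝ) : Matrix (Fin 2) (Fin 2) ℝ := !![c, 0; 0, c⁻¹]

/-- The core factor, interpolating between the identity (`c = 1`) and an involution-like
matrix exchanging the axes (`c = 0`). -/
def core (c : ℝ) : Matrix (Fin 2) (Fin 2) ℝ := !![c, c - 1; 1 - c, 2 - c]

/-- The explicit form of the perturbed cocycle. -/
def cocMat (l c P Q : ℝ) : Matrix (Fin 2) (Fin 2) ℝ :=
  !![l * c, l * (c - 1 + Q); (1 - c - P) / l, (2 - c) / l]

theorem low_mul_low (a b : ℝ) : low a * low b = low (a + b) := by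
  simp [low]

theorem upp_mul_upp (a b : ℝ) : upp a * upp b = upp (a + b) := by
  simp [upp, add_comm]

theorem low_zero : low 0 = 1 := by simp [low, Matrix.one_fin_two]

theorem upp_zero : upp 0 = 1 := by simp [upp, Matrix.one_fin_two]

theorem hyp_one : hyp 1 = 1 := by simp [hyp, Matrix.one_fin_two]

theorem low_mul_hyp {c : ℝ} (hc : c ≠ 0) (a : ℝ) : low a * hyp c = hyp c * low (c ^ 2 * a) := by
  simp [low, hyp]; field_simp

theorem upp_mul_hyp {c : ℝ} (hc : c ≠ 0) (a : ℝ) : upp a * hyp c = hyp c * upp (c⁻¹ ^ 2 * a) := by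
  simp [upp, hyp]; field_simp

theorem hyp_mul_hyp (a b : ℝ) : hyp a * hyp b = hyp (a * b) := by
  simp [hyp, mul_comm]

theorem low_core_upp {c t : ℝ} (hc : c ≠ 0) (ht : t = c⁻¹ - 1) :
    low (-t) * core c * upp t = hyp c := by
  subst ht
  ext i j
  fin_cases i <;> fin_cases j <;> simp [low, core, upp, hyp] <;> field_simp <;>
    ring

theorem cocMat_eq {l c P Q : ℝ} (hP : (1 - c) * P = 0) (hQ : (1 - c) * Q = 0)
    (hPQ : P * Q = 0) : cocMat l c P Q = hyp l * (low (-P) * core c * upp Q) := by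
  ext i j
  fin_cases i <;> fin_cases j <;>
    simp [low, core, upp, hyp, cocMat] <;> grind

theorem det_cocMat {l c P Q : ℝ} (hl : l ≠ 0) (hP : (1 - c) * P = 0) (hQ : (1 - c) * Q = 0)
    (hPQ : P * Q = 0) : (cocMat l c P Q).det = 1 := by
  rw [cocMat, Matrix.det_fin_two_of]
  field_simp
  linear_combination -hQ - hP + hPQ

namespace Setup

variable {α s : ℝ} (S : Setup α s)

theorem rho_le {m m' : ℕ} (h : m' ≤ m) : (1 / 2 : ℝ) ^ S.sc.d m ≤ (1 / 2) ^ S.sc.d m' :=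
  pow_le_pow_of_le_one (by norm_num) (by norm_num) (S.sc.d_mono.monotone h)

theorem two_rho_le {m m' : ℕ} (hm : m' ≤ m) {i : ℤ} (hi : m' < m ∨ i ≠ 0)
    (h : |i - S.sc.k m| ≤ S.sc.k m') : 2 * (1 / 2 : ℝ) ^ S.sc.d m' ≤ nd (i * α) := by
  rcases hm.lt_or_eq with hlt | rfl
  · exact S.sc.free m m' hlt i h
  · have h1 := S.four_k_le m'
    have h2 := S.sc.k_pos m'
    rw [abs_le] at h
    have h3 := S.sc.good m' i (by omega) (by rw [abs_lt]; omega)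
    have : (0 : ℝ) < (1 / 2) ^ S.sc.d m' := by positivity
    linarith

/-- A point of the `m`-th interval does not return to the `m'`-th interval near time `k m`. -/
theorem rho_le_nd_add {ω : ℝ} (hω : ω = α ∨ ω = -α) {m m' : ℕ} (hm : m' ≤ m) {i : ℤ}
    (hi : m' < m ∨ i ≠ 0) (h : |i - S.sc.k m| ≤ S.sc.k m') {y : ℝ}
    (hy : nd y < (1 / 2) ^ S.sc.d m) : (1 / 2 : ℝ) ^ S.sc.d m' ≤ nd (y + i * ω) := by
  have h1 := S.two_rho_le hm hi h
  rw [← nd_mul_eq hω] at h1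
  have h2 := nd_sub_le (y + i * ω) y
  rw [add_sub_cancel_left] at h2
  linarith [S.rho_le hm]

/-- First return times to the `m`-th interval exceed `2 k m`. -/
theorem rho_le_nd_add_self {ω : ℝ} (hω : ω = α ∨ ω = -α) {m : ℕ} {i : ℤ}
    (hi : i ≠ 0) (h : |i| ≤ 2 * S.sc.k m) {y : ℝ}
    (hy : nd y < (1 / 2) ^ S.sc.d m) : (1 / 2 : ℝ) ^ S.sc.d m ≤ nd (y + i * ω) := by
  have h0 := S.four_k_le m
  have h5 := S.sc.k_pos m
  have h1 := S.sc.good m i hi (by omega)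
  rw [← nd_mul_eq hω] at h1
  have h2 := nd_sub_le (y + i * ω) y
  rw [add_sub_cancel_left] at h2
  have : (0 : ℝ) < (1 / 2) ^ S.sc.d m := by positivity
  linarith

/-- The correction at the `m`-th resonance, transported to time `k m`. -/
def pterm (l ω : ℝ) (m : ℕ) (x : ℝ) : ℝ :=
  l⁻¹ ^ (2 * S.sc.k m) * S.corr ω m (x - S.sc.k m * ω)

theorem nd_lt_of_pterm_ne {l ω : ℝ} {m : ℕ} {x : ℝ} (h : S.pterm l ω m x ≠ 0) :
    nd (x - S.sc.k m * ω) < (1 / 2) ^ S.sc.d m := by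
  by_contra! h1
  exact h (by rw [pterm, S.corr_eq_zero ω h1, mul_zero])

theorem pterm_eq_zero_of_near {l ω : ℝ} (hω : ω = α ∨ ω = -α) {m m' : ℕ} (hm : m' < m) {i : ℤ}
    (hi : |i| ≤ S.sc.k m') {x : ℝ} (hx : nd (x + i * ω) < (1 / 2) ^ S.sc.d m') :
    S.pterm l ω m x = 0 := by
  by_contra h
  have h1 := S.rho_le_nd_add hω hm.le (i := S.sc.k m + i) (Or.inl hm)
    (by rwa [add_sub_cancel_left]) (S.nd_lt_of_pterm_ne h)
  have e : x - S.sc.k m * ω + ((S.sc.k m + i : ℤ) : ℝ) * ω = x + i * ω := by push_cast; ring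
  rw [e] at h1
  exact absurd h1 (not_le.2 hx)

theorem rho_zero_le_nd {l ω : ℝ} (hω : ω = α ∨ ω = -α) {m : ℕ} {x : ℝ}
    (h : S.pterm l ω m x ≠ 0) : (1 / 2 : ℝ) ^ S.sc.d 0 ≤ nd x := by
  have h2 := S.sc.k_pos m
  have h1 := S.rho_le_nd_add hω (Nat.zero_le m) (i := S.sc.k m) (Or.inr (by omega))
    (by simp) (S.nd_lt_of_pterm_ne h)
  simpa using h1

theorem prof_eq_one {J : ℕ} (hJ : S.j₀ ≤ J) {x : ℝ} (hx : (1 / 2 : ℝ) ^ S.sc.d 0 ≤ nd x) :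
    S.prof J x = 1 := by
  have h0 : (1 / 2 : ℝ) ^ S.j₀ ≤ nd x :=
    (pow_le_pow_of_le_one (by norm_num) (by norm_num) (Nat.le_succ _)).trans hx
  rw [prof, S.psi_eq_zero J h0, S.bump.pbump_eq_zero
    ((pow_le_pow_of_le_one (by norm_num) (by norm_num) hJ).trans h0)]
  simp

theorem one_sub_prof_mul_pterm {l ω : ℝ} (hω : ω = α ∨ ω = -α) {J : ℕ} (hJ : S.j₀ ≤ J) (m : ℕ)
    (x : ℝ) : (1 - S.prof J x) * S.pterm l ω m x = 0 := by
  by_cases h : S.pterm l ω m x = 0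
  · rw [h, mul_zero]
  · rw [S.prof_eq_one hJ (S.rho_zero_le_nd hω h), sub_self, zero_mul]

theorem pterm_mul_pterm_neg (l : ℝ) (m m' : ℕ) (x : ℝ) :
    S.pterm l α m x * S.pterm l (-α) m' x = 0 := by
  have key : ∀ ω, (ω = α ∨ ω = -α) → ∀ m m', m' ≤ m → S.pterm l ω m x ≠ 0 →
      S.pterm l (-ω) m' x ≠ 0 → False := by
    intro ω hω m m' hm h h'
    have h2 := S.sc.k_pos m
    have h1 := S.rho_le_nd_add hω hm (i := S.sc.k m + S.sc.k m') (Or.inr (by omega))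
      (by rw [add_sub_cancel_left]; simp) (S.nd_lt_of_pterm_ne h)
    have h3 := S.nd_lt_of_pterm_ne h'
    have e : x - S.sc.k m * ω + ((S.sc.k m + S.sc.k m' : ℤ) : ℝ) * ω = x - S.sc.k m' * -ω := by
      push_cast; ring
    rw [e] at h1
    exact absurd h1 (not_le.2 h3)
  by_contra h
  rw [mul_eq_zero, not_or] at h
  rcases le_total m' m with hm | hm
  · exact key α (Or.inl rfl) m m' hm h.1 h.2
  · exact key (-α) (Or.inr rfl) m' m hm h.2 (by rw [neg_neg]; exact h.1)

/-- The truncated sum of all corrections in one direction. -/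
def pert (l ω : ℝ) (N : ℕ) (x : ℝ) : ℝ := ∑ m ∈ Finset.range (N + 1), S.pterm l ω m x

/-- The approximating cocycles. -/
def coc (l : ℝ) (N : ℕ) (x : ℝ) : Matrix (Fin 2) (Fin 2) ℝ :=
  cocMat l (S.prof (S.J N) x) (S.pert l α N x) (S.pert l (-α) N x)

theorem one_sub_prof_mul_pert {l ω : ℝ} (hω : ω = α ∨ ω = -α) (N : ℕ) (x : ℝ) :
    (1 - S.prof (S.J N) x) * S.pert l ω N x = 0 := by
  rw [pert, Finset.mul_sum]
  exact Finset.sum_eq_zero fun m _ => S.one_sub_prof_mul_pterm hω (S.j₀_lt_J N).le m x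

theorem pert_mul_pert_neg (l : ℝ) (N : ℕ) (x : ℝ) : S.pert l α N x * S.pert l (-α) N x = 0 := by
  rw [pert, pert, Finset.sum_mul_sum]
  exact Finset.sum_eq_zero fun m _ => Finset.sum_eq_zero fun m' _ => S.pterm_mul_pterm_neg l m m' x

theorem det_coc {l : ℝ} (hl : l ≠ 0) (N : ℕ) (x : ℝ) : (S.coc l N x).det = 1 :=
  det_cocMat hl (S.one_sub_prof_mul_pert (Or.inl rfl) N x)
    (S.one_sub_prof_mul_pert (Or.inr rfl) N x) (S.pert_mul_pert_neg l N x)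

theorem coc_eq (l : ℝ) (N : ℕ) (x : ℝ) : S.coc l N x =
    hyp l * (low (-S.pert l α N x) * core (S.prof (S.J N) x) * upp (S.pert l (-α) N x)) :=
  cocMat_eq (S.one_sub_prof_mul_pert (Or.inl rfl) N x)
    (S.one_sub_prof_mul_pert (Or.inr rfl) N x) (S.pert_mul_pert_neg l N x)

theorem corr_add_one (ω : ℝ) (m : ℕ) (y : ℝ) : S.corr ω m (y + 1) = S.corr ω m y := by
  have e : ∀ l : ℕ, S.psi (S.J m) (y + 1 + (l + 1) * ω) = S.psi (S.J m) (y + (l + 1) * ω) :=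
    fun l => by rw [add_right_comm, S.psi_add_one]
  simp only [corr, eta_add_one, psi_add_one, e]

theorem pert_add_one (l ω : ℝ) (N : ℕ) (x : ℝ) : S.pert l ω N (x + 1) = S.pert l ω N x := by
  simp only [pert, pterm]
  refine Finset.sum_congr rfl fun m _ => ?_
  rw [← S.corr_add_one ω m (x - _)]; congr 2; ring

theorem prof_add_one (J : ℕ) (x : ℝ) : S.prof J (x + 1) = S.prof J x := by
  rw [prof, psi_add_one, pbump_add_one, prof]

theorem coc_add_one (l : ℝ) (N : ℕ) (x : ℝ) : S.coc l N (x + 1) = S.coc l N x := by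
  simp only [coc, pert_add_one, prof_add_one]

end Setup

theorem gconv_const {s : ℝ} (a : ℝ) : GConv s (fun _ _ => a) (fun _ => a) :=
  ⟨contDiff_const, fun _ => contDiff_const, ⟨|a|, fun x => jet_const zero_le_one a x⟩,
    fun _ => 0, tendsto_const_nhds, fun _ x => by
      simpa using jet_const (s := s) zero_le_one (0 : ℝ) x⟩

theorem GConv.add {s : ℝ} {f f' : ℕ → ℝ → ℝ} {g g' : ℝ → ℝ} (h : GConv s f g)
    (h' : GConv s f' g') : GConv s (fun n y => f n y + f' n y) (fun y => g y + g' y) := by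
  obtain ⟨M, hM⟩ := h.jet_limit
  obtain ⟨M', hM'⟩ := h'.jet_limit
  obtain ⟨δ, hδ, hj⟩ := h.jet_sub
  obtain ⟨δ', hδ', hj'⟩ := h'.jet_sub
  refine ⟨h.smooth_limit.add h'.smooth_limit, fun n => (h.smooth n).add (h'.smooth n),
    ⟨M + M', fun x => (hM x).add h.smooth_limit h'.smooth_limit (hM' x)⟩, fun n => δ n + δ' n,
    by simpa using hδ.add hδ', fun n x => ?_⟩
  have := (hj n x).add ((h.smooth n).sub h.smooth_limit) ((h'.smooth n).sub h'.smooth_limit)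
    (hj' n x)
  simpa only [add_sub_add_comm] using this

theorem GConv.const_mul {s : ℝ} {f : ℕ → ℝ → ℝ} {g : ℝ → ℝ} (h : GConv s f g) (a : ℝ) :
    GConv s (fun n y => a * f n y) (fun y => a * g y) := by
  obtain ⟨M, hM⟩ := h.jet_limit
  obtain ⟨δ, hδ, hj⟩ := h.jet_sub
  refine ⟨contDiff_const.mul h.smooth_limit, fun n => contDiff_const.mul (h.smooth n),
    ⟨_, fun x => (hM x).const_mul a⟩, fun n => |a| * δ n,
    by simpa using hδ.const_mul |a|, fun n x => ?_⟩
  simpa only [mul_sub] using (hj n x).const_mul a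

theorem GConv.exists_jet {s : ℝ} {f : ℕ → ℝ → ℝ} {g : ℝ → ℝ} (h : GConv s f g) (n : ℕ) :
    ∃ M, ∀ x, Jet s 1 M (f n) x := by
  obtain ⟨M, hM⟩ := h.jet_limit
  obtain ⟨δ, -, hj⟩ := h.jet_sub
  refine ⟨M + δ n, fun x => ?_⟩
  have := (hM x).add h.smooth_limit ((h.smooth n).sub h.smooth_limit) (hj n x)
  simpa only [add_sub_cancel] using this

section MatrixValued

variable {A : ℝ → Matrix (Fin 2) (Fin 2) ℝ} {s M : ℝ}

theorem smooth_matrix (hA : ∀ i j, Smooth fun x => A x i j) : ContDiff ℝ (⊤ : ℕ∞) A :=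
  contDiff_pi.2 fun i => contDiff_pi.2 fun j => hA i j

theorem iteratedDeriv_apply (hA : ∀ i j, Smooth fun x => A x i j) (n : ℕ) (x : ℝ) (i j : Fin 2) :
    iteratedDeriv n A x i j = iteratedDeriv n (fun y => A y i j) x := by
  induction n generalizing x with
  | zero => simp
  | succ n ih =>
    have h1 : DifferentiableAt ℝ (iteratedDeriv n A) x :=
      ((smooth_matrix hA).differentiable_iteratedDeriv n (by exact_mod_cast WithTop.coe_lt_top _)) x
    rw [iteratedDeriv_succ, iteratedDeriv_succ]
    have h2 := hasDerivAt_pi.1 (hasDerivAt_pi.1 h1.hasDerivAt i) j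
    rw [← h2.deriv]
    congr 1
    funext y
    exact ih y

theorem norm_iteratedDeriv_le (hA : ∀ i j, Smooth fun x => A x i j)
    (h : ∀ i j x, Jet s 1 M (fun y => A y i j) x) (n : ℕ) (x : ℝ) :
    ‖iteratedDeriv n A x‖ ≤ M * ((n.factorial : ℝ) ^ s / (1 + (n : ℝ) ^ 2)) := by
  have hM := (h 0 0 0).nonneg
  rw [Matrix.norm_le_iff (by positivity)]
  intro i j
  rw [iteratedDeriv_apply hA, Real.norm_eq_abs]
  simpa using (h i j x).div_le n

theorem gevreySeq_le (hA : ∀ i j, Smooth fun x => A x i j)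
    (h : ∀ i j x, Jet s 1 M (fun y => A y i j) x) (n : ℕ) : gevreySeq s 1 A n ≤ M := by
  have hf : (0 : ℝ) < (n.factorial : ℝ) ^ s := Real.rpow_pos_of_pos (by positivity) _
  have h1 : supDeriv n A ≤ M * ((n.factorial : ℝ) ^ s / (1 + (n : ℝ) ^ 2)) :=
    ciSup_le (norm_iteratedDeriv_le hA h n)
  rw [gevreySeq, one_pow, one_mul, div_le_iff₀ hf]
  calc _ ≤ (1 + (n : ℝ) ^ 2) * (M * ((n.factorial : ℝ) ^ s / (1 + (n : ℝ) ^ 2))) := by gcongr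
    _ = _ := by field_simp

theorem memGevrey_of_jet (hA : ∀ i j, Smooth fun x => A x i j)
    (h : ∀ i j x, Jet s 1 M (fun y => A y i j) x) : MemGevrey s 1 A := by
  refine ⟨smooth_matrix hA, fun k => ⟨M * ((k.factorial : ℝ) ^ s / (1 + (k : ℝ) ^ 2)), ?_⟩, ⟨M, ?_⟩⟩
  · rintro _ ⟨x, rfl⟩
    exact norm_iteratedDeriv_le hA h k x
  · rintro _ ⟨n, rfl⟩
    exact gevreySeq_le hA h n

theorem gevreyNorm_nonneg (s : ℝ) (A : ℝ → Matrix (Fin 2) (Fin 2) ℝ) : 0 ≤ gevreyNorm s 1 A := by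
  refine mul_nonneg (by positivity) (Real.iSup_nonneg fun k => ?_)
  have : 0 ≤ supDeriv k A := Real.iSup_nonneg fun x => norm_nonneg _
  rw [gevreySeq]; positivity

theorem gevreyNorm_le (hA : ∀ i j, Smooth fun x => A x i j)
    (h : ∀ i j x, Jet s 1 M (fun y => A y i j) x) :
    gevreyNorm s 1 A ≤ 4 * Real.pi ^ 2 / 3 * M :=
  mul_le_mul_of_nonneg_left (ciSup_le (gevreySeq_le hA h)) (by positivity)

end MatrixValued

/-- Entrywise Gevrey convergence of matrix-valued maps. -/
def MConv (s : ℝ) (A : ℕ → ℝ → Matrix (Fin 2) (Fin 2) ℝ) (D : ℝ → Matrix (Fin 2) (Fin 2) ℝ) : Prop :=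
  ∀ i j, GConv s (fun n x => A n x i j) (fun x => D x i j)

namespace MConv

variable {s : ℝ} {A : ℕ → ℝ → Matrix (Fin 2) (Fin 2) ℝ} {D : ℝ → Matrix (Fin 2) (Fin 2) ℝ}

theorem exists_bound {β : Type*} {p : Fin 2 → Fin 2 → β → ℝ → Prop}
    (hp : ∀ i j b M M', M ≤ M' → p i j b M → p i j b M')
    (h : ∀ i j, ∃ M, ∀ b, p i j b M) : ∃ M, ∀ i j b, p i j b M := by
  choose M hM using h
  exact ⟨∑ i, ∑ j, |M i j|, fun i j b => hp i j b _ _ ((le_abs_self _).trans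
    ((Finset.single_le_sum (f := fun j => |M i j|) (fun j _ => abs_nonneg _) (Finset.mem_univ j)).trans
      (Finset.single_le_sum (f := fun i => ∑ j, |M i j|)
        (fun i _ => Finset.sum_nonneg fun j _ => abs_nonneg _) (Finset.mem_univ i)))) (hM i j b)⟩

theorem memGevrey_limit (h : MConv s A D) : MemGevrey s 1 D := by
  obtain ⟨M, hM⟩ := exists_bound (p := fun i j x M => Jet s 1 M (fun y => D y i j) x)
    (fun _ _ _ _ _ hM hj => hj.mono_const zero_le_one hM) fun i j => (h i j).jet_limit
  exact memGevrey_of_jet (fun i j => (h i j).smooth_limit) hM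

theorem memGevrey (h : MConv s A D) (n : ℕ) : MemGevrey s 1 (A n) := by
  obtain ⟨M, hM⟩ := exists_bound (p := fun i j x M => Jet s 1 M (fun y => A n y i j) x)
    (fun _ _ _ _ _ hM hj => hj.mono_const zero_le_one hM) fun i j => (h i j).exists_jet n
  exact memGevrey_of_jet (fun i j => (h i j).smooth n) hM

theorem tendsto_gevreyNorm (h : MConv s A D) :
    Tendsto (fun n => gevreyNorm s 1 fun x => A n x - D x) atTop (nhds 0) := by
  have hj := fun i j => (h i j).jet_sub
  choose δ hδ hJ using hj
  have hlim : Tendsto (fun n => 4 * Real.pi ^ 2 / 3 * ∑ i, ∑ j, δ i j n) atTop (nhds 0) := by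
    have := (tendsto_finsetSum Finset.univ fun i _ =>
      tendsto_finsetSum Finset.univ fun j _ => hδ i j).const_mul (4 * Real.pi ^ 2 / 3)
    simpa using this
  refine squeeze_zero (fun n => gevreyNorm_nonneg _ _) (fun n => ?_) hlim
  have hpos : ∀ i j, 0 ≤ δ i j n := fun i j => (hJ i j n 0).nonneg
  refine gevreyNorm_le (fun i j => ((h i j).smooth n).sub (h i j).smooth_limit) fun i j x =>
    (hJ i j n x).mono_const zero_le_one ?_
  exact (Finset.single_le_sum (f := fun j => δ i j n) (fun j _ => hpos i j)
    (Finset.mem_univ j)).trans (Finset.single_le_sum (f := fun i => ∑ j, δ i j n)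
        (fun i _ => Finset.sum_nonneg fun j _ => hpos i j) (Finset.mem_univ i))

theorem tendsto (h : MConv s A D) (x : ℝ) : Tendsto (fun n => A n x) atTop (nhds (D x)) :=
  tendsto_pi_nhds.2 fun i => tendsto_pi_nhds.2 fun j => (h i j).tendsto x

theorem continuous (h : MConv s A D) (n : ℕ) : Continuous (A n) :=
  continuous_pi fun i => continuous_pi fun j => ((h i j).smooth n).continuous

theorem continuous_limit (h : MConv s A D) : Continuous D :=
  continuous_pi fun i => continuous_pi fun j => (h i j).smooth_limit.continuous

end MConv

theorem mconv_cocMat {s : ℝ} (l : ℝ) {c P Q : ℕ → ℝ → ℝ} {c' P' Q' : ℝ → ℝ} (hc : GConv s c c')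
    (hP : GConv s P P') (hQ : GConv s Q Q') :
    MConv s (fun n x => cocMat l (c n x) (P n x) (Q n x)) fun x => cocMat l (c' x) (P' x) (Q' x) := by
  have e : ∀ (f g : ℕ → ℝ → ℝ) (f' g' : ℝ → ℝ), GConv s f f' → (∀ n x, g n x = f n x) →
      (∀ x, g' x = f' x) → GConv s g g' := by
    intro f g f' g' h h1 h2
    rwa [show g = f from funext fun n => funext (h1 n), show g' = f' from funext h2]
  intro i j
  fin_cases i <;> fin_cases j
  · exact e _ _ _ _ (hc.const_mul l) (fun n x => by simp [cocMat]) (fun x => by simp [cocMat])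
  · exact e _ _ _ _ ((hc.add ((gconv_const (-1)).add hQ)).const_mul l)
      (fun n x => by simp [cocMat, sub_eq_add_neg, add_assoc])
      (fun x => by simp [cocMat, sub_eq_add_neg, add_assoc])
  · exact e _ _ _ _ (((gconv_const 1).add ((hc.const_mul (-1)).add (hP.const_mul (-1)))).const_mul l⁻¹)
      (fun n x => by simp [cocMat]; ring) (fun x => by simp [cocMat]; ring)
  · exact e _ _ _ _ (((gconv_const 2).add (hc.const_mul (-1))).const_mul l⁻¹)
      (fun n x => by simp [cocMat]; ring) (fun x => by simp [cocMat]; ring)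

namespace Setup

variable {α s : ℝ} (S : Setup α s)

theorem smooth_pterm (l ω : ℝ) (m : ℕ) : Smooth (S.pterm l ω m) :=
  contDiff_const.mul ((S.smooth_corr ω m).comp (contDiff_id.sub contDiff_const))

theorem exists_gconv_pert : ∃ l₀ : ℝ, 1 ≤ l₀ ∧ ∀ l, l₀ ≤ l → ∀ ω, (ω = α ∨ ω = -α) →
    ∃ g, GConv s (fun N => S.pert l ω N) g := by
  obtain ⟨C, hC⟩ := S.exists_jet_corr
  refine ⟨Real.exp (|C| + 1), Real.one_le_exp (by positivity), fun l hl ω hω => ?_⟩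
  have hl0 : 0 < l := (Real.exp_pos _).trans_le hl
  have h1 : ∀ (m : ℕ) x, Jet s 1 (Real.exp (-m)) (S.pterm l ω m) x := by
    intro m x
    have h2 := (Jet.comp_affine (S.smooth_corr ω m) (a := 1) (b := -(S.sc.k m * ω)) (x := x)
      (hC ω hω m _)).const_mul (l⁻¹ ^ (2 * S.sc.k m))
    simp only [one_mul, abs_one, ← sub_eq_add_neg] at h2
    refine Jet.mono_const h2 zero_le_one ?_
    rw [abs_of_nonneg (by positivity)]
    have h3 : l⁻¹ ≤ Real.exp (-(|C| + 1)) := by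
      rw [Real.exp_neg]; exact inv_anti₀ (Real.exp_pos _) hl
    calc l⁻¹ ^ (2 * S.sc.k m) * Real.exp (C * S.sc.k m)
        ≤ Real.exp (-(|C| + 1)) ^ (2 * S.sc.k m) * Real.exp (C * S.sc.k m) := by gcongr
      _ = Real.exp (-(2 * S.sc.k m * (|C| + 1)) + C * S.sc.k m) := by
        rw [← Real.exp_nat_mul, ← Real.exp_add]; congr 1; push_cast; ring
      _ ≤ _ := by
        rw [Real.exp_le_exp]
        have h4 : (m : ℝ) ≤ S.sc.k m := by exact_mod_cast S.sc.le_k m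
        have h5 := mul_le_mul_of_nonneg_right (le_abs_self C) (Nat.cast_nonneg (α := ℝ) (S.sc.k m))
        have h6 := mul_nonneg (abs_nonneg C) (Nat.cast_nonneg (α := ℝ) (S.sc.k m))
        have h7 : (0 : ℝ) ≤ S.sc.k m := Nat.cast_nonneg _
        nlinarith
  exact ⟨_, (gconv_sum (fun m => S.smooth_pterm l ω m) Real.summable_exp_neg_nat h1).comp
    (tendsto_add_atTop_nat 1)⟩

theorem exists_mconv : ∃ l₀ : ℝ, 1 ≤ l₀ ∧ ∀ l, l₀ ≤ l → ∃ D, MConv s (S.coc l) D := by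
  obtain ⟨l₀, h0, h⟩ := S.exists_gconv_pert
  obtain ⟨c, hc⟩ := S.exists_gconv_prof
  refine ⟨l₀, h0, fun l hl => ?_⟩
  obtain ⟨P, hP⟩ := h l hl α (Or.inl rfl)
  obtain ⟨Q, hQ⟩ := h l hl (-α) (Or.inr rfl)
  exact ⟨_, mconv_cocMat l hc hP hQ⟩

end Setup

namespace Setup

variable {α s : ℝ} (S : Setup α s)

/-- The increment of the coordinate change at the `i`-th scale. -/
def jump (N i : ℕ) (y : ℝ) : ℝ := (S.eta i y - S.eta (i + 1) y) * (Real.exp (S.psi (S.J N) y) - 1)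

/-- The increment transported `j` steps along the orbit. -/
def jumpAt (l : ℝ) (N i : ℕ) (ω : ℝ) (j : ℕ) (y : ℝ) : ℝ :=
  S.jump N i y * (l⁻¹ ^ (2 * j) *
    Real.exp (2 * ∑ r ∈ Finset.range j, S.psi (S.J N) (y + (r + 1) * ω)))

/-- The solution of the truncated cohomological equation. -/
def sol (l : ℝ) (N i : ℕ) (ω x : ℝ) : ℝ :=
  ∑ j ∈ Finset.range (S.sc.k i), S.jumpAt l N i ω j (x - j * ω)

theorem jump_eq_zero (N : ℕ) {i : ℕ} {y : ℝ} (hy : (1 / 2) ^ S.sc.d i ≤ nd y) :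
    S.jump N i y = 0 := by
  have h1 : S.eta i y = 0 := S.bump.pbump_eq_zero hy
  have h2 : S.eta (i + 1) y = 0 := S.bump.pbump_eq_zero ((S.rho_le (Nat.le_succ i)).trans hy)
  rw [jump, h1, h2, sub_self, zero_mul]

theorem jumpAt_eq_zero (l : ℝ) (N : ℕ) {i : ℕ} (ω : ℝ) (j : ℕ) {y : ℝ}
    (hy : (1 / 2) ^ S.sc.d i ≤ nd y) : S.jumpAt l N i ω j y = 0 := by
  rw [jumpAt, S.jump_eq_zero N hy, zero_mul]

theorem sol_eq_zero (l : ℝ) (N : ℕ) {i : ℕ} {ω x : ℝ}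
    (h : ∀ j < S.sc.k i, (1 / 2) ^ S.sc.d i ≤ nd (x - j * ω)) : S.sol l N i ω x = 0 :=
  Finset.sum_eq_zero fun j hj => S.jumpAt_eq_zero l N ω j (h j (Finset.mem_range.1 hj))

theorem jumpAt_zero (l : ℝ) (N i : ℕ) (ω y : ℝ) : S.jumpAt l N i ω 0 y = S.jump N i y := by
  simp [jumpAt]

theorem jumpAt_succ (l : ℝ) (N i : ℕ) (ω : ℝ) (j : ℕ) (x : ℝ) :
    S.jumpAt l N i ω (j + 1) (x - (j + 1 : ℕ) * ω) =
      l⁻¹ ^ 2 * Real.exp (2 * S.psi (S.J N) x) * S.jumpAt l N i ω j (x - ω - j * ω) := by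
  have e : x - (j + 1 : ℕ) * ω = x - ω - j * ω := by push_cast; ring
  have e2 : x - ω - j * ω + (j + 1) * ω = x := by ring
  rw [e, jumpAt, jumpAt, Finset.sum_range_succ, e2,
    mul_add 2 (Finset.sum _ _), Real.exp_add, mul_add, pow_add]
  ring

theorem sol_rec (l : ℝ) (N i : ℕ) (ω x : ℝ) :
    S.sol l N i ω x + S.jumpAt l N i ω (S.sc.k i) (x - S.sc.k i * ω) =
      S.jump N i x + l⁻¹ ^ 2 * Real.exp (2 * S.psi (S.J N) x) * S.sol l N i ω (x - ω) := by
  have h := Finset.sum_range_succ (fun j : ℕ => S.jumpAt l N i ω j (x - j * ω)) (S.sc.k i)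
  rw [Finset.sum_range_succ'] at h
  rw [sol, ← h, sol, Finset.mul_sum, add_comm]
  congr 1
  · simp [jumpAt_zero]
  · exact Finset.sum_congr rfl fun j _ => S.jumpAt_succ l N i ω j x

theorem half_pow_J_le {i N : ℕ} (h : i ≤ N + 1) :
    (1 / 2 : ℝ) ^ S.J N ≤ (1 / 2) ^ S.sc.d i :=
  pow_le_pow_of_le_one (by norm_num) (by norm_num)
    ((S.sc.d_mono.monotone h).trans (Nat.le_succ _))

theorem jumpAt_eq_pterm (l : ℝ) {N i : ℕ} (hi : i ≤ N) {ω : ℝ} (hω : ω = α ∨ ω = -α) (x : ℝ) :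
    S.jumpAt l N i ω (S.sc.k i) (x - S.sc.k i * ω) = S.pterm l ω i x := by
  obtain ⟨y, hy⟩ : ∃ y, y = x - S.sc.k i * ω := ⟨_, rfl⟩
  rw [pterm, ← hy, jumpAt, jump, corr]
  by_cases h0 : S.eta i y - S.eta (i + 1) y = 0
  · rw [h0]; ring
  have h1 : nd y < (1 / 2) ^ S.sc.d i := by
    by_contra! h
    refine h0 ?_
    rw [show S.eta i y = 0 from S.bump.pbump_eq_zero h, show S.eta (i + 1) y = 0 from
      S.bump.pbump_eq_zero ((S.rho_le (Nat.le_succ i)).trans h), sub_self]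
  have h2 : (1 / 2) ^ S.J i ≤ nd y := by
    by_contra! h
    refine h0 ?_
    rw [show S.eta (i + 1) y = 1 from S.bump.pbump_eq_one h.le, show S.eta i y = 1 from
      S.bump.pbump_eq_one (h.le.trans (pow_le_pow_of_le_one (by norm_num) (by norm_num) ?_)), sub_self]
    have : S.sc.d i < S.sc.d (i + 1) := S.sc.d_mono (Nat.lt_succ_self i)
    rw [J]; omega
  have hJ := S.J_mono.monotone hi
  rw [S.psi_eq_psi (S.j₀_lt_J i).le hJ h2]
  have h3 : ∀ r ∈ Finset.range (S.sc.k i),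
      S.psi (S.J N) (y + (r + 1) * ω) = S.psi (S.J i) (y + (r + 1) * ω) := by
    intro r hr
    rw [Finset.mem_range] at hr
    have h4 := S.rho_le_nd_add_self hω (i := r + 1) (by omega)
      (by rw [abs_of_nonneg (by omega)]; omega) h1
    push_cast at h4
    rw [S.psi_eq_psi (S.j₀_lt_J i).le hJ ((S.half_pow_J_le (Nat.le_succ i)).trans h4)]
  rw [Finset.sum_congr rfl h3]
  ring

/-- The diagonalising coordinate at the `i`-th stage. -/
def coord (N i : ℕ) (x : ℝ) : ℝ := (1 - S.eta i x) * (Real.exp (S.psi (S.J N) x) - 1)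

/-- The corrections not yet removed at the `i`-th stage. -/
def tail (l ω : ℝ) (N i : ℕ) (x : ℝ) : ℝ := ∑ m ∈ Finset.Ico i (N + 1), S.pterm l ω m x

/-- The intermediate cocycles of the conjugation procedure. -/
def stage (l : ℝ) (N i : ℕ) (x : ℝ) : Matrix (Fin 2) (Fin 2) ℝ :=
  hyp l * (low (-S.tail l α N i x) * (low (-S.coord N i x) * core (S.prof (S.J N) x) *
    upp (S.coord N i x)) * upp (S.tail l (-α) N i x))

/-- The conjugation from one stage to the next. -/
def conj (l : ℝ) (N i : ℕ) (x : ℝ) : Matrix (Fin 2) (Fin 2) ℝ :=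
  low (-(l⁻¹ ^ 2 * S.sol l N i α (x - α))) * upp (-S.sol l N i (-α) x)

theorem coord_succ (N i : ℕ) (x : ℝ) : S.coord N (i + 1) x = S.coord N i x + S.jump N i x := by
  rw [coord, coord, jump]; ring

theorem tail_eq (l ω : ℝ) {N i : ℕ} (hi : i ≤ N) (x : ℝ) :
    S.tail l ω N i x = S.pterm l ω i x + S.tail l ω N (i + 1) x := by
  rw [tail, Finset.sum_eq_sum_Ico_succ_bot (by omega), tail]

theorem tail_eq_zero (l : ℝ) {ω : ℝ} (hω : ω = α ∨ ω = -α) (N : ℕ) {i : ℕ} {x : ℝ} {j : ℤ}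
    (hj : |j| ≤ S.sc.k i) (hx : nd (x + j * ω) < (1 / 2) ^ S.sc.d i) :
    S.tail l ω N (i + 1) x = 0 :=
  Finset.sum_eq_zero fun m hm =>
    S.pterm_eq_zero_of_near hω (by have := (Finset.mem_Ico.1 hm).1; omega) hj hx

/-- Away from the `i`-th interval but on its orbit segment, the cocycle is diagonal. -/
theorem low_core_upp_coord {N i : ℕ} (hi : i ≤ N + 1) {x : ℝ} (hx : (1 / 2) ^ S.sc.d i ≤ nd x) :
    low (-S.coord N i x) * core (S.prof (S.J N) x) * upp (S.coord N i x) =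
      hyp (Real.exp (-S.psi (S.J N) x)) := by
  have h1 : S.prof (S.J N) x = Real.exp (-S.psi (S.J N) x) := by
    rw [prof, S.bump.pbump_eq_zero ((S.half_pow_J_le hi).trans hx), sub_zero, mul_one]
  rw [h1]
  refine low_core_upp (Real.exp_ne_zero _) ?_
  rw [coord, show S.eta i x = 0 from S.bump.pbump_eq_zero hx, Real.exp_neg, inv_inv]
  ring

theorem conj_stage {l : ℝ} (hl : l ≠ 0) {N i : ℕ} (hi : i ≤ N) (x : ℝ) :
    S.conj l N i (x + α) * S.stage l N i x = S.stage l N (i + 1) x * S.conj l N i x := by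
  have hα : α = α ∨ α = -α := Or.inl rfl
  have hα' : -α = α ∨ -α = -α := Or.inr rfl
  have hk := S.sc.k_pos i
  have r1 := S.sol_rec l N i α x
  have r2 := S.sol_rec l N i (-α) x
  rw [S.jumpAt_eq_pterm l hi hα] at r1
  rw [S.jumpAt_eq_pterm l hi hα', sub_neg_eq_add] at r2
  have hret : ∀ y, nd y < (1 / 2) ^ S.sc.d i → ∀ j : ℤ, j ≠ 0 → |j| ≤ 2 * S.sc.k i →
      (1 / 2) ^ S.sc.d i ≤ nd (y + j * α) :=
    fun y hy j h0 h1 => S.rho_le_nd_add_self hα h0 h1 hy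
  have hp0 : ∀ ω, (1 / 2) ^ S.sc.d i ≤ nd (x - S.sc.k i * ω) → S.pterm l ω i x = 0 := by
    intro ω h
    rw [pterm, S.corr_eq_zero ω h, mul_zero]
  rw [conj, conj, stage, stage, add_sub_cancel_right, S.tail_eq l α hi, S.tail_eq l (-α) hi,
    S.coord_succ]
  -- the vanishing of everything that is not on the active orbit segment
  have hback : ∀ y (j : ℤ), x = y + j * α → nd y < (1 / 2) ^ S.sc.d i → 0 ≤ j → j ≤ S.sc.k i →
      S.sol l N i (-α) (x + α) = 0 ∧ S.pterm l (-α) i x = 0 ∧ (0 < j → S.sol l N i (-α) x = 0) := by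
    intro y j hx hy h0 h1
    have key : ∀ r : ℕ, (r : ℤ) ≤ S.sc.k i → 0 < j + r →
        (1 / 2) ^ S.sc.d i ≤ nd (x + r * α) := by
      intro r hr hjr
      have := hret y hy (j + r) (by omega) (by rw [abs_of_nonneg (by omega)]; omega)
      rw [hx]; push_cast at this
      convert this using 2; ring
    refine ⟨S.sol_eq_zero l N fun r hr => ?_, hp0 _ ?_, fun hj => S.sol_eq_zero l N fun r hr => ?_⟩
    · have := key (r + 1) (by omega) (by omega)
      push_cast at this
      convert this using 2; ring
    · have := key (S.sc.k i) le_rfl (by omega)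
      convert this using 2; ring
    · have := key r (by omega) (by omega)
      convert this using 2; ring
  have hforw : ∀ y (j : ℤ), x = y - j * α → nd y < (1 / 2) ^ S.sc.d i → 0 ≤ j → j ≤ S.sc.k i →
      S.sol l N i α (x - α) = 0 ∧ S.pterm l α i x = 0 ∧ (0 < j → S.sol l N i α x = 0) := by
    intro y j hx hy h0 h1
    have key : ∀ r : ℕ, (r : ℤ) ≤ S.sc.k i → 0 < j + r →
        (1 / 2) ^ S.sc.d i ≤ nd (x - r * α) := by
      intro r hr hjr
      have := hret y hy (-(j + r)) (by omega) (by rw [abs_neg, abs_of_nonneg (by omega)]; omega)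
      rw [hx]; push_cast at this
      convert this using 2; ring
    refine ⟨S.sol_eq_zero l N fun r hr => ?_, hp0 _ ?_, fun hj => S.sol_eq_zero l N fun r hr => ?_⟩
    · have := key (r + 1) (by omega) (by omega)
      push_cast at this
      convert this using 2; ring
    · exact key (S.sc.k i) le_rfl (by omega)
    · exact key r (by omega) (by omega)
  have htail : ∀ j : ℤ, |j| ≤ S.sc.k i → nd (x + j * α) < (1 / 2) ^ S.sc.d i →
      S.tail l α N (i + 1) x = 0 ∧ S.tail l (-α) N (i + 1) x = 0 := by
    intro j hj h
    refine ⟨S.tail_eq_zero l hα N hj h, S.tail_eq_zero l hα' N (j := -j) (by rwa [abs_neg]) ?_⟩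
    rwa [Int.cast_neg, neg_mul_neg]
  by_cases c1 : nd x < (1 / 2) ^ S.sc.d i
  · obtain ⟨b1, b2, -⟩ := hback x 0 (by simp) c1 le_rfl (by omega)
    obtain ⟨f1, f2, -⟩ := hforw x 0 (by simp) c1 le_rfl (by omega)
    obtain ⟨t1, t2⟩ := htail 0 (by simp) (by simpa using c1)
    rw [f1, f2, mul_zero, add_zero, add_zero] at r1
    rw [b1, b2, mul_zero, add_zero, add_zero] at r2
    rw [b1, b2, f1, f2, t1, t2, r1, r2]
    simp only [mul_zero, neg_zero, add_zero, low_zero, upp_zero, one_mul, mul_one]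
    rw [← mul_assoc, low_mul_hyp hl, mul_assoc (hyp l), mul_assoc (hyp l)]
    congr 1
    rw [mul_assoc (low (-(S.coord N i x + S.jump N i x)) * _), upp_mul_upp, ← mul_assoc, ← mul_assoc,
      low_mul_low]
    congr 3
    · field_simp; ring
    · ring
  push Not at c1
  have hb := S.jump_eq_zero N c1
  rw [hb, add_zero, S.low_core_upp_coord (hi.trans (Nat.le_succ N)) c1]
  have hc : Real.exp (-S.psi (S.J N) x) ≠ 0 := Real.exp_ne_zero _
  have hc2 : Real.exp (2 * S.psi (S.J N) x) = (Real.exp (-S.psi (S.J N) x))⁻¹ ^ 2 := by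
    rw [← Real.exp_neg, neg_neg, ← Real.exp_nat_mul]; norm_num
  rw [hb, zero_add, hc2] at r1 r2
  generalize Real.exp (-S.psi (S.J N) x) = c at *
  by_cases c2 : ∃ j : ℤ, 0 < j ∧ j ≤ S.sc.k i ∧ nd (x - j * α) < (1 / 2) ^ S.sc.d i
  · obtain ⟨j, hj0, hjk, hj⟩ := c2
    obtain ⟨b1, b2, b3⟩ := hback _ j (by ring) hj hj0.le hjk
    obtain ⟨t1, t2⟩ := htail (-j) (by rw [abs_neg, abs_of_pos hj0]; exact hjk) (by
      push_cast; rwa [neg_mul, ← sub_eq_add_neg])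
    rw [b1, b2, b3 hj0, t1, t2]
    simp only [neg_zero, add_zero, low_zero, upp_zero, one_mul, mul_one]
    rw [← mul_assoc, low_mul_hyp hl, mul_assoc (hyp l), mul_assoc (hyp l)]
    congr 1
    rw [← mul_assoc, low_mul_low, low_mul_hyp hc]
    congr 2
    have e : l ^ 2 * -(l⁻¹ ^ 2 * S.sol l N i α x) = -S.sol l N i α x := by field_simp
    rw [e, ← neg_add, r1]
    field_simp
  by_cases c3 : ∃ j : ℤ, 0 < j ∧ j ≤ S.sc.k i ∧ nd (x + j * α) < (1 / 2) ^ S.sc.d i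
  · obtain ⟨j, hj0, hjk, hj⟩ := c3
    obtain ⟨b1, b2, b3⟩ := hforw _ j (by ring) hj hj0.le hjk
    obtain ⟨t1, t2⟩ := htail j (by rw [abs_of_pos hj0]; exact hjk) hj
    rw [b1, b2, b3 hj0, t1, t2]
    simp only [mul_zero, neg_zero, add_zero, low_zero, upp_zero, one_mul, mul_one]
    rw [← mul_assoc, upp_mul_hyp hl, mul_assoc (hyp l), mul_assoc (hyp l)]
    congr 1
    rw [← mul_assoc, upp_mul_hyp hc, mul_assoc, upp_mul_upp]
    congr 2
    linear_combination r2
  push Not at c2 c3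
  have hm : ∀ r : ℕ, r ≤ S.sc.k i → (1 / 2) ^ S.sc.d i ≤ nd (x - r * α) := by
    intro r hr
    rcases Nat.eq_zero_or_pos r with rfl | h
    · simpa using c1
    · exact_mod_cast c2 r (by omega) (by omega)
  have hpl : ∀ r : ℕ, r ≤ S.sc.k i → (1 / 2) ^ S.sc.d i ≤ nd (x + r * α) := by
    intro r hr
    rcases Nat.eq_zero_or_pos r with rfl | h
    · simpa using c1
    · exact_mod_cast c3 r (by omega) (by omega)
  have z1 : S.sol l N i α x = 0 := S.sol_eq_zero l N fun r hr => hm r hr.le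
  have z2 : S.sol l N i α (x - α) = 0 := S.sol_eq_zero l N fun r hr => by
    have := hm (r + 1) hr
    push_cast at this
    convert this using 2; ring
  have z3 : S.sol l N i (-α) x = 0 := S.sol_eq_zero l N fun r hr => by
    have := hpl r hr.le
    convert this using 2; ring
  have z4 : S.sol l N i (-α) (x + α) = 0 := S.sol_eq_zero l N fun r hr => by
    have := hpl (r + 1) hr
    push_cast at this
    convert this using 2; ring
  have z5 := hp0 α (hm _ le_rfl)
  have z6 := hp0 (-α) (by
    have := hpl _ le_rfl
    convert this using 2; ring)
  rw [z1, z2, z3, z4, z5, z6]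
  simp only [mul_zero, neg_zero, zero_add, low_zero, upp_zero, one_mul, mul_one]

theorem stage_zero (l : ℝ) (N : ℕ) (x : ℝ) : S.stage l N 0 x = S.coc l N x := by
  have h : S.coord N 0 x = 0 := by
    rw [coord]
    rcases le_or_gt (nd x) ((1 / 2) ^ S.j₀) with hx | hx
    · rw [show S.eta 0 x = 1 from S.bump.pbump_eq_one hx]; ring
    · rw [S.psi_eq_zero _ hx.le]; simp
  rw [stage, h, coc_eq, neg_zero, low_zero, upp_zero, one_mul, mul_one]
  simp only [tail, pert, Finset.range_eq_Ico]

theorem stage_last (l : ℝ) (N : ℕ) (x : ℝ) : S.stage l N (N + 1) x =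
    hyp l * (low (-S.coord N (N + 1) x) * core (S.prof (S.J N) x) * upp (S.coord N (N + 1) x)) := by
  rw [stage]
  simp [tail, low_zero, upp_zero]

/-- The composition of the first `i` conjugations. -/
def conjProd (l : ℝ) (N : ℕ) : ℕ → ℝ → Matrix (Fin 2) (Fin 2) ℝ
  | 0, _ => 1
  | i + 1, x => S.conj l N i x * conjProd l N i x

theorem conjProd_coc {l : ℝ} (hl : l ≠ 0) {N i : ℕ} (hi : i ≤ N + 1) (x : ℝ) :
    S.conjProd l N i (x + α) * S.coc l N x = S.stage l N i x * S.conjProd l N i x := by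
  induction i with
  | zero => simp [conjProd, stage_zero]
  | succ i ih =>
    rw [conjProd, conjProd, mul_assoc, ih (by omega), ← mul_assoc, S.conj_stage hl (by omega),
      mul_assoc]

theorem conjProd_cocIter {l : ℝ} (hl : l ≠ 0) (N n : ℕ) (x : ℝ) :
    S.conjProd l N (N + 1) (x + n * α) * cocIter α (S.coc l N) n x =
      cocIter α (S.stage l N (N + 1)) n x * S.conjProd l N (N + 1) x := by
  induction n with
  | zero => simp [cocIter]
  | succ n ih =>
    have e : x + (n + 1 : ℕ) * α = x + n * α + α := by push_cast; ring
    rw [cocIter, cocIter, e, ← mul_assoc, S.conjProd_coc hl le_rfl, mul_assoc, ih, mul_assoc]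

end Setup

section OpNorm

theorem opNorm_nonneg (M : Matrix (Fin 2) (Fin 2) ℝ) : 0 ≤ opNorm M := norm_nonneg _

theorem opNorm_mul_le (M N : Matrix (Fin 2) (Fin 2) ℝ) : opNorm (M * N) ≤ opNorm M * opNorm N := by
  rw [opNorm, map_mul]; exact norm_mul_le _ _

theorem opNorm_one : opNorm 1 = 1 := by
  rw [opNorm, map_one]; exact norm_one

theorem continuous_opNorm : Continuous opNorm :=
  continuous_norm.comp (LinearMap.continuous_of_finiteDimensional
    (Matrix.toEuclideanCLM (𝕜 := ℝ) (n := Fin 2)).toAlgEquiv.toLinearMap)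

theorem sq_add_sq_le_opNorm_sq (M : Matrix (Fin 2) (Fin 2) ℝ) (j : Fin 2) :
    M 0 j ^ 2 + M 1 j ^ 2 ≤ opNorm M ^ 2 := by
  have h := (Matrix.toEuclideanCLM (𝕜 := ℝ) M).le_opNorm (EuclideanSpace.single j 1)
  rw [PiLp.norm_single, norm_one, mul_one] at h
  have h2 := pow_le_pow_left₀ (norm_nonneg _) h 2
  rw [EuclideanSpace.norm_sq_eq] at h2
  simpa [Matrix.ofLp_toEuclideanCLM, Fin.sum_univ_two, opNorm] using h2

theorem abs_apply_le_opNorm (M : Matrix (Fin 2) (Fin 2) ℝ) (i j : Fin 2) :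
    |M i j| ≤ opNorm M := by
  refine abs_le_of_sq_le_sq ?_ (opNorm_nonneg M)
  have h := sq_add_sq_le_opNorm_sq M j
  fin_cases i
  · simp only [Fin.zero_eta]; nlinarith [sq_nonneg (M 1 j)]
  · simp only [Fin.mk_one]; nlinarith [sq_nonneg (M 0 j)]

theorem one_le_opNorm {M : Matrix (Fin 2) (Fin 2) ℝ} (hM : M.det = 1) : 1 ≤ opNorm M := by
  have h0 := sq_add_sq_le_opNorm_sq M 0
  have h1 := sq_add_sq_le_opNorm_sq M 1
  rw [Matrix.det_fin_two] at hM
  have h2 : (1 : ℝ) ^ 4 ≤ opNorm M ^ 4 := by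
    calc (1 : ℝ) ^ 4 = (M 0 0 * M 1 1 - M 0 1 * M 1 0) ^ 2 := by rw [hM]; norm_num
      _ ≤ (M 0 0 ^ 2 + M 1 0 ^ 2) * (M 0 1 ^ 2 + M 1 1 ^ 2) := by
        nlinarith [sq_nonneg (M 0 0 * M 0 1 + M 1 0 * M 1 1)]
      _ ≤ opNorm M ^ 2 * opNorm M ^ 2 := by gcongr
      _ = _ := by ring
  exact le_of_pow_le_pow_left₀ (by norm_num) (opNorm_nonneg M) h2

theorem opNorm_le_sum (M : Matrix (Fin 2) (Fin 2) ℝ) :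
    opNorm M ≤ |M 0 0| + |M 0 1| + |M 1 0| + |M 1 1| := by
  refine ContinuousLinearMap.opNorm_le_bound _ (by positivity) fun v => ?_
  have hv : ‖v‖ ^ 2 = v 0 ^ 2 + v 1 ^ 2 := by
    rw [EuclideanSpace.norm_sq_eq]; simp [Fin.sum_univ_two]
  refine le_of_sq_le_sq ?_ (by positivity)
  rw [mul_pow, hv, EuclideanSpace.norm_sq_eq]
  simp only [Matrix.ofLp_toEuclideanCLM, Fin.sum_univ_two, Real.norm_eq_abs, sq_abs,
    Matrix.mulVec_eq_sum, Finset.sum_apply, Pi.smul_apply, MulOpposite.smul_eq_mul_unop, MulOpposite.unop_op,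
    Matrix.transpose_apply]
  have hS : M 0 0 ^ 2 + M 0 1 ^ 2 + M 1 0 ^ 2 + M 1 1 ^ 2 ≤
      (|M 0 0| + |M 0 1| + |M 1 0| + |M 1 1|) ^ 2 := by
    rw [← sq_abs (M 0 0), ← sq_abs (M 0 1), ← sq_abs (M 1 0), ← sq_abs (M 1 1)]
    have a := abs_nonneg (M 0 0)
    have b := abs_nonneg (M 0 1)
    have c := abs_nonneg (M 1 0)
    have d := abs_nonneg (M 1 1)
    nlinarith [mul_nonneg a b, mul_nonneg a c, mul_nonneg a d, mul_nonneg b c, mul_nonneg b d,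
      mul_nonneg c d]
  refine le_trans ?_ (mul_le_mul_of_nonneg_right hS (by positivity))
  nlinarith [sq_nonneg (M 0 0 * v 1 - M 0 1 * v 0), sq_nonneg (M 1 0 * v 1 - M 1 1 * v 0)]

end OpNorm

section Iteration

variable {α : ℝ} {A : ℝ → Matrix (Fin 2) (Fin 2) ℝ}

theorem det_cocIter (hA : ∀ x, (A x).det = 1) (n : ℕ) (x : ℝ) : (cocIter α A n x).det = 1 := by
  induction n with
  | zero => simp [cocIter]
  | succ n ih => rw [cocIter, Matrix.det_mul, hA, ih, one_mul]

theorem continuous_cocIter (hA : Continuous A) (n : ℕ) : Continuous (cocIter α A n) := by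
  induction n with
  | zero => exact continuous_const
  | succ n ih => exact (hA.comp (continuous_id.add continuous_const)).matrix_mul ih

theorem continuous_log_opNorm (hA : Continuous A) (hd : ∀ x, (A x).det = 1) (n : ℕ) :
    Continuous fun x => Real.log (opNorm (cocIter α A n x)) :=
  (continuous_opNorm.comp (continuous_cocIter hA n)).log fun x =>
    (one_pos.trans_le (one_le_opNorm (det_cocIter hd n x))).ne'

theorem log_opNorm_nonneg (hd : ∀ x, (A x).det = 1) (n : ℕ) (x : ℝ) :
    0 ≤ Real.log (opNorm (cocIter α A n x)) :=
  Real.log_nonneg (one_le_opNorm (det_cocIter hd n x))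

theorem opNorm_cocIter_le {C : ℝ} (hA : ∀ x, opNorm (A x) ≤ C) (n : ℕ) (x : ℝ) :
    opNorm (cocIter α A n x) ≤ C ^ n := by
  induction n with
  | zero => simp [cocIter, opNorm_one]
  | succ n ih =>
    rw [cocIter, pow_succ']
    exact (opNorm_mul_le _ _).trans (mul_le_mul (hA _) ih (opNorm_nonneg _)
      ((opNorm_nonneg _).trans (hA 0)))

theorem log_opNorm_cocIter_le {C : ℝ} (hd : ∀ x, (A x).det = 1) (hA : ∀ x, opNorm (A x) ≤ C)
    (n : ℕ) (x : ℝ) : Real.log (opNorm (cocIter α A n x)) ≤ n * Real.log C := by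
  rw [← Real.log_pow]
  exact Real.log_le_log (one_pos.trans_le (one_le_opNorm (det_cocIter hd n x)))
    (opNorm_cocIter_le hA n x)

theorem cocIter_congr {B : ℝ → Matrix (Fin 2) (Fin 2) ℝ} {x : ℝ} {n : ℕ}
    (h : ∀ i < n, A (x + i * α) = B (x + i * α)) : cocIter α A n x = cocIter α B n x := by
  induction n with
  | zero => rfl
  | succ n ih =>
    rw [cocIter, cocIter, h n (Nat.lt_succ_self n),
      ih fun i hi => h i (hi.trans (Nat.lt_succ_self n))]

theorem cocIter_add (m n : ℕ) (x : ℝ) :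
    cocIter α A (m + n) x = cocIter α A n (x + m * α) * cocIter α A m x := by
  induction n with
  | zero => simp [cocIter]
  | succ n ih =>
    have e : x + ((m + n : ℕ) : ℝ) * α = x + m * α + n * α := by push_cast; ring
    rw [← add_assoc, cocIter, cocIter, ih, e, mul_assoc]

theorem cocIter_hyp (f : ℝ → ℝ) (n : ℕ) (x : ℝ) :
    cocIter α (fun y => hyp (f y)) n x = hyp (∏ i ∈ Finset.range n, f (x + i * α)) := by
  induction n with
  | zero => simp [cocIter, hyp_one]
  | succ n ih => rw [cocIter, ih, hyp_mul_hyp, Finset.prod_range_succ, mul_comm]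

end Iteration

section PeriodicIntegral

variable {f : ℝ → ℝ}

theorem integral_translate (hf : Function.Periodic f 1) (c : ℝ) :
    ∫ x in (0 : ℝ)..1, f (x + c) = ∫ x in (0 : ℝ)..1, f x := by
  rw [intervalIntegral.integral_comp_add_right, zero_add, add_comm]
  simpa using hf.intervalIntegral_add_eq c 0

theorem integral_centered (hf : Function.Periodic f 1) :
    ∫ x in (0 : ℝ)..1, f x = ∫ x in (-(1 / 2) : ℝ)..1 / 2, f x := by
  have := hf.intervalIntegral_add_eq 0 (-(1 / 2))
  norm_num at this ⊢
  exact this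

end PeriodicIntegral

theorem nd_eq_abs {x : ℝ} (hx : |x| < 1 / 2) : nd x = |x| := by
  rw [nd, round_eq_of_abs_lt (z := 0) (by simpa using hx)]; simp

namespace IsBump

variable {s K M : ℝ} {χ : ℝ → ℝ}

theorem integral_pbump_le (h : IsBump s K M χ) {j : ℕ} (hj : 2 ≤ j) :
    ∫ x in (0 : ℝ)..1, pbump χ j x ≤ 2 * (1 / 2) ^ j := by
  have hc : Continuous (pbump χ j) := (h.smooth_pbump hj).continuous
  have hr : (1 / 2 : ℝ) ^ j ≤ (1 / 2) ^ 2 := pow_le_pow_of_le_one (by norm_num) (by norm_num) hj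
  have hr0 : (0 : ℝ) < (1 / 2) ^ j := by positivity
  have hi : ∀ a b, IntervalIntegrable (pbump χ j) volume a b := fun a b => hc.intervalIntegrable a b
  rw [integral_centered (pbump_add_one χ j),
    ← intervalIntegral.integral_add_adjacent_intervals (hi _ (-(1 / 2) ^ j)) (hi _ _),
    ← intervalIntegral.integral_add_adjacent_intervals (hi (-(1 / 2) ^ j) ((1 / 2) ^ j)) (hi _ _)]
  have z1 : ∫ x in (-(1 / 2) : ℝ)..-(1 / 2) ^ j, pbump χ j x = 0 := by
    rw [intervalIntegral.integral_zero_ae]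
    refine Filter.Eventually.of_forall fun x hx => ?_
    rw [Set.uIoc_of_le (by linarith)] at hx
    refine h.pbump_eq_zero ?_
    rw [nd_eq_abs (abs_lt.2 ⟨by linarith [hx.1], by linarith [hx.2]⟩)]
    exact le_abs.2 (Or.inr (by linarith [hx.2]))
  have z2 : ∫ x in ((1 / 2) ^ j : ℝ)..1 / 2, pbump χ j x = 0 := by
    rw [intervalIntegral.integral_zero_ae]
    have : ∀ᵐ x : ℝ, x ≠ 1 / 2 := Measure.ae_ne volume (1 / 2)
    filter_upwards [this] with x hne hx
    rw [Set.uIoc_of_le (by linarith)] at hx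
    refine h.pbump_eq_zero ?_
    rw [nd_eq_abs (abs_lt.2 ⟨by linarith [hx.1], lt_of_le_of_ne hx.2 hne⟩)]
    exact le_abs.2 (Or.inl hx.1.le)
  have z3 : ∫ x in (-(1 / 2) ^ j : ℝ)..(1 / 2) ^ j, pbump χ j x ≤
      ∫ x in (-(1 / 2) ^ j : ℝ)..(1 / 2) ^ j, (1 : ℝ) :=
    intervalIntegral.integral_mono_on (by linarith) (hi _ _) (continuous_const.intervalIntegrable _ _)
      fun x _ => h.pbump_le_one j x
  rw [intervalIntegral.integral_const, smul_eq_mul, mul_one] at z3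
  linarith

theorem le_integral_pbump (h : IsBump s K M χ) {j : ℕ} (hj : 2 ≤ j) :
    (1 / 2) ^ j ≤ ∫ x in (0 : ℝ)..1, pbump χ j x := by
  have hc : Continuous (pbump χ j) := (h.smooth_pbump hj).continuous
  have hr : (1 / 2 : ℝ) ^ (j + 1) ≤ (1 / 2) ^ 3 :=
    pow_le_pow_of_le_one (by norm_num) (by norm_num) (by omega)
  have hr0 : (0 : ℝ) < (1 / 2) ^ (j + 1) := by positivity
  have hi : ∀ a b, IntervalIntegrable (pbump χ j) volume a b := fun a b => hc.intervalIntegrable a b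
  rw [integral_centered (pbump_add_one χ j)]
  have z3 : ∫ x in (-(1 / 2) ^ (j + 1) : ℝ)..(1 / 2) ^ (j + 1), (1 : ℝ) ≤
      ∫ x in (-(1 / 2) ^ (j + 1) : ℝ)..(1 / 2) ^ (j + 1), pbump χ j x := by
    refine intervalIntegral.integral_mono_on (by linarith)
      (continuous_const.intervalIntegrable _ _) (hi _ _) fun x hx => ?_
    rw [h.pbump_eq_one]
    exact (nd_le_abs x).trans (abs_le.2 hx)
  have z4 := intervalIntegral.integral_mono_interval (f := pbump χ j) (μ := volume)
    (a := -(1 / 2) ^ (j + 1)) (b := (1 / 2) ^ (j + 1)) (c := -(1 / 2)) (d := 1 / 2)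
    (by linarith) (by linarith) (by linarith)
    (Filter.Eventually.of_forall fun x => h.pbump_nonneg j x) (hi _ _)
  rw [intervalIntegral.integral_const, smul_eq_mul, mul_one] at z3
  refine le_trans (le_of_eq ?_) (z3.trans z4)
  rw [pow_succ]; ring

end IsBump

theorem integral_sum_translate {f : ℝ → ℝ} (hc : Continuous f) (hf : Function.Periodic f 1)
    {ι : Type*} (t : Finset ι) (c : ι → ℝ) :
    ∫ x in (0 : ℝ)..1, ∑ i ∈ t, f (x + c i) = t.card * ∫ x in (0 : ℝ)..1, f x := by
  rw [intervalIntegral.integral_finsetSum fun i _ =>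
    Continuous.intervalIntegrable (by fun_prop) _ _]
  simp only [integral_translate hf, Finset.sum_const, nsmul_eq_mul]

namespace Setup

variable {α s : ℝ} (S : Setup α s)

/-- A continuous majorant of the indicator function of the `m`-th interval. -/
def near (m : ℕ) (x : ℝ) : ℝ := pbump S.χ (S.sc.d m - 1) x

theorem near_nonneg (m : ℕ) (x : ℝ) : 0 ≤ S.near m x := S.bump.pbump_nonneg _ _

theorem two_le_d_sub (m : ℕ) : 2 ≤ S.sc.d m - 1 := by have := S.four_le_d m; omega

theorem continuous_near (m : ℕ) : Continuous (S.near m) :=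
  (S.bump.smooth_pbump (S.two_le_d_sub m)).continuous

theorem near_add_one (m : ℕ) : Function.Periodic (S.near m) 1 := pbump_add_one _ _

theorem rho_le_of_near_lt_one {m : ℕ} {x : ℝ} (h : S.near m x < 1) :
    (1 / 2 : ℝ) ^ S.sc.d m ≤ nd x := by
  by_contra! h1
  refine h.ne (S.bump.pbump_eq_one ?_)
  rw [Nat.sub_add_cancel (by have := S.four_le_d m; omega)]
  exact h1.le

theorem integral_near_le (m : ℕ) :
    ∫ x in (0 : ℝ)..1, S.near m x ≤ 4 * (1 / 2) ^ S.sc.d m := by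
  refine (S.bump.integral_pbump_le (S.two_le_d_sub m)).trans (le_of_eq ?_)
  conv_rhs => rw [← Nat.sub_add_cancel (show 1 ≤ S.sc.d m by have := S.four_le_d m; omega)]
  rw [pow_succ]; ring

/-- A majorant of the indicator function of the points where the conjugation is nontrivial. -/
def bad (N : ℕ) (x : ℝ) : ℝ :=
  ∑ m ∈ Finset.range (N + 1), ∑ j ∈ Finset.range (S.sc.k m),
    (S.near m (x + (-α - j * α)) + S.near m (x + j * α))

theorem bad_nonneg (N : ℕ) (x : ℝ) : 0 ≤ S.bad N x :=
  Finset.sum_nonneg fun _ _ => Finset.sum_nonneg fun _ _ =>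
    add_nonneg (S.near_nonneg _ _) (S.near_nonneg _ _)

theorem continuous_bad (N : ℕ) : Continuous (S.bad N) := by
  have := S.continuous_near
  unfold bad
  fun_prop

theorem bad_add_one (N : ℕ) : Function.Periodic (S.bad N) 1 := by
  intro x
  have h : ∀ m c, S.near m (x + 1 + c) = S.near m (x + c) := fun m c => by
    rw [add_right_comm]; exact S.near_add_one m _
  simp only [bad, h]

theorem conjProd_eq_one (l : ℝ) {N : ℕ} {x : ℝ} (h : S.bad N x < 1) {i : ℕ} (hi : i ≤ N + 1) :
    S.conjProd l N i x = 1 := by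
  induction i with
  | zero => rfl
  | succ i ih =>
    have key : ∀ j < S.sc.k i, S.near i (x + (-α - j * α)) + S.near i (x + j * α) < 1 := by
      intro j hj
      refine lt_of_le_of_lt ?_ h
      have h1 := Finset.single_le_sum (f := fun j : ℕ =>
          S.near i (x + (-α - j * α)) + S.near i (x + j * α))
        (fun _ _ => add_nonneg (S.near_nonneg _ _) (S.near_nonneg _ _)) (Finset.mem_range.2 hj)
      exact h1.trans (Finset.single_le_sum (f := fun m => ∑ j ∈ Finset.range (S.sc.k m),
          (S.near m (x + (-α - j * α)) + S.near m (x + j * α)))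
        (fun _ _ => Finset.sum_nonneg fun _ _ => add_nonneg (S.near_nonneg _ _) (S.near_nonneg _ _))
        (Finset.mem_range.2 (by omega)))
    have h1 : S.sol l N i α (x - α) = 0 := S.sol_eq_zero l N fun j hj => by
      have := S.rho_le_of_near_lt_one (m := i) (x := x + (-α - j * α))
        (by linarith [key j hj, S.near_nonneg i (x + j * α)])
      convert this using 2; ring
    have h2 : S.sol l N i (-α) x = 0 := S.sol_eq_zero l N fun j hj => by
      have := S.rho_le_of_near_lt_one (m := i) (x := x + j * α)
        (by linarith [key j hj, S.near_nonneg i (x + (-α - j * α))])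
      convert this using 2; ring
    rw [conjProd, conj, h1, h2, ih (by omega)]
    simp [low_zero, upp_zero]

theorem integral_bad_le (N : ℕ) : ∫ x in (0 : ℝ)..1, S.bad N x ≤ (1 / 2) ^ 13 := by
  have hc := S.continuous_near
  have h1 : ∀ m, ∫ x in (0 : ℝ)..1, ∑ j ∈ Finset.range (S.sc.k m),
      (S.near m (x + (-α - j * α)) + S.near m (x + j * α)) ≤ (1 / 2) ^ 15 * (1 / 2) ^ m := by
    intro m
    simp only [Finset.sum_add_distrib]
    rw [intervalIntegral.integral_add (Continuous.intervalIntegrable (by fun_prop) _ _)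
      (Continuous.intervalIntegrable (by fun_prop) _ _),
      integral_sum_translate (hc m) (S.near_add_one m),
      integral_sum_translate (hc m) (S.near_add_one m), Finset.card_range]
    have h2 := S.integral_near_le m
    have h3 : (2 : ℝ) ^ (14 + m) * S.sc.k m ≤ S.sc.q m := by exact_mod_cast S.sc.k_le m
    have h4 : (16 : ℝ) * S.sc.q m ≤ 2 ^ S.sc.d m := by exact_mod_cast S.sc.q_le m
    have h5 : (1 / 2 : ℝ) ^ S.sc.d m * 2 ^ S.sc.d m = 1 := by rw [← mul_pow]; norm_num
    have h6 : (1 / 2 : ℝ) ^ m * 2 ^ m = 1 := by rw [← mul_pow]; norm_num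
    have h7 : (0 : ℝ) < (1 / 2) ^ S.sc.d m := by positivity
    have h8 : (0 : ℝ) < (1 / 2) ^ m := by positivity
    have h9 : (0 : ℝ) ≤ S.sc.k m := by positivity
    calc (S.sc.k m : ℝ) * (∫ x in (0 : ℝ)..1, S.near m x) +
          S.sc.k m * ∫ x in (0 : ℝ)..1, S.near m x
        ≤ S.sc.k m * (4 * (1 / 2) ^ S.sc.d m) + S.sc.k m * (4 * (1 / 2) ^ S.sc.d m) := by gcongr
      _ = (1 / 2) ^ m * (1 / 2) ^ S.sc.d m * ((1 / 2) ^ 11 * (2 ^ (14 + m) * S.sc.k m)) := by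
          rw [pow_add]; linear_combination (8 * S.sc.k m * (1 / 2) ^ S.sc.d m : ℝ) * (-h6)
      _ ≤ (1 / 2) ^ m * (1 / 2) ^ S.sc.d m * ((1 / 2) ^ 11 * (2 ^ S.sc.d m / 16)) := by
          gcongr; linarith
      _ = (1 / 2) ^ 15 * (1 / 2) ^ m := by
          linear_combination ((1 / 2) ^ 15 * (1 / 2) ^ m : ℝ) * h5
  unfold bad
  rw [intervalIntegral.integral_finsetSum fun i _ =>
    Continuous.intervalIntegrable (by fun_prop) _ _]
  refine (Finset.sum_le_sum fun m _ => h1 m).trans ?_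
  rw [← Finset.mul_sum]
  have h2 := (summable_geometric_of_lt_one (r := (1 / 2 : ℝ)) (by norm_num) (by norm_num)).sum_le_tsum
    (Finset.range (N + 1)) (fun _ _ => by positivity)
  rw [tsum_geometric_of_lt_one (by norm_num) (by norm_num)] at h2
  norm_num at h2 ⊢
  linarith

/-- An upper bound for the mean of the profile exponents. -/
def mean : ℝ := 2 * (1 - S.Θ / 2)⁻¹

theorem integral_psi_le (J : ℕ) : ∫ x in (0 : ℝ)..1, S.psi J x ≤ S.mean := by
  have h0 := S.Θ_pos
  have h1 := S.Θ_lt_two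
  unfold psi
  have hi : ∀ j ∈ Finset.Ico S.j₀ J,
      IntervalIntegrable (fun x => S.Θ ^ j * pbump S.χ j x) volume 0 1 := fun j hj =>
    (continuous_const.mul (S.smooth_pb (Finset.mem_Ico.1 hj).1).continuous).intervalIntegrable _ _
  rw [intervalIntegral.integral_finsetSum hi]
  have h2 : ∀ j ∈ Finset.Ico S.j₀ J,
      ∫ x in (0 : ℝ)..1, S.Θ ^ j * pbump S.χ j x ≤ 2 * (S.Θ / 2) ^ j := by
    intro j hj
    rw [intervalIntegral.integral_const_mul]
    have := S.bump.integral_pbump_le (S.two_le_j₀.trans (Finset.mem_Ico.1 hj).1)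
    calc S.Θ ^ j * ∫ x in (0 : ℝ)..1, pbump S.χ j x ≤ S.Θ ^ j * (2 * (1 / 2) ^ j) := by gcongr
      _ = 2 * (S.Θ / 2) ^ j := by rw [div_pow, div_pow]; ring
  refine (Finset.sum_le_sum h2).trans ?_
  rw [← Finset.mul_sum, mean]
  have h3 := (summable_geometric_of_lt_one (r := S.Θ / 2) (by positivity) (by linarith)).sum_le_tsum
    (Finset.Ico S.j₀ J) (fun _ _ => by positivity)
  rw [tsum_geometric_of_lt_one (by positivity) (by linarith)] at h3
  linarith

theorem stage_last_eq_hyp (l : ℝ) {N : ℕ} {x : ℝ} (hx : (1 / 2) ^ S.sc.d (N + 1) ≤ nd x) :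
    S.stage l N (N + 1) x = hyp (l * Real.exp (-S.psi (S.J N) x)) := by
  rw [stage_last, S.low_core_upp_coord le_rfl hx, hyp_mul_hyp]

theorem log_prod_eq {l : ℝ} (hl : 0 < l) (N n : ℕ) (x : ℝ) :
    Real.log (∏ i ∈ Finset.range n, l * Real.exp (-S.psi (S.J N) (x + i * α))) =
      n * Real.log l - ∑ i ∈ Finset.range n, S.psi (S.J N) (x + i * α) := by
  rw [Real.log_prod fun i _ => by positivity]
  simp [Real.log_mul hl.ne' (Real.exp_ne_zero _), Finset.sum_add_distrib, sub_eq_add_neg]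

/-- Pointwise lower bound for the growth of the cocycle. -/
theorem le_log_opNorm {l : ℝ} (hl : 1 ≤ l) (N n : ℕ) (x : ℝ) :
    n * Real.log l * (1 - S.bad N x - S.bad N (x + n * α) -
        ∑ i ∈ Finset.range n, S.near (N + 1) (x + i * α)) -
      ∑ i ∈ Finset.range n, S.psi (S.J N) (x + i * α) ≤
    Real.log (opNorm (cocIter α (S.coc l N) n x)) := by
  have hl0 : l ≠ 0 := by positivity
  have hlog := Real.log_nonneg hl
  have hb1 := S.bad_nonneg N x
  have hb2 := S.bad_nonneg N (x + n * α)
  have hb3 : 0 ≤ ∑ i ∈ Finset.range n, S.near (N + 1) (x + i * α) :=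
    Finset.sum_nonneg fun _ _ => S.near_nonneg _ _
  have hpsi : 0 ≤ ∑ i ∈ Finset.range n, S.psi (S.J N) (x + i * α) :=
    Finset.sum_nonneg fun _ _ => S.psi_nonneg _ _
  have hn : 0 ≤ n * Real.log l := by positivity
  by_cases h : S.bad N x < 1 ∧ S.bad N (x + n * α) < 1 ∧
      ∑ i ∈ Finset.range n, S.near (N + 1) (x + i * α) < 1
  · obtain ⟨h1, h2, h3⟩ := h
    have h4 := S.conjProd_cocIter hl0 N n x
    rw [S.conjProd_eq_one l h1 le_rfl, S.conjProd_eq_one l h2 le_rfl, one_mul, mul_one] at h4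
    have h5 : cocIter α (S.stage l N (N + 1)) n x =
        cocIter α (fun y => hyp (l * Real.exp (-S.psi (S.J N) y))) n x :=
      cocIter_congr fun i hi => S.stage_last_eq_hyp l (S.rho_le_of_near_lt_one
        ((Finset.single_le_sum (f := fun i : ℕ => S.near (N + 1) (x + i * α))
          (fun _ _ => S.near_nonneg _ _) (Finset.mem_range.2 hi)).trans_lt h3))
    rw [h4, h5, cocIter_hyp]
    have h6 := abs_apply_le_opNorm
      (hyp (∏ i ∈ Finset.range n, l * Real.exp (-S.psi (S.J N) (x + i * α)))) 0 0
    have hp : 0 < ∏ i ∈ Finset.range n, l * Real.exp (-S.psi (S.J N) (x + i * α)) :=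
      Finset.prod_pos fun _ _ => by positivity
    have h7 := Real.log_le_log hp ((le_abs_self _).trans h6)
    rw [S.log_prod_eq (by positivity)] at h7
    nlinarith
  · have h1 : 1 - S.bad N x - S.bad N (x + n * α) -
        ∑ i ∈ Finset.range n, S.near (N + 1) (x + i * α) ≤ 0 := by
      by_contra! h2
      exact h ⟨by linarith, by linarith, by linarith⟩
    have h2 := log_opNorm_nonneg (α := α) (S.det_coc hl0 N) n x
    nlinarith [mul_nonpos_of_nonneg_of_nonpos hn h1]

theorem continuous_psi (N : ℕ) : Continuous (S.psi (S.J N)) := (S.smooth_psi (S.J N)).continuous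

/-- Integrated lower bound for the growth of the cocycle. -/
theorem le_integral_log {l : ℝ} (hl : 1 ≤ l) {N : ℕ} (hA : Continuous (S.coc l N)) (n : ℕ) :
    n * Real.log l * (1 - 2 * (1 / 2) ^ 13 - n * (4 * (1 / 2) ^ S.sc.d (N + 1))) - n * S.mean ≤
      ∫ x in (0 : ℝ)..1, Real.log (opNorm (cocIter α (S.coc l N) n x)) := by
  have hl0 : l ≠ 0 := by positivity
  have c1 := S.continuous_bad N
  have c2 := S.continuous_near (N + 1)
  have c3 := S.continuous_psi N
  have hn : 0 ≤ n * Real.log l := mul_nonneg n.cast_nonneg (Real.log_nonneg hl)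
  have hm := intervalIntegral.integral_mono_on (μ := volume) zero_le_one
    (Continuous.intervalIntegrable (by fun_prop) _ _)
    ((continuous_log_opNorm hA (S.det_coc hl0 N) n).intervalIntegrable _ _)
    (fun x _ => S.le_log_opNorm hl N n x)
  refine le_trans ?_ hm
  rw [intervalIntegral.integral_sub (Continuous.intervalIntegrable (by fun_prop) _ _)
      (Continuous.intervalIntegrable (by fun_prop) _ _), intervalIntegral.integral_const_mul,
    intervalIntegral.integral_sub (Continuous.intervalIntegrable (by fun_prop) _ _)
      (Continuous.intervalIntegrable (by fun_prop) _ _),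
    intervalIntegral.integral_sub (Continuous.intervalIntegrable (by fun_prop) _ _)
      (Continuous.intervalIntegrable (by fun_prop) _ _),
    intervalIntegral.integral_sub (Continuous.intervalIntegrable (by fun_prop) _ _)
      (Continuous.intervalIntegrable (by fun_prop) _ _),
    integral_translate (S.bad_add_one N), integral_sum_translate c2 (S.near_add_one _),
    integral_sum_translate c3 (S.psi_add_one _)]
  have h1 := S.integral_bad_le N
  have h2 := S.integral_near_le (N + 1)
  have h3 := S.integral_psi_le (S.J N)
  simp only [intervalIntegral.integral_const, Finset.card_range, sub_zero, smul_eq_mul, mul_one]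
  have h4 : (0 : ℝ) ≤ n := n.cast_nonneg
  refine sub_le_sub (mul_le_mul_of_nonneg_left ?_ hn) (mul_le_mul_of_nonneg_left h3 h4)
  linarith [mul_le_mul_of_nonneg_left h2 h4]

end Setup

section Lyapunov

variable {α : ℝ} {A : ℝ → Matrix (Fin 2) (Fin 2) ℝ}

/-- The averaged logarithmic growth over `n` steps. -/
def growth (α : ℝ) (A : ℝ → Matrix (Fin 2) (Fin 2) ℝ) (n : ℕ) : ℝ :=
  (n : ℝ)⁻¹ * ∫ x in (0 : ℝ)..1, Real.log (opNorm (cocIter α A n x))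

theorem growth_nonneg (hd : ∀ x, (A x).det = 1) (n : ℕ) : 0 ≤ growth α A n :=
  mul_nonneg (by positivity) (intervalIntegral.integral_nonneg zero_le_one fun x _ =>
    log_opNorm_nonneg hd n x)

theorem growth_le {C : ℝ} (hA : Continuous A) (hd : ∀ x, (A x).det = 1)
    (hC : ∀ x, opNorm (A x) ≤ C) (n : ℕ) : growth α A n ≤ Real.log C := by
  have h1 : 1 ≤ C := (one_le_opNorm (hd 0)).trans (hC 0)
  have h2 := intervalIntegral.integral_mono_on (μ := volume) zero_le_one
    ((continuous_log_opNorm (α := α) hA hd n).intervalIntegrable 0 1)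
    (intervalIntegrable_const) (fun x _ => log_opNorm_cocIter_le hd hC n x)
  rw [intervalIntegral.integral_const, sub_zero, one_smul] at h2
  rcases Nat.eq_zero_or_pos n with rfl | hn
  · simpa [growth] using Real.log_nonneg h1
  · have : (0 : ℝ) < n := by exact_mod_cast hn
    rw [growth, inv_mul_le_iff₀ this]
    exact h2

theorem isBoundedUnder_growth {C : ℝ} (hA : Continuous A) (hd : ∀ x, (A x).det = 1)
    (hC : ∀ x, opNorm (A x) ≤ C) : IsBoundedUnder (· ≤ ·) atTop (growth α A) :=
  isBoundedUnder_of ⟨_, growth_le hA hd hC⟩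

theorem isCoboundedUnder_growth (hd : ∀ x, (A x).det = 1) :
    IsCoboundedUnder (· ≤ ·) atTop (growth α A) :=
  (isBoundedUnder_of ⟨0, fun n => growth_nonneg hd n⟩ :
    IsBoundedUnder (· ≥ ·) atTop (growth α A)).isCoboundedUnder_le

theorem le_lyap {C b : ℝ} (hA : Continuous A) (hd : ∀ x, (A x).det = 1)
    (hC : ∀ x, opNorm (A x) ≤ C) (h : ∀ n, 1 ≤ n → b ≤ growth α A n) : b ≤ lyap α A :=
  le_limsup_of_frequently_le ((eventually_ge_atTop 1).mono h).frequently
    (isBoundedUnder_growth hA hd hC)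

theorem lyap_le {b : ℝ} {v : ℕ → ℝ} (hd : ∀ x, (A x).det = 1)
    (h : ∀ n, 1 ≤ n → growth α A n ≤ v n) (hv : Tendsto v atTop (nhds b)) : lyap α A ≤ b := by
  rw [← hv.limsup_eq]
  exact limsup_le_limsup ((eventually_ge_atTop 1).mono h) (isCoboundedUnder_growth hd)
    hv.isBoundedUnder_le

end Lyapunov

namespace MConv

variable {α s : ℝ} {A : ℕ → ℝ → Matrix (Fin 2) (Fin 2) ℝ} {D : ℝ → Matrix (Fin 2) (Fin 2) ℝ}

theorem exists_opNorm_le (h : MConv s A D) : ∃ C, ∀ n x, opNorm (A n x) ≤ C := by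
  have key : ∀ i j, ∃ M, ∀ n x, |A n x i j| ≤ M := by
    intro i j
    obtain ⟨M, hM⟩ := (h i j).jet_limit
    obtain ⟨δ, hδ, hj⟩ := (h i j).jet_sub
    obtain ⟨B, hB⟩ := hδ.bddAbove_range
    refine ⟨B + M, fun n x => ?_⟩
    have h1 : |D x i j| ≤ M := by simpa using hM x 0
    have h2 : |A n x i j - D x i j| ≤ δ n := by simpa using hj n x 0
    have h3 : δ n ≤ B := hB ⟨n, rfl⟩
    have h4 := abs_add_le (A n x i j - D x i j) (D x i j)
    rw [sub_add_cancel] at h4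
    linarith
  choose M hM using key
  exact ⟨_, fun n x => (opNorm_le_sum _).trans (add_le_add (add_le_add (add_le_add
    (hM 0 0 n x) (hM 0 1 n x)) (hM 1 0 n x)) (hM 1 1 n x))⟩

theorem tendsto_cocIter (h : MConv s A D) (n : ℕ) (x : ℝ) :
    Tendsto (fun N => cocIter α (A N) n x) atTop (nhds (cocIter α D n x)) := by
  induction n with
  | zero => exact tendsto_const_nhds
  | succ n ih => exact (h.tendsto _).mul ih

theorem det_limit (h : MConv s A D) (hd : ∀ n x, (A n x).det = 1) (x : ℝ) : (D x).det = 1 := by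
  have h1 := ((continuous_id.matrix_det).tendsto (D x)).comp (h.tendsto x)
  refine tendsto_nhds_unique h1 ?_
  simp [Function.comp_def, hd]

theorem periodic_limit (h : MConv s A D) (hp : ∀ n x, A n (x + 1) = A n x) (x : ℝ) :
    D (x + 1) = D x := by
  have h1 := h.tendsto (x + 1)
  simp only [hp] at h1
  exact tendsto_nhds_unique h1 (h.tendsto x)

theorem opNorm_limit_le (h : MConv s A D) {C : ℝ} (hC : ∀ n x, opNorm (A n x) ≤ C) (x : ℝ) :
    opNorm (D x) ≤ C :=
  le_of_tendsto ((continuous_opNorm.tendsto _).comp (h.tendsto x))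
    (Eventually.of_forall fun n => hC n x)

theorem tendsto_growth (h : MConv s A D) (hd : ∀ n x, (A n x).det = 1) (n : ℕ) :
    Tendsto (fun N => growth α (A N) n) atTop (nhds (growth α D n)) := by
  obtain ⟨C, hC⟩ := h.exists_opNorm_le
  refine Tendsto.const_mul _ ?_
  refine intervalIntegral.tendsto_integral_filter_of_dominated_convergence
    (fun _ => n * Real.log C) (Eventually.of_forall fun N =>
      (continuous_log_opNorm (h.continuous N) (hd N) n).aestronglyMeasurable)
    (Eventually.of_forall fun N => Eventually.of_forall fun x _ => ?_)
    intervalIntegrable_const (Eventually.of_forall fun x _ => ?_)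
  · rw [Real.norm_of_nonneg (log_opNorm_nonneg (hd N) n x)]
    exact log_opNorm_cocIter_le (hd N) (hC N) n x
  · exact ((continuous_opNorm.tendsto _).comp (h.tendsto_cocIter n x)).log
      (one_pos.trans_le (one_le_opNorm (det_cocIter (h.det_limit hd) n x))).ne'

end MConv

namespace Setup

variable {α s : ℝ} (S : Setup α s)

theorem le_lyap_limit {l : ℝ} (hl : 1 ≤ l) {D : ℝ → Matrix (Fin 2) (Fin 2) ℝ}
    (h : MConv s (S.coc l) D) :
    Real.log l * (1 - 2 * (1 / 2) ^ 13) - S.mean ≤ lyap α D := by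
  have hl0 : l ≠ 0 := by positivity
  have hd := fun N => S.det_coc (l := l) hl0 N
  obtain ⟨C, hC⟩ := h.exists_opNorm_le
  refine le_lyap h.continuous_limit (h.det_limit hd) (h.opNorm_limit_le hC) fun n hn => ?_
  have hn0 : (0 : ℝ) < n := by exact_mod_cast hn
  have h1 : Tendsto (fun N => Real.log l *
      (1 - 2 * (1 / 2) ^ 13 - n * (4 * (1 / 2) ^ S.sc.d (N + 1))) - S.mean) atTop
      (nhds (Real.log l * (1 - 2 * (1 / 2) ^ 13 - n * (4 * 0)) - S.mean)) :=
    (((((tendsto_pow_atTop_nhds_zero_of_lt_one (by norm_num) (by norm_num)).comp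
      (S.sc.d_mono.tendsto_atTop.comp (tendsto_add_atTop_nat 1))).const_mul 4).const_mul
        (n : ℝ)).const_sub _).const_mul _ |>.sub_const _
  rw [mul_zero, mul_zero, sub_zero] at h1
  refine le_of_tendsto_of_tendsto' h1 (h.tendsto_growth hd n) fun N => ?_
  rw [growth, le_inv_mul_iff₀ hn0]
  refine le_trans (le_of_eq ?_) (S.le_integral_log hl (h.continuous N) n)
  ring

end Setup

theorem exists_le_of_periodic {f : ℝ → ℝ} (hc : Continuous f) (hf : Function.Periodic f 1) :
    ∃ C, ∀ x, f x ≤ C := by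
  obtain ⟨C, hC⟩ := (isCompact_Icc (a := (0 : ℝ)) (b := 1)).exists_bound_of_continuousOn
    hc.continuousOn
  refine ⟨C, fun x => ?_⟩
  obtain ⟨y, hy, hxy⟩ := hf.exists_mem_Ico₀ one_pos x
  rw [hxy]
  exact (le_abs_self _).trans (hC y ⟨hy.1, hy.2.le⟩)

theorem opNorm_adjugate_le (M : Matrix (Fin 2) (Fin 2) ℝ) : opNorm M.adjugate ≤ 4 * opNorm M := by
  refine (opNorm_le_sum _).trans ?_
  have h := abs_apply_le_opNorm M
  simp only [Matrix.adjugate_fin_two, Matrix.of_apply, Matrix.cons_val_zero, Matrix.cons_val_one,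
    abs_neg, Matrix.cons_val']
  linarith [h 0 0, h 0 1, h 1 0, h 1 1]

theorem log_opNorm_mul_le {M N : Matrix (Fin 2) (Fin 2) ℝ} (hM : M.det = 1) (hN : N.det = 1) :
    Real.log (opNorm (M * N)) ≤ Real.log (opNorm M) + Real.log (opNorm N) := by
  have h1 := one_pos.trans_le (one_le_opNorm hM)
  have h2 := one_pos.trans_le (one_le_opNorm hN)
  rw [← Real.log_mul h1.ne' h2.ne']
  exact Real.log_le_log (one_pos.trans_le (one_le_opNorm (by rw [Matrix.det_mul, hM, hN, one_mul])))
    (opNorm_mul_le M N)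

theorem det_low (a : ℝ) : (low a).det = 1 := by simp [low, Matrix.det_fin_two_of]

theorem det_upp (a : ℝ) : (upp a).det = 1 := by simp [upp, Matrix.det_fin_two_of]

theorem det_hyp {c : ℝ} (hc : c ≠ 0) : (hyp c).det = 1 := by
  simp [hyp, Matrix.det_fin_two_of, hc]

theorem det_core (c : ℝ) : (core c).det = 1 := by rw [core, Matrix.det_fin_two_of]; ring

/-- The norm of the conjugated cocycle matrix. -/
theorem opNorm_hyp_core_le {l c t E : ℝ} (hl : 1 ≤ l) (hE : 1 ≤ E) (hc : 0 ≤ c) (hcE : c * E ≤ 1)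
    (ht : 0 ≤ t) (htE : t + 1 ≤ E) :
    opNorm (hyp l * (low (-t) * core c * upp t)) ≤ 5 * l * E := by
  have hl0 : 0 < l := by positivity
  have e : hyp l * (low (-t) * core c * upp t) = !![l * c, l * (c * (t + 1) - 1);
      l⁻¹ * (1 - c * (t + 1)), l⁻¹ * (2 * (t + 1) - c * (t + 1) * (t + 1))] := by
    ext i j
    fin_cases i <;> fin_cases j <;> simp [low, core, upp, hyp, -mul_eq_mul_left_iff] <;> ring
  have h1 : c * (t + 1) ≤ 1 := (mul_le_mul_of_nonneg_left htE hc).trans hcE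
  have h0 : 0 ≤ c * (t + 1) := by positivity
  have hc1 : c ≤ 1 := by nlinarith
  have hi0 : 0 < l⁻¹ := by positivity
  have hi : l⁻¹ ≤ 1 := inv_le_one_of_one_le₀ hl
  rw [e]
  refine (opNorm_le_sum _).trans ?_
  simp only [Matrix.of_apply, Matrix.cons_val_zero, Matrix.cons_val_one, Matrix.cons_val',
    Matrix.cons_val_fin_one, abs_mul, abs_of_pos hl0, abs_of_pos hi0]
  have b1 : |c| ≤ 1 := abs_le.2 ⟨by linarith, hc1⟩
  have b2 : |c * (t + 1) - 1| ≤ 1 := abs_le.2 ⟨by linarith, by linarith⟩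
  have b3 : |1 - c * (t + 1)| ≤ 1 := abs_le.2 ⟨by linarith, by linarith⟩
  have b4 : |2 * (t + 1) - c * (t + 1) * (t + 1)| ≤ 2 * E := abs_le.2 ⟨by nlinarith, by nlinarith⟩
  calc l * |c| + l * |c * (t + 1) - 1| + l⁻¹ * |1 - c * (t + 1)| +
        l⁻¹ * |2 * (t + 1) - c * (t + 1) * (t + 1)|
      ≤ l * 1 + l * 1 + 1 * 1 + 1 * (2 * E) := by gcongr
    _ ≤ 5 * l * E := by nlinarith

/-- Exchanging the axes in the middle of a hyperbolic orbit cancels the growth. -/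
theorem opNorm_hyp_core_hyp_le {l p p' E E' : ℝ} (hl : 1 ≤ l) (hE : 1 ≤ E) (hE' : 1 ≤ E')
    (hp : 0 < p) (hp' : 0 < p') (h1 : p * p'⁻¹ ≤ E') (h2 : p' * p⁻¹ ≤ E) (h3 : p⁻¹ ≤ E)
    (h4 : p'⁻¹ ≤ E') : opNorm (hyp p * (hyp l * core 0) * hyp p') ≤ 5 * l * (E * E') := by
  have hl0 : 0 < l := by positivity
  have hi0 : 0 < l⁻¹ := by positivity
  have hi : l⁻¹ ≤ 1 := inv_le_one_of_one_le₀ hl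
  have e : hyp p * (hyp l * core 0) * hyp p' = !![0, -(l * (p * p'⁻¹));
      l⁻¹ * (p' * p⁻¹), 2 * l⁻¹ * (p⁻¹ * p'⁻¹)] := by
    ext i j
    fin_cases i <;> fin_cases j <;> simp [core, hyp] <;> ring
  rw [e]
  refine (opNorm_le_sum _).trans ?_
  have c1 : 0 < l * (p * p'⁻¹) := by positivity
  have c2 : 0 < l⁻¹ * (p' * p⁻¹) := by positivity
  have c3 : 0 < 2 * l⁻¹ * (p⁻¹ * p'⁻¹) := by positivity
  simp only [Matrix.of_apply, Matrix.cons_val_zero, Matrix.cons_val_one, Matrix.cons_val',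
    Matrix.cons_val_fin_one, abs_neg, abs_zero, abs_of_pos c1, abs_of_pos c2, abs_of_pos c3]
  have g1 : E' ≤ E * E' := by nlinarith
  have g2 : E ≤ E * E' := by nlinarith
  have g3 : 0 ≤ E * E' := by positivity
  calc 0 + l * (p * p'⁻¹) + l⁻¹ * (p' * p⁻¹) + 2 * l⁻¹ * (p⁻¹ * p'⁻¹)
      ≤ 0 + l * (E * E') + 1 * (E * E') + 2 * 1 * (E * E') := by
        have k1 := h1.trans g1
        have k2 := h2.trans g2
        generalize p * p'⁻¹ = a at k1 ⊢
        generalize p' * p⁻¹ = b at k2 c2 ⊢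
        have k3 : 0 ≤ b := (pos_of_mul_pos_right c2 hi0.le).le
        gcongr
    _ ≤ 5 * l * (E * E') := by nlinarith

namespace Setup

variable {α s : ℝ} (S : Setup α s)

theorem continuous_eta (m : ℕ) : Continuous (S.eta m) :=
  (S.bump.smooth_pbump (by have := S.four_le_d m; omega)).continuous

theorem continuous_sol (l : ℝ) (N i : ℕ) (ω : ℝ) : Continuous (S.sol l N i ω) := by
  have h1 := S.continuous_eta
  have h2 := S.continuous_psi N
  unfold sol jumpAt jump
  fun_prop

theorem sol_add_one (l : ℝ) (N i : ℕ) (ω x : ℝ) : S.sol l N i ω (x + 1) = S.sol l N i ω x := by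
  have h1 : ∀ m y, S.eta m (y + 1) = S.eta m y := fun m y => pbump_add_one _ _ y
  have h2 : ∀ y, S.psi (S.J N) (y + 1) = S.psi (S.J N) y := S.psi_add_one _
  have h3 : ∀ j : ℕ, x + 1 - j * ω = x - j * ω + 1 := fun j => by ring
  have h4 : ∀ y c : ℝ, y + 1 + c = y + c + 1 := fun y c => by ring
  unfold sol jumpAt jump
  simp only [h3, h4 _ (_ * ω), h1, h2]

theorem continuous_conjProd (l : ℝ) (N i : ℕ) : Continuous (S.conjProd l N i) := by
  induction i with
  | zero => exact continuous_const
  | succ i ih =>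
    refine Continuous.matrix_mul (Continuous.matrix_mul ?_ ?_) ih
    · have := S.continuous_sol l N i α
      unfold low
      refine continuous_matrix fun a b => ?_
      fin_cases a <;> fin_cases b <;> simp <;> fun_prop
    · have := S.continuous_sol l N i (-α)
      unfold upp
      refine continuous_matrix fun a b => ?_
      fin_cases a <;> fin_cases b <;> simp <;> fun_prop

theorem conjProd_add_one (l : ℝ) (N i : ℕ) (x : ℝ) :
    S.conjProd l N i (x + 1) = S.conjProd l N i x := by
  induction i with
  | zero => rfl
  | succ i ih => rw [conjProd, conjProd, ih, conj, conj, add_sub_right_comm, sol_add_one, sol_add_one]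

theorem det_conjProd (l : ℝ) (N i : ℕ) (x : ℝ) : (S.conjProd l N i x).det = 1 := by
  induction i with
  | zero => simp [conjProd]
  | succ i ih => rw [conjProd, conj, Matrix.det_mul, Matrix.det_mul, det_low, det_upp, ih]; norm_num

/-- The cocycle and its conjugated form have the same growth up to a bounded factor. -/
theorem exists_log_opNorm_le {l : ℝ} (hl : l ≠ 0) (N : ℕ) : ∃ C, ∀ n x,
    Real.log (opNorm (cocIter α (S.coc l N) n x)) ≤
      C + Real.log (opNorm (cocIter α (S.stage l N (N + 1)) n x)) := by
  obtain ⟨C, hC⟩ := exists_le_of_periodic (f := fun x => opNorm (S.conjProd l N (N + 1) x))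
    (continuous_opNorm.comp (S.continuous_conjProd l N (N + 1)))
    (fun x => by simp only [conjProd_add_one])
  have hdc := det_cocIter (α := α) (S.det_coc hl N)
  have hdz := S.det_conjProd l N (N + 1)
  have hC1 : 1 ≤ C := (one_le_opNorm (hdz 0)).trans (hC 0)
  refine ⟨Real.log (4 * C) + Real.log C, fun n x => ?_⟩
  have h1 := S.conjProd_cocIter hl N n x
  have h2 := congrArg (fun M => (S.conjProd l N (N + 1) (x + n * α)).adjugate * M) h1
  rw [← mul_assoc, Matrix.adjugate_mul, hdz, one_smul, one_mul] at h2
  have hds : (cocIter α (S.stage l N (N + 1)) n x).det = 1 := by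
    have := congrArg Matrix.det h1
    rw [Matrix.det_mul, Matrix.det_mul, hdz, hdz, hdc] at this
    linarith
  have hda : (S.conjProd l N (N + 1) (x + n * α)).adjugate.det = 1 := by
    rw [Matrix.det_adjugate, hdz, one_pow]
  rw [h2]
  refine (log_opNorm_mul_le hda (by rw [Matrix.det_mul, hds, hdz, one_mul])).trans ?_
  have h3 := log_opNorm_mul_le hds (hdz x)
  have h4 := Real.log_le_log (one_pos.trans_le (one_le_opNorm hda))
    ((opNorm_adjugate_le _).trans (mul_le_mul_of_nonneg_left (hC (x + n * α)) (by norm_num)))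
  have h5 := Real.log_le_log (one_pos.trans_le (one_le_opNorm (hdz x))) (hC x)
  linarith

theorem det_stage_last {l : ℝ} (hl : l ≠ 0) (N : ℕ) (x : ℝ) :
    (S.stage l N (N + 1) x).det = 1 := by
  rw [stage_last]
  simp [det_hyp hl, det_low, det_core, det_upp]

theorem log_opNorm_stage_le {l : ℝ} (hl : 1 ≤ l) (N : ℕ) (x : ℝ) :
    Real.log (opNorm (S.stage l N (N + 1) x)) ≤ Real.log (5 * l) + S.psi (S.J N) x := by
  have hψ := S.psi_nonneg (S.J N) x
  have hE : 1 ≤ Real.exp (S.psi (S.J N) x) := Real.one_le_exp hψ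
  have hη0 : 0 ≤ S.eta (N + 1) x := S.bump.pbump_nonneg _ _
  have hη1 : S.eta (N + 1) x ≤ 1 := S.bump.pbump_le_one _ _
  have hχ0 : 0 ≤ pbump S.χ (S.J N) x := S.bump.pbump_nonneg _ _
  have hχ1 : pbump S.χ (S.J N) x ≤ 1 := S.bump.pbump_le_one _ _
  have hee : Real.exp (-S.psi (S.J N) x) * Real.exp (S.psi (S.J N) x) = 1 := by
    rw [← Real.exp_add]; simp
  have hc : 0 ≤ S.prof (S.J N) x := mul_nonneg (Real.exp_nonneg _) (by linarith)
  have h := opNorm_hyp_core_le (t := S.coord N (N + 1) x) hl hE hc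
    (by rw [prof]; nlinarith)
    (mul_nonneg (by linarith) (by linarith)) (by rw [coord]; nlinarith)
  rw [← stage_last] at h
  have h2 := Real.log_le_log
    (one_pos.trans_le (one_le_opNorm (S.det_stage_last (by positivity) N x))) h
  rwa [Real.log_mul (by positivity) (Real.exp_ne_zero _), Real.log_exp] at h2

theorem stage_last_center (l : ℝ) {N : ℕ} {x : ℝ} (hx : nd x < (1 / 2) ^ (S.J N + 1)) :
    S.stage l N (N + 1) x = hyp l * core 0 := by
  have h1 : pbump S.χ (S.J N) x = 1 := S.bump.pbump_eq_one hx.le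
  have h2 : S.eta (N + 1) x = 1 := S.bump.pbump_eq_one
    (hx.le.trans (pow_le_pow_of_le_one (by norm_num) (by norm_num) (Nat.le_succ _)))
  rw [stage_last, coord, prof, h1, h2]
  simp [low_zero, upp_zero]

/-- Visits to the `m`-th interval are separated. -/
theorem rho_le_nd_of_lt {m : ℕ} {i : ℤ} (hi : i ≠ 0) (h : |i| < S.sc.q m) {y : ℝ}
    (hy : nd y < (1 / 2) ^ S.sc.d m) : (1 / 2 : ℝ) ^ S.sc.d m ≤ nd (y + i * α) := by
  have h1 := S.sc.good m i hi h
  have h2 := nd_sub_le (y + i * α) y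
  rw [add_sub_cancel_left] at h2
  have : (0 : ℝ) < (1 / 2) ^ S.sc.d m := by positivity
  linarith

theorem half_pow_succ_J_le (N : ℕ) : (1 / 2 : ℝ) ^ (S.J N + 1) ≤ (1 / 2) ^ S.sc.d (N + 1) :=
  (pow_le_pow_of_le_one (by norm_num) (by norm_num) (Nat.le_succ _)).trans
    (S.half_pow_J_le le_rfl)

/-- The growth cancels along an orbit segment centred at a visit to the deepest interval. -/
theorem log_opNorm_window_le {l : ℝ} (hl : 1 ≤ l) {N w : ℕ} (hw : 2 * w < S.sc.q (N + 1)) {y : ℝ}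
    (hy : nd (y + w * α) < (1 / 2) ^ (S.J N + 1)) :
    Real.log (opNorm (cocIter α (S.stage l N (N + 1)) (2 * w + 1) y)) ≤
      Real.log (5 * l) + ∑ i ∈ Finset.range (2 * w + 1), S.psi (S.J N) (y + i * α) := by
  have hl0 : 0 < l := by positivity
  have hρ := hy.trans_le (S.half_pow_succ_J_le N)
  have hdiag : ∀ z, (∀ i < w, ∃ r : ℤ, r ≠ 0 ∧ |r| ≤ w ∧ z + i * α = y + w * α + r * α) →
      cocIter α (S.stage l N (N + 1)) w z =
        hyp (∏ i ∈ Finset.range w, l * Real.exp (-S.psi (S.J N) (z + i * α))) := by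
    intro z hz
    rw [← cocIter_hyp (fun y => l * Real.exp (-S.psi (S.J N) y))]
    refine cocIter_congr fun i hi => ?_
    obtain ⟨r, hr, hrw, e⟩ := hz i hi
    refine S.stage_last_eq_hyp l ?_
    rw [e]
    exact S.rho_le_nd_of_lt hr (by omega) hρ
  have hprod : ∀ z, ∏ i ∈ Finset.range w, l * Real.exp (-S.psi (S.J N) (z + i * α)) =
      l ^ w * Real.exp (-∑ i ∈ Finset.range w, S.psi (S.J N) (z + i * α)) := by
    intro z
    rw [Finset.prod_mul_distrib, ← Real.exp_sum]
    simp
  have hd1 := hdiag y fun i hi => ⟨(i : ℤ) - w, by omega, by rw [abs_le]; omega, by push_cast; ring⟩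
  have hd2 := hdiag (y + ((w + 1 : ℕ) : ℝ) * α) fun i hi =>
    ⟨(i : ℤ) + 1, by omega, by rw [abs_le]; omega, by push_cast; ring⟩
  have hsum : ∑ i ∈ Finset.range (2 * w + 1), S.psi (S.J N) (y + i * α) =
      ∑ i ∈ Finset.range w, S.psi (S.J N) (y + i * α) + S.psi (S.J N) (y + w * α) +
      ∑ i ∈ Finset.range w, S.psi (S.J N) (y + ((w + 1 : ℕ) : ℝ) * α + i * α) := by
    rw [show 2 * w + 1 = w + 1 + w by ring, Finset.sum_range_add, Finset.sum_range_succ]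
    congr 1
    refine Finset.sum_congr rfl fun i _ => ?_
    congr 1; push_cast; ring
  have hit : cocIter α (S.stage l N (N + 1)) (2 * w + 1) y =
      hyp (l ^ w * Real.exp (-∑ i ∈ Finset.range w,
        S.psi (S.J N) (y + ((w + 1 : ℕ) : ℝ) * α + i * α))) * (hyp l * core 0) *
      hyp (l ^ w * Real.exp (-∑ i ∈ Finset.range w, S.psi (S.J N) (y + i * α))) := by
    rw [show 2 * w + 1 = w + 1 + w by ring, cocIter_add, cocIter, hd1, hd2, hprod, hprod,
      S.stage_last_center l hy, mul_assoc (hyp (l ^ w * _))]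
  have hdet := det_cocIter (α := α) (S.det_stage_last hl0.ne' N) (2 * w + 1) y
  set a := ∑ i ∈ Finset.range w, S.psi (S.J N) (y + i * α)
  set b := ∑ i ∈ Finset.range w, S.psi (S.J N) (y + ((w + 1 : ℕ) : ℝ) * α + i * α)
  have ha : 0 ≤ a := Finset.sum_nonneg fun _ _ => S.psi_nonneg _ _
  have hb : 0 ≤ b := Finset.sum_nonneg fun _ _ => S.psi_nonneg _ _
  have hea := Real.one_le_exp ha
  have heb := Real.one_le_exp hb
  have hlw : 1 ≤ l ^ w := one_le_pow₀ hl
  have hinv : ∀ c, (l ^ w * Real.exp (-c))⁻¹ = (l ^ w)⁻¹ * Real.exp c := fun c => by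
    rw [mul_inv, Real.exp_neg, inv_inv]
  have hinv' : ∀ c, (l ^ w * Real.exp (-c))⁻¹ ≤ Real.exp c := fun c => by
    rw [hinv]
    exact mul_le_of_le_one_left (Real.exp_nonneg _) (inv_le_one_of_one_le₀ hlw)
  have hquot : ∀ c c', 0 ≤ c → l ^ w * Real.exp (-c) * (l ^ w * Real.exp (-c'))⁻¹ ≤ Real.exp c' := by
    intro c c' hc
    rw [hinv, mul_mul_mul_comm, mul_inv_cancel₀ (by positivity), one_mul]
    exact mul_le_of_le_one_left (Real.exp_nonneg _) (Real.exp_le_one_iff.2 (by linarith))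
  have h := opNorm_hyp_core_hyp_le hl heb hea (by positivity) (by positivity)
    (hquot b a hb) (hquot a b ha) (hinv' b) (hinv' a)
  rw [← hit] at h
  have h2 := Real.log_le_log (one_pos.trans_le (one_le_opNorm hdet)) h
  rw [Real.log_mul (by positivity) (by positivity), ← Real.exp_add, Real.log_exp] at h2
  rw [hsum]
  linarith [S.psi_nonneg (S.J N) (y + w * α)]

/-- Pointwise upper bound for the growth of the conjugated cocycle. -/
theorem log_opNorm_stage_iter_le {l : ℝ} (hl : 1 ≤ l) {N w : ℕ} (hw : 2 * w < S.sc.q (N + 1))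
    (n : ℕ) (x : ℝ) :
    Real.log (opNorm (cocIter α (S.stage l N (N + 1)) n x)) ≤
      n * Real.log (5 * l) + ∑ i ∈ Finset.range n, S.psi (S.J N) (x + i * α) -
        2 * w * Real.log (5 * l) *
          ∑ j ∈ Finset.Ico w (n - w), pbump S.χ (S.J N + 1) (x + j * α) := by
  have hl0 : l ≠ 0 := by positivity
  have hΛ : 0 ≤ Real.log (5 * l) := Real.log_nonneg (by linarith)
  have hd := S.det_stage_last hl0 N
  have hdi := det_cocIter (α := α) hd
  have hnd : ∀ z, pbump S.χ (S.J N + 1) z ≠ 0 → nd z < (1 / 2) ^ (S.J N + 1) := fun z hz => by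
    by_contra! h
    exact hz (S.bump.pbump_eq_zero h)
  induction n using Nat.strong_induction_on with
  | _ n ih =>
  rcases n with _ | m
  · simp [cocIter, opNorm_one]
  by_cases hcase : 2 * w ≤ m ∧ pbump S.χ (S.J N + 1) (x + (m - w : ℕ) * α) ≠ 0
  · obtain ⟨hwm, hne⟩ := hcase
    obtain ⟨n', rfl⟩ : ∃ n', m = n' + 2 * w := ⟨m - 2 * w, by omega⟩
    have hcen : x + (n' + 2 * w - w : ℕ) * α = x + n' * α + w * α := by
      rw [show n' + 2 * w - w = n' + w by omega]; push_cast; ring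
    have hy := hnd _ hne
    have hzero : ∀ j ∈ Finset.Ico w (n' + 2 * w - w), j ∉ Finset.Ico w (n' - w) →
        pbump S.χ (S.J N + 1) (x + j * α) = 0 := by
      intro j hj hj'
      rw [Finset.mem_Ico] at hj hj'
      by_contra h0
      have h1 := S.rho_le_nd_of_lt (m := N + 1) (i := (j : ℤ) - (n' + w)) (by omega)
        (by rw [abs_lt]; omega) (hy.trans_le (S.half_pow_succ_J_le N))
      have e : x + (n' + 2 * w - w : ℕ) * α + ((j : ℤ) - (n' + w) : ℤ) * α = x + j * α := by
        rw [hcen]; push_cast; ring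
      rw [e] at h1
      linarith [hnd _ h0, S.half_pow_succ_J_le N]
    have hsum : ∑ j ∈ Finset.Ico w (n' + 2 * w + 1 - w), pbump S.χ (S.J N + 1) (x + j * α) ≤
        ∑ j ∈ Finset.Ico w (n' - w), pbump S.χ (S.J N + 1) (x + j * α) + 1 := by
      rw [show n' + 2 * w + 1 - w = n' + 2 * w - w + 1 by omega,
        Finset.sum_Ico_succ_top (by omega),
        ← Finset.sum_subset (Finset.Ico_subset_Ico_right (by omega)) hzero]
      gcongr
      exact S.bump.pbump_le_one _ _
    have h1 := ih n' (by omega)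
    rw [hcen] at hy
    have h2 := S.log_opNorm_window_le hl hw hy
    have h3 := log_opNorm_mul_le (hdi (2 * w + 1) (x + n' * α)) (hdi n' x)
    rw [← cocIter_add] at h3
    have h4 : ∑ i ∈ Finset.range (n' + 2 * w + 1), S.psi (S.J N) (x + i * α) =
        ∑ i ∈ Finset.range n', S.psi (S.J N) (x + i * α) +
        ∑ i ∈ Finset.range (2 * w + 1), S.psi (S.J N) (x + n' * α + i * α) := by
      rw [add_assoc, Finset.sum_range_add]
      congr 1
      refine Finset.sum_congr rfl fun i _ => ?_
      congr 1; push_cast; ring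
    have h5 := mul_le_mul_of_nonneg_left hsum (by positivity : 0 ≤ 2 * w * Real.log (5 * l))
    rw [← add_assoc] at h3
    rw [h4]
    push_cast
    linarith
  · have hsum : ∑ j ∈ Finset.Ico w (m + 1 - w), pbump S.χ (S.J N + 1) (x + j * α) =
        ∑ j ∈ Finset.Ico w (m - w), pbump S.χ (S.J N + 1) (x + j * α) := by
      by_cases hwm : 2 * w ≤ m
      · have h0 : pbump S.χ (S.J N + 1) (x + (m - w : ℕ) * α) = 0 := by
          by_contra h0; exact hcase ⟨hwm, h0⟩
        rw [show m + 1 - w = m - w + 1 by omega, Finset.sum_Ico_succ_top (by omega), h0, add_zero]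
      · rw [Finset.Ico_eq_empty (by omega), Finset.Ico_eq_empty (by omega)]
    have h1 := ih m (Nat.lt_succ_self m)
    have h2 := log_opNorm_mul_le (hd (x + m * α)) (hdi m x)
    have h3 := S.log_opNorm_stage_le hl N (x + m * α)
    rw [hsum, cocIter, Finset.sum_range_succ]
    push_cast
    linarith

/-- Integrated upper bound for the growth of the cocycle. -/
theorem lyap_coc_le {l : ℝ} (hl : 1 ≤ l) {N : ℕ} (hA : Continuous (S.coc l N)) :
    lyap α (S.coc l N) ≤ (1 - 1 / 256) * Real.log (5 * l) + S.mean := by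
  have hl0 : l ≠ 0 := by positivity
  have hΛ : 0 ≤ Real.log (5 * l) := Real.log_nonneg (by linarith)
  obtain ⟨C, hC⟩ := S.exists_log_opNorm_le hl0 N
  obtain ⟨w, hw⟩ : ∃ w, w = (S.sc.q (N + 1) - 1) / 2 := ⟨_, rfl⟩
  have hq := S.q_pos (N + 1)
  have hw1 : 2 * w < S.sc.q (N + 1) := by omega
  have hw2 : S.sc.q (N + 1) ≤ 4 * w := by omega
  have hp : (S.sc.q (N + 1) : ℝ)⁻¹ ≤ 128 * (1 / 2) ^ (S.J N + 1) := by
    have h1 : (2 : ℝ) ^ S.sc.d (N + 1) ≤ 32 * S.sc.q (N + 1) := by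
      exact_mod_cast S.sc.pow_le (N + 1)
    have h2 : (1 / 2 : ℝ) ^ (S.J N + 1) = (4 * 2 ^ S.sc.d (N + 1))⁻¹ := by
      rw [J, one_div, inv_pow]; congr 1; ring
    rw [h2, ← div_eq_mul_inv, inv_le_iff_one_le_mul₀ (by positivity), div_mul_eq_mul_div,
      le_div_iff₀ (by positivity)]
    linarith
  have hgain : (1 : ℝ) / 256 ≤ 2 * w * (1 / 2) ^ (S.J N + 1) := by
    have h1 : (S.sc.q (N + 1) : ℝ) ≤ 4 * w := by exact_mod_cast hw2
    have h2 : (0 : ℝ) < S.sc.q (N + 1) := by exact_mod_cast (by omega : 0 < S.sc.q (N + 1))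
    have h3 : (1 : ℝ) ≤ S.sc.q (N + 1) * (128 * (1 / 2) ^ (S.J N + 1)) := by
      rwa [inv_le_iff_one_le_mul₀' h2] at hp
    have h4 : (0 : ℝ) < (1 / 2) ^ (S.J N + 1) := by positivity
    nlinarith
  have c1 := S.continuous_psi N
  have c2 : Continuous (pbump S.χ (S.J N + 1)) :=
    (S.bump.smooth_pbump (by have := S.two_le_j₀; have := S.j₀_lt_J N; omega)).continuous
  have h_int : ∀ n : ℕ, ∫ x in (0 : ℝ)..1, Real.log (opNorm (cocIter α (S.coc l N) n x)) ≤
      C + (n * Real.log (5 * l) + n * S.mean -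
        2 * w * Real.log (5 * l) * ((n - 2 * w) * (1 / 2) ^ (S.J N + 1))) := by
    intro n
    have hm := intervalIntegral.integral_mono_on (μ := volume) zero_le_one
      ((continuous_log_opNorm (α := α) hA (S.det_coc hl0 N) n).intervalIntegrable 0 1)
      (Continuous.intervalIntegrable (by fun_prop) _ _)
      (fun x _ => (hC n x).trans (add_le_add_right (S.log_opNorm_stage_iter_le hl hw1 n x) C))
    refine hm.trans ?_
    rw [intervalIntegral.integral_add (Continuous.intervalIntegrable (by fun_prop) _ _)
        (Continuous.intervalIntegrable (by fun_prop) _ _),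
      intervalIntegral.integral_sub (Continuous.intervalIntegrable (by fun_prop) _ _)
        (Continuous.intervalIntegrable (by fun_prop) _ _),
      intervalIntegral.integral_add (Continuous.intervalIntegrable (by fun_prop) _ _)
        (Continuous.intervalIntegrable (by fun_prop) _ _),
      intervalIntegral.integral_const_mul, intervalIntegral.integral_const_mul,
      integral_sum_translate c1 (S.psi_add_one _), integral_sum_translate c2 (pbump_add_one _ _)]
    simp only [intervalIntegral.integral_const, Finset.card_range, sub_zero, smul_eq_mul, one_mul,
      Nat.card_Ico]
    have h1 := S.integral_psi_le (S.J N)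
    have h2 := S.bump.le_integral_pbump (j := S.J N + 1)
      (by have := S.two_le_j₀; have := S.j₀_lt_J N; omega)
    have h3 : (n : ℝ) - 2 * w ≤ ((n - w - w : ℕ) : ℝ) := by
      rw [Nat.sub_sub, ← two_mul]
      have : n ≤ n - 2 * w + 2 * w := by omega
      have : (n : ℝ) ≤ (n - 2 * w : ℕ) + 2 * w := by exact_mod_cast this
      linarith
    have h4 : ((n : ℝ) - 2 * w) * (1 / 2) ^ (S.J N + 1) ≤ ((n - w - w : ℕ) : ℝ) *
        ∫ x in (0 : ℝ)..1, pbump S.χ (S.J N + 1) x :=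
      (mul_le_mul_of_nonneg_right h3 (by positivity)).trans
        (mul_le_mul_of_nonneg_left h2 (by positivity))
    have h5 := mul_le_mul_of_nonneg_left h4 (by positivity : 0 ≤ 2 * w * Real.log (5 * l))
    have h6 := mul_le_mul_of_nonneg_left h1 n.cast_nonneg
    linarith
  obtain ⟨E, hE⟩ : ∃ E, E = C + 2 * w * Real.log (5 * l) * (2 * w * (1 / 2) ^ (S.J N + 1)) :=
    ⟨_, rfl⟩
  have hlim : Tendsto (fun n : ℕ => (n : ℝ)⁻¹ * E +
      ((1 - 1 / 256) * Real.log (5 * l) + S.mean)) atTop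
      (nhds (0 * E + ((1 - 1 / 256) * Real.log (5 * l) + S.mean))) :=
    (tendsto_inv_atTop_nhds_zero_nat.mul_const E).add_const _
  rw [zero_mul, zero_add] at hlim
  refine lyap_le (S.det_coc hl0 N) (fun n hn => ?_) hlim
  have hn0 : (0 : ℝ) < n := by exact_mod_cast hn
  rw [growth, inv_mul_le_iff₀ hn0, mul_add, mul_inv_cancel_left₀ hn0.ne']
  refine (h_int n).trans ?_
  have h7 := mul_le_mul_of_nonneg_left hgain (by positivity : 0 ≤ n * Real.log (5 * l))
  rw [hE]
  linarith

end Setup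

theorem nonempty_setup {α : ℝ} (hα : Irrational α)
    (hSDC : ∃ γ : ℝ, 0 < γ ∧ ∃ τ : ℝ, 0 < τ ∧ ∀ᶠ n in atTop,
      (cfq α (n + 1) : ℝ) ≤ γ⁻¹ * (cfq α n : ℝ) * (Real.log (cfq α n : ℝ)) ^ τ)
    {s : ℝ} (hs : 2 < s) : Nonempty (Setup α s) := by
  obtain ⟨n, hn⟩ := exists_nat_one_div_lt (sub_pos.2 hs)
  obtain ⟨χ, K, M, hχ⟩ := exists_isBump (r := 2 * n + 1) ⟨n, rfl⟩
  have h1 : (1 : ℝ) / (2 * n + 1 : ℕ) ≤ 1 / (n + 1) := by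
    push_cast
    gcongr
    linarith [(Nat.cast_nonneg n : (0 : ℝ) ≤ n)]
  have h0 : (0 : ℝ) ≤ 1 / (2 * n + 1 : ℕ) := by positivity
  have hσ : 1 < s - (1 + 1 / ((2 * n + 1 : ℕ) : ℝ)) := by linarith
  obtain ⟨a, ha, ha1⟩ := exists_between ((div_lt_one (one_pos.trans hσ)).2 hσ)
  have ha0 : 0 < a := (one_div_pos.2 (one_pos.trans hσ)).trans ha
  obtain ⟨sc⟩ := nonempty_scales ha0 ha1 fun δ hδ => exists_goodDenom hα hSDC hδ
  exact ⟨{ s₁ := _, σ := _, a := a, K := K, M := M, χ := χ, one_le_s₁ := by linarith,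
           add_eq := by ring, σ_pos := one_pos.trans hσ, a_pos := ha0, a_lt := ha1,
           inv_lt := ha, bump := hχ, sc := sc }⟩

namespace Setup

variable {α s : ℝ} (S : Setup α s)

theorem mean_pos : 0 < S.mean := by
  have := S.Θ_lt_two
  exact mul_pos two_pos (inv_pos.2 (by linarith))

/-- For a large hyperbolicity parameter the lower bound for the limit exceeds the upper bound for
the approximating cocycles. -/
theorem exists_large (l₀ : ℝ) : ∃ l, l₀ ≤ l ∧ 1 ≤ l ∧
    0 < Real.log l * (1 - 2 * (1 / 2) ^ 13) - S.mean ∧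
    (1 - 1 / 256) * Real.log (5 * l) + S.mean <
      Real.log l * (1 - 2 * (1 / 2) ^ 13) - S.mean := by
  have hm := S.mean_pos
  obtain ⟨T, hT⟩ : ∃ T, T = |l₀| + 4096 * (2 * S.mean + 5) := ⟨_, rfl⟩
  have h0 := abs_nonneg l₀
  have h5 : Real.log 5 ≤ 5 - 1 := Real.log_le_sub_one_of_pos (by norm_num)
  refine ⟨Real.exp T, ?_, Real.one_le_exp (by linarith), ?_, ?_⟩
  · linarith [Real.add_one_le_exp T, le_abs_self l₀]
  · rw [Real.log_exp]; linarith
  · rw [Real.log_mul (by norm_num) (Real.exp_ne_zero _), Real.log_exp]; linarith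

end Setup

/-- Discontinuity of the Lyapunov exponent in the Gevrey class `G^s(S¹, SL(2,ℝ))`, `s > 2`,
for any fixed strong Diophantine frequency `α` (i.e. `q_{n+1} ≤ γ⁻¹ q_n (log q_n)^τ`):
there are `D ∈ G^s` with `L(α,D) > 0`, `K > 0`, and `A_j → D` in `‖·‖_{s,K}` with
`limsup_j L(α,A_j) < L(α,D)`. -/
theorem statement3 (α : ℝ) (hα : Irrational α)
    (hSDC : ∃ γ : ℝ, 0 < γ ∧ ∃ τ : ℝ, 0 < τ ∧ ∀ᶠ n in atTop,
      (cfq α (n + 1) : ℝ) ≤ γ⁻¹ * (cfq α n : ℝ) * (Real.log (cfq α n : ℝ)) ^ τ)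
    (s : ℝ) (hs : 2 < s) :
    ∃ D : ℝ → Matrix (Fin 2) (Fin 2) ℝ, ∃ K : ℝ, 0 < K ∧
      ∃ A : ℕ → ℝ → Matrix (Fin 2) (Fin 2) ℝ,
        Function.Periodic D 1 ∧ (∀ x, (D x).det = 1) ∧ MemGevrey s K D ∧
        (∀ j, Function.Periodic (A j) 1 ∧ (∀ x, ((A j) x).det = 1) ∧ MemGevrey s K (A j)) ∧
        0 < lyap α D ∧
        Tendsto (fun j : ℕ => gevreyNorm s K (fun x => A j x - D x)) atTop (nhds 0) ∧
        limsup (fun j : ℕ => lyap α (A j)) atTop < lyap α D := by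
  obtain ⟨S⟩ := nonempty_setup hα hSDC hs
  obtain ⟨l₀, -, hconv⟩ := S.exists_mconv
  obtain ⟨l, hl₀, hl, hpos, hgap⟩ := S.exists_large l₀
  obtain ⟨D, hD⟩ := hconv l hl₀
  have hl0 : l ≠ 0 := by positivity
  have hd := fun N => S.det_coc (l := l) hl0 N
  have hlow := S.le_lyap_limit hl hD
  obtain ⟨C, hC⟩ := hD.exists_opNorm_le
  refine ⟨D, 1, one_pos, S.coc l, hD.periodic_limit (S.coc_add_one l), hD.det_limit hd,
    hD.memGevrey_limit, fun j => ⟨S.coc_add_one l j, hd j, hD.memGevrey j⟩, hpos.trans_le hlow,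
    hD.tendsto_gevreyNorm, lt_of_le_of_lt ?_ (hgap.trans_le hlow)⟩
  refine limsup_le_of_le ?_ (Eventually.of_forall fun N => S.lyap_coc_le hl (hD.continuous N))
  exact (isBoundedUnder_of ⟨0, fun N => le_lyap (hD.continuous N) (hd N) (hC N) fun n _ =>
    growth_nonneg (hd N) n⟩ : IsBoundedUnder (· ≥ ·) atTop _).isCoboundedUnder_le
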